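/- arXiv:1901.07009 — 8 statements merged into one kernel-verified Lean document; each statement's English description precedes it below -/
import Mathlib

section
/- For every positive integer N, the error term R defined implicitly by the expansion p(n) = (2π²/(3√3)) · (e^{r_n}/(1 + 2r_n)²) · (1 − Σ_{ℓ=1}^{N} D_ℓ/(1 + 2r_n)^ℓ + R(n)) satisfies n^{N/2} · R(n) → 0 as n → ∞. -/
open Real Filter

/-- `r_n = √((2π²/3)(n − 1/24) + 1/4)`. -/
noncomputable def rseq (n : ℕ) : ℝ :=
  Real.sqrt (2 * Real.pi ^ 2 / 3 * ((n : ℝ) - 1 / 24) + 1 / 4)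

/-- `D_ℓ = (−1)^{ℓ+1}·((ℓ+1)/4^ℓ)·∑_{k=0}^{ℓ+1} (−1)^k·2^k·C(2ℓ,k)/(ℓ+1−k)!`. -/
noncomputable def Dcoef (l : ℕ) : ℝ :=
  (-1) ^ (l + 1) * (((l : ℝ) + 1) / 4 ^ l) *
    ∑ k ∈ Finset.range (l + 2),
      (-1) ^ k * 2 ^ k * (Nat.choose (2 * l) k : ℝ) / (Nat.factorial (l + 1 - k) : ℝ)

section TaylorPart

set_option linter.unusedSectionVars false

variable {𝕜 : Type*} [NontriviallyNormedField 𝕜] [CompleteSpace 𝕜] [CharZero 𝕜]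

/-- Taylor series at zero. -/
noncomputable def tay (f : 𝕜 → 𝕜) : PowerSeries 𝕜 :=
  PowerSeries.mk fun k => iteratedDeriv k f 0 / (k.factorial : 𝕜)

lemma coeff_tay (f : 𝕜 → 𝕜) (k : ℕ) :
    (tay f).coeff k = iteratedDeriv k f 0 / (k.factorial : 𝕜) := by
  simp [tay]

lemma tay_congr {f g : 𝕜 → 𝕜} (h : f =ᶠ[nhds 0] g) : tay f = tay g := by
  ext k
  rw [coeff_tay, coeff_tay, (h.iteratedDeriv_eq k)]

lemma tay_mul {f g : 𝕜 → 𝕜} (hf : AnalyticAt 𝕜 f 0) (hg : AnalyticAt 𝕜 g 0) :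
    tay (fun s => f s * g s) = tay f * tay g := by
  ext k
  rw [coeff_tay, PowerSeries.coeff_mul, iteratedDeriv_fun_mul hf.contDiffAt hg.contDiffAt,
    Finset.Nat.sum_antidiagonal_eq_sum_range_succ_mk, Finset.sum_div]
  refine Finset.sum_congr rfl fun i hi => ?_
  have hi' : i ≤ k := by simpa [Nat.lt_succ_iff] using hi
  rw [coeff_tay, coeff_tay, Nat.cast_choose 𝕜 hi']
  have h1 : (k.factorial : 𝕜) ≠ 0 := by exact_mod_cast k.factorial_ne_zero
  have h2 : (i.factorial : 𝕜) ≠ 0 := by exact_mod_cast i.factorial_ne_zero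
  have h3 : ((k - i).factorial : 𝕜) ≠ 0 := by exact_mod_cast (k - i).factorial_ne_zero
  field_simp

lemma tay_add {f g : 𝕜 → 𝕜} (hf : AnalyticAt 𝕜 f 0) (hg : AnalyticAt 𝕜 g 0) :
    tay (fun s => f s + g s) = tay f + tay g := by
  ext k
  rw [map_add, coeff_tay, coeff_tay, coeff_tay, iteratedDeriv_fun_add hf.contDiffAt hg.contDiffAt,
    add_div]

lemma tay_const (c : 𝕜) : tay (fun _ => c) = PowerSeries.C c := by
  ext k
  rw [coeff_tay, iteratedDeriv_const, PowerSeries.coeff_C]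
  split_ifs with h <;> simp [h]

lemma tay_id : tay (fun s : 𝕜 => s) = PowerSeries.X := by
  ext k
  rw [coeff_tay, PowerSeries.coeff_X]
  rcases k with _ | _ | k
  · simp
  · simp [iteratedDeriv_one]
  · have : iteratedDeriv (k + 1 + 1) (fun s : 𝕜 => s) = fun _ => 0 := by
      rw [iteratedDeriv_succ', iteratedDeriv_succ']
      ext x
      simp [iteratedDeriv_const]
    simp [this]

lemma tay_pow {f : 𝕜 → 𝕜} (hf : AnalyticAt 𝕜 f 0) (n : ℕ) :
    tay (fun s => f s ^ n) = tay f ^ n := by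
  induction n with
  | zero => simp [tay_const]
  | succ n ih =>
    simp_rw [pow_succ]
    rw [tay_mul (hf.fun_pow n) hf, ih]

lemma tay_deriv (f : 𝕜 → 𝕜) (k : ℕ) :
    (tay (deriv f)).coeff k = (k + 1) * (tay f).coeff (k + 1) := by
  rw [coeff_tay, coeff_tay, iteratedDeriv_succ', Nat.factorial_succ]
  have h1 : (k.factorial : 𝕜) ≠ 0 := by exact_mod_cast k.factorial_ne_zero
  have h2 : (k + 1 : 𝕜) ≠ 0 := by exact_mod_cast k.succ_ne_zero
  push_cast
  field_simp

lemma tay_X_pow_mul {g : 𝕜 → 𝕜} (hg : AnalyticAt 𝕜 g 0) (l : ℕ) :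
    tay (fun s => s ^ l * g s) = PowerSeries.X ^ l * tay g := by
  have h : AnalyticAt 𝕜 (fun s : 𝕜 => s) 0 := analyticAt_id
  rw [tay_mul (h.fun_pow l) hg, tay_pow h, tay_id]

lemma tay_coeff_zero (f : 𝕜 → 𝕜) : (tay f).coeff 0 = f 0 := by
  simp [coeff_tay]

lemma tay_sum {ι : Type*} (s : Finset ι) (f : ι → 𝕜 → 𝕜) (hf : ∀ i ∈ s, AnalyticAt 𝕜 (f i) 0) :
    tay (fun x => ∑ i ∈ s, f i x) = ∑ i ∈ s, tay (f i) := by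
  classical
  induction s using Finset.induction_on with
  | empty => simp [tay_const]
  | insert a s ha ih =>
    simp_rw [Finset.sum_insert ha]
    rw [tay_add (hf a (by simp)), ih]
    · exact fun i hi => hf i (by simp [hi])
    · exact Finset.analyticAt_fun_sum _ fun i hi => hf i (by simp [hi])

lemma tay_prod {ι : Type*} (s : Finset ι) (f : ι → 𝕜 → 𝕜) (hf : ∀ i ∈ s, AnalyticAt 𝕜 (f i) 0) :
    tay (fun x => ∏ i ∈ s, f i x) = ∏ i ∈ s, tay (f i) := by
  classical
  induction s using Finset.induction_on with
  | empty => simp [tay_const]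
  | insert a s ha ih =>
    simp_rw [Finset.prod_insert ha]
    rw [tay_mul (hf a (by simp)), ih]
    · exact fun i hi => hf i (by simp [hi])
    · exact Finset.analyticAt_fun_prod _ fun i hi => hf i (by simp [hi])

end TaylorPart

section CoefPart

lemma coeff_lin_pow (m j : ℕ) :
    ((1 + PowerSeries.C (1/2 : ℝ) * PowerSeries.X) ^ m).coeff j = (m.choose j : ℝ) / 2 ^ j := by
  have : (1 + PowerSeries.C (1/2 : ℝ) * PowerSeries.X) ^ m
      = PowerSeries.rescale (1/2 : ℝ) ((1 + PowerSeries.X) ^ m) := by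
    simp [PowerSeries.rescale_X]
  rw [this, PowerSeries.coeff_rescale]
  have h2 : ((1 + PowerSeries.X : PowerSeries ℝ) ^ m)
      = (((1 + Polynomial.X : Polynomial ℝ) ^ m : Polynomial ℝ) : PowerSeries ℝ) := by
    simp
  rw [h2, Polynomial.coeff_coe, Polynomial.coeff_one_add_X_pow]
  simp [div_eq_mul_inv, mul_comm]

lemma tay_lin (c : ℝ) : tay (fun s : ℝ => 1 + c * s) = 1 + PowerSeries.C c * PowerSeries.X := by
  rw [tay_add (by fun_prop) (by fun_prop), tay_mul (by fun_prop) (by fun_prop), tay_const, tay_const,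
    tay_id]
  simp

lemma tay_exp (c : ℝ) (k : ℕ) :
    (tay (fun s : ℝ => Real.exp (c * s))).coeff k = c ^ k / k.factorial := by
  rw [coeff_tay, iteratedDeriv_exp_const_mul]
  simp

/-- auxiliary function -/
noncomputable def fk (k : ℕ) (s : ℝ) : ℝ := Real.exp (-(1/4) * s) * (1 + 1/2 * s) ^ (2 * k)

lemma fk_analytic (k : ℕ) : AnalyticAt ℝ (fk k) 0 := by
  unfold fk; fun_prop

lemma fk_coeff (k : ℕ) : 4 * ((k : ℝ) + 1) * (tay (fk k)).coeff (k + 1) = Dcoef k := by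
  unfold fk Dcoef
  rw [tay_mul (by fun_prop) (by fun_prop), tay_pow (by fun_prop), tay_lin, mul_comm (tay _),
    PowerSeries.coeff_mul, Finset.Nat.sum_antidiagonal_eq_sum_range_succ_mk, Finset.mul_sum,
    Finset.mul_sum]
  refine Finset.sum_congr rfl fun j hj => ?_
  have hj' : j ≤ k + 1 := by simpa [Nat.lt_succ_iff] using hj
  obtain ⟨i, hi⟩ := Nat.exists_eq_add_of_le hj'
  rw [coeff_lin_pow, tay_exp]
  simp only [hi, Nat.add_sub_cancel_left]
  have h4 : (4 : ℝ) ^ k * 4 = 2 ^ j * 2 ^ j * 4 ^ i := by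
    rw [← pow_succ, hi, pow_add, ← mul_pow]; norm_num
  have h4' : (4 : ℝ) ^ k = 2 ^ j * 2 ^ j * 4 ^ i / 4 := by linarith
  have h1 : ((-1 : ℝ)) ^ (j + i) = (-1) ^ j * (-1) ^ i := pow_add _ _ _
  have h5 : (-(1/4 : ℝ)) ^ i = (-1) ^ i / 4 ^ i := by
    rw [show (-(1/4 : ℝ)) = (-1) / 4 by norm_num, div_pow]
  have h6 : ((-1 : ℝ) ^ j) * (-1) ^ j = 1 := by rw [← mul_pow]; simp
  rw [h1, h5, h4']
  field_simp
  linear_combination (-((2 * k).choose j : ℝ)) * h6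

/-- the expansion function in the variable `s` -/
noncomputable def Hf (s : ℝ) : ℝ :=
  (1 + 1/2 * s) / (1 - 1/2 * s) ^ 3 * (1 - 2 * s - s ^ 2 / 4) * Real.exp (-(1/4) * s)

/-- the variable `x` in terms of `s` -/
noncomputable def xf (s : ℝ) : ℝ := s / (1 + 1/2 * s) ^ 2

/-- multiplier -/
noncomputable def mk' (k : ℕ) (s : ℝ) : ℝ := (1 + 1/2 * s) ^ (2 * k) * ((1 - 1/2 * s) / (1 + 1/2 * s))

lemma mk'_analytic (k : ℕ) : AnalyticAt ℝ (mk' k) 0 := by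
  unfold mk'
  fun_prop (disch := norm_num)

lemma xf_analytic : AnalyticAt ℝ xf 0 := by
  unfold xf
  fun_prop (disch := norm_num)

lemma Hf_analytic : AnalyticAt ℝ Hf 0 := by
  unfold Hf
  fun_prop (disch := norm_num)

lemma near_ne : ∀ᶠ s : ℝ in nhds 0, (1 + 1/2 * s) ≠ 0 ∧ (1 - 1/2 * s) ≠ 0 := by
  filter_upwards [Metric.ball_mem_nhds (0 : ℝ) one_pos] with s hs
  simp [abs_lt] at hs
  constructor <;> (apply ne_of_gt; linarith)

lemma fk_deriv (k : ℕ) (s : ℝ) (hs : (1 + 1/2 * s) ≠ 0) :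
    HasDerivAt (fk k) (fk k s * (-(1/4) + k / (1 + 1/2 * s))) s := by
  have h1 : HasDerivAt (fun s : ℝ => Real.exp (-(1/4) * s))
      (Real.exp (-(1/4) * s) * (-(1/4) * 1)) s := ((hasDerivAt_id s).const_mul _).exp
  have h2 : HasDerivAt (fun s : ℝ => (1 + 1/2 * s) ^ (2 * k))
      ((2 * k : ℕ) * (1 + 1/2 * s) ^ (2 * k - 1) * (1/2 * 1)) s :=
    (((hasDerivAt_id s).const_mul _).const_add _).pow _
  refine (h1.mul h2).congr_deriv ?_
  unfold fk
  rcases k with _ | k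
  · simp
  · rw [show 2 * (k + 1) - 1 = 2 * k + 1 by omega, show 2 * (k + 1) = 2 * k + 1 + 1 by ring,
      pow_succ (1 + 1/2 * s) (2 * k + 1)]
    push_cast
    generalize 1 + 1/2 * s = X at *
    field_simp
    ring

lemma Hm_coeff (k : ℕ) : (tay (fun s => Hf s * mk' k s)).coeff k = - Dcoef k := by
  set A : ℝ → ℝ := fun s => -4 * fk k s / (1 - 1/2 * s) with hA
  have hfk := fk_analytic k
  have hAa : AnalyticAt ℝ A 0 := by
    rw [hA]; fun_prop (disch := norm_num)
  have key : (fun s => Hf s * mk' k s) =ᶠ[nhds 0]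
      fun s => (s ^ 1 * deriv A s + (-(k : ℝ)) * A s) + (-4) * deriv (fk k) s := by
    filter_upwards [near_ne] with s hs
    have hd := fk_deriv k s hs.1
    have hdA : HasDerivAt A (((-4 * (fk k s * (-(1/4) + k / (1 + 1/2 * s)))) * (1 - 1/2 * s)
        - (-4 * fk k s) * (-(1/2 * 1))) / (1 - 1/2 * s) ^ 2) s :=
      (hd.const_mul _).div (((hasDerivAt_id s).const_mul _).const_sub _) hs.2
    rw [hd.deriv, hdA.deriv, hA]
    have e : Hf s * mk' k s = fk k s * ((1 - 2 * s - s ^ 2 / 4) / (1 - 1/2 * s) ^ 2) := by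
      unfold Hf mk' fk
      obtain ⟨h1, h2⟩ := hs
      generalize hX : 1 + 1/2 * s = X at *
      generalize hY : 1 - 1/2 * s = Y at *
      field_simp
    rw [e]
    obtain ⟨h1, h2⟩ := hs
    have h1' : (2 + s) ≠ 0 := fun h => h1 (by linarith)
    have h2' : (2 - s) ≠ 0 := fun h => h2 (by linarith)
    beta_reduce
    generalize fk k s = G
    field_simp
    ring
  rw [tay_congr key, tay_add _ (by fun_prop), tay_add, tay_X_pow_mul, tay_mul, tay_mul, tay_const,
    tay_const, map_add, map_add, PowerSeries.coeff_C_mul, PowerSeries.coeff_C_mul, tay_deriv,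
    ← fk_coeff]
  · rcases k with _ | k
    · simp
    · rw [pow_one, PowerSeries.coeff_succ_X_mul, tay_deriv]
      push_cast
      ring
  all_goals fun_prop

lemma xm_coeff (k l : ℕ) : (tay (fun s => xf s ^ l * mk' k s)).coeff k = if l = k then 1 else 0 := by
  rcases lt_or_ge l k with h | h
  · obtain ⟨e, rfl⟩ := Nat.exists_eq_add_of_lt h
    have key : (fun s => xf s ^ l * mk' (l + e + 1) s) =ᶠ[nhds 0]
        fun s => s ^ l * ((1 + (-1/2) * s) * (1 + 1/2 * s) ^ (2 * e + 1)) := by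
      filter_upwards [near_ne] with s hs
      unfold xf mk'
      obtain ⟨h1, h2⟩ := hs
      rw [show (1 + (-1/2) * s) = 1 - 1/2 * s by ring]
      generalize hX : 1 + 1/2 * s = X at *
      generalize hY : 1 - 1/2 * s = Y at *
      rw [show 2 * (l + e + 1) = 2 * l + (2 * e + 1) + 1 by ring, div_pow, pow_succ X (_ + _),
        pow_add X (2 * l), pow_mul]
      field_simp
    rw [if_neg (by omega), tay_congr key, tay_X_pow_mul (by fun_prop),
      tay_mul (by fun_prop) (by fun_prop), tay_pow (by fun_prop), tay_lin, tay_lin,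
      PowerSeries.coeff_X_pow_mul', if_pos (by omega), show l + e + 1 - l = e + 1 by omega, add_mul,
      one_mul, map_add, mul_assoc, PowerSeries.coeff_C_mul, PowerSeries.coeff_succ_X_mul,
      coeff_lin_pow, coeff_lin_pow]
    have : (2 * e + 1).choose (e + 1) = (2 * e + 1).choose e := Nat.choose_symm_half e
    rw [this, pow_succ]
    field_simp
    ring
  · obtain ⟨e, rfl⟩ := Nat.exists_eq_add_of_le h
    have key : (fun s => xf s ^ (k + e) * mk' k s) =ᶠ[nhds 0]
        fun s => s ^ (k + e) * ((1 - 1/2 * s) / (1 + 1/2 * s) / (1 + 1/2 * s) ^ (2 * e)) := by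
      filter_upwards [near_ne] with s hs
      unfold xf mk'
      obtain ⟨h1, h2⟩ := hs
      generalize hX : 1 + 1/2 * s = X at *
      generalize hY : 1 - 1/2 * s = Y at *
      rw [div_pow, ← pow_mul, mul_add, pow_add X]
      field_simp
    rw [tay_congr key, tay_X_pow_mul (by fun_prop (disch := norm_num)), PowerSeries.coeff_X_pow_mul']
    rcases e with _ | e
    · rw [if_pos (by simp), if_pos (by simp)]
      simp [tay_coeff_zero]
    · rw [if_neg (by omega), if_neg (by omega)]

/-- The truncated expansion error is `O(s^(N+1))`. -/
lemma expansion_isBigO (N : ℕ) :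
    (fun s => Hf s + ∑ l ∈ Finset.range (N + 1), Dcoef l * xf s ^ l) =O[nhds 0]
      fun s => s ^ (N + 1) := by
  set E : ℝ → ℝ := fun s => Hf s + ∑ l ∈ Finset.range (N + 1), Dcoef l * xf s ^ l with hE
  have hx := xf_analytic
  have hH := Hf_analytic
  have hEa : AnalyticAt ℝ E 0 := by
    rw [hE]
    exact hH.fun_add (Finset.analyticAt_fun_sum _ fun i hi => by fun_prop)
  have hLk : ∀ k < N + 1, (tay (fun s => E s * mk' k s)).coeff k = 0 := by
    intro k hk
    have hm := mk'_analytic k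
    have : (fun s => E s * mk' k s) = fun s => Hf s * mk' k s +
        ∑ l ∈ Finset.range (N + 1), Dcoef l * (xf s ^ l * mk' k s) := by
      ext s
      simp only [hE, add_mul, Finset.sum_mul, mul_assoc]
    rw [this, tay_add (by fun_prop) (Finset.analyticAt_fun_sum _ fun i hi => by fun_prop),
      tay_sum _ _ (fun i hi => by fun_prop), map_add, map_sum, Hm_coeff]
    have : ∀ l ∈ Finset.range (N + 1), (tay (fun s => Dcoef l * (xf s ^ l * mk' k s))).coeff k
        = if l = k then Dcoef l else 0 := by
      intro l hl
      rw [tay_mul (by fun_prop) (by fun_prop), tay_const, PowerSeries.coeff_C_mul, xm_coeff]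
      simp
    rw [Finset.sum_congr rfl this, Finset.sum_ite_eq' _ _ _, if_pos (by simpa using hk)]
    simp
  have hcoef : ∀ k < N + 1, (tay E).coeff k = 0 := by
    intro k
    induction k using Nat.strong_induction_on with
    | _ k ih =>
      intro hk
      have h := hLk k hk
      rw [tay_mul hEa (mk'_analytic k), PowerSeries.coeff_mul,
        Finset.sum_eq_single (k, 0)] at h
      · rw [tay_coeff_zero] at h
        simpa [mk'] using h
      · rintro ⟨i, j⟩ hij hne
        have hs : i + j = k := by simpa using hij
        have : i < k := by
          rcases Nat.eq_zero_or_pos j with rfl | hj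
          · exact absurd (by simpa using hs) (fun h => hne (by simp [h]))
          · omega
        simp [ih i this (by omega)]
      · simp
  have hord : ((N + 1 : ℕ) : ℕ∞) ≤ analyticOrderAt E 0 := by
    rw [natCast_le_analyticOrderAt_iff_iteratedDeriv_eq_zero hEa]
    intro i hi
    have := hcoef i hi
    rw [coeff_tay, div_eq_zero_iff] at this
    exact this.resolve_right (by exact_mod_cast i.factorial_ne_zero)
  obtain ⟨g, hg, hEg⟩ := (natCast_le_analyticOrderAt hEa).1 hord
  have h1 : E =ᶠ[nhds 0] fun s => s ^ (N + 1) * g s := by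
    filter_upwards [hEg] with s hs
    simpa using hs
  refine h1.trans_isBigO ?_
  have h2 : g =O[nhds 0] fun _ => (1 : ℝ) := hg.continuousAt.isBigO_one ℝ
  simpa using (Asymptotics.isBigO_refl (fun s : ℝ => s ^ (N + 1)) (nhds 0)).mul h2

end CoefPart
section GenFunPart

open Complex in
/-- Euler function -/
noncomputable def ef (q : ℂ) : ℂ := ∏' n : ℕ, (1 - q ^ (n + 1))

lemma ef_diff : DifferentiableOn ℂ ef (Metric.ball (0 : ℂ) 1) :=
  ModularForm.differentiableOn_tprod_one_sub_pow

lemma ef_ne_zero {q : ℂ} (hq : ‖q‖ < 1) : ef q ≠ 0 := by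
  unfold ef
  have h : Summable fun n : ℕ => ‖-q ^ (n + 1)‖ := by
    simpa using (summable_nat_add_iff 1).mpr (summable_geometric_of_lt_one (norm_nonneg _) hq)
  have := tprod_one_add_ne_zero_of_summable (f := fun n : ℕ => -q ^ (n + 1)) ?_ h
  · simpa [sub_eq_add_neg] using this
  · intro i h0
    have h1 : q ^ (i + 1) = 1 := by linear_combination -h0
    have h2 : ‖q‖ ^ (i + 1) = 1 := by rw [← norm_pow, h1]; simp
    have h3 : ‖q‖ ^ (i + 1) < 1 := pow_lt_one₀ (norm_nonneg _) hq (by simp)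
    linarith

lemma iter_tendsto {ι : Type*} {F : ι → ℂ → ℂ} {f : ℂ → ℂ} {φ : Filter ι} {U : Set ℂ}
    (hU : IsOpen U) (k : ℕ) :
    ∀ (F : ι → ℂ → ℂ) (f : ℂ → ℂ) (_ : TendstoLocallyUniformlyOn F f φ U)
    (_ : ∀ i, DifferentiableOn ℂ (F i) U) (z : ℂ) (_ : z ∈ U),
    Tendsto (fun i => iteratedDeriv k (F i) z) φ (nhds (iteratedDeriv k f z)) := by
  induction k with
  | zero =>
    intro F f hf hF z hz
    simpa using hf.tendsto_at hz
  | succ k ih =>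
    intro F f hf hF z hz
    simp_rw [iteratedDeriv_succ']
    exact ih _ _ (hf.deriv (.of_forall hF) hU) (fun i => (hF i).deriv hU) z hz

lemma tay_ef : tay ef = PowerSeries.pentagonalSeries ℂ := by
  ext k
  have hlu : TendstoLocallyUniformlyOn (fun (s : Finset ℕ) (q : ℂ) => ∏ i ∈ s, (1 - q ^ (i + 1)))
      ef Filter.atTop (Metric.ball (0 : ℂ) 1) :=
    ModularForm.multipliableLocallyUniformlyOn_one_sub_pow.hasProdLocallyUniformlyOn
  have h1 := iter_tendsto (F := fun (s : Finset ℕ) (q : ℂ) => ∏ i ∈ s, (1 - q ^ (i + 1)))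
    (f := ef) Metric.isOpen_ball k _ _ hlu (fun i => by fun_prop) 0 (by simp)
  have h2 : Tendsto (fun s : Finset ℕ =>
      (tay (fun q : ℂ => ∏ i ∈ s, (1 - q ^ (i + 1)))).coeff k) atTop (nhds ((tay ef).coeff k)) := by
    simp_rw [coeff_tay]
    exact h1.div_const _
  refine tendsto_nhds_unique h2 ?_
  apply tendsto_nhds_of_eventually_eq
  filter_upwards [PowerSeries.coeff_prod_one_sub_X_pow_eventually_eq ℂ k] with s hs
  rw [← hs, tay_prod _ _ (fun i hi => by fun_prop)]
  congr 1
  refine Finset.prod_congr rfl fun i hi => ?_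
  have : (fun q : ℂ => 1 - q ^ (i + 1)) = fun q => 1 + (-1) * (q ^ (i + 1)) := by ext; ring
  rw [this, tay_add (by fun_prop) (by fun_prop), tay_mul (by fun_prop) (by fun_prop), tay_const,
    tay_const, tay_pow (by fun_prop), tay_id]
  simp [sub_eq_add_neg]

open PowerSeries.WithPiTopology in
lemma card_mul_pent :
    (PowerSeries.mk fun n => (Fintype.card (Nat.Partition n) : ℂ)) * PowerSeries.pentagonalSeries ℂ
      = 1 := by
  have h1 := Nat.Partition.hasProd_powerSeriesMk_card_restricted ℂ (fun _ => True)
  have h2 := PowerSeries.WithPiTopology.hasProd_one_sub_X_pow ℂ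
  have h3 := h1.mul h2
  have h4 : (fun i : ℕ => (if True then ∑' j : ℕ, (PowerSeries.X : PowerSeries ℂ) ^ ((i + 1) * j) else 1)
      * (1 - PowerSeries.X ^ (i + 1))) = fun _ => 1 := by
    ext1 i
    simp_rw [if_true, pow_mul]
    rw [PowerSeries.WithPiTopology.tsum_pow_mul_one_sub_of_constantCoeff_eq_zero (by simp)]
  rw [h4] at h3
  have h5 := h3.unique hasProd_one
  rw [← h5]
  congr 2
  ext1 n
  simp [Nat.Partition.restricted]

lemma efinv_diff : DifferentiableOn ℂ (fun q => (ef q)⁻¹) (Metric.ball (0 : ℂ) 1) :=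
  ef_diff.fun_inv fun q hq => ef_ne_zero (by simpa using hq)

lemma card_eq_iter (n : ℕ) :
    iteratedDeriv n (fun q => (ef q)⁻¹) 0 / n.factorial = (Fintype.card (Nat.Partition n) : ℂ) := by
  have ha : AnalyticAt ℂ ef 0 := ef_diff.analyticAt (Metric.ball_mem_nhds _ one_pos)
  have hb : AnalyticAt ℂ (fun q => (ef q)⁻¹) 0 :=
    efinv_diff.analyticAt (Metric.ball_mem_nhds _ one_pos)
  have h1 : tay (fun q => (ef q)⁻¹) * tay ef = 1 := by
    rw [← tay_mul hb ha]
    have : (fun s => (ef s)⁻¹ * ef s) =ᶠ[nhds 0] fun _ => 1 := by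
      filter_upwards [Metric.ball_mem_nhds (0 : ℂ) one_pos] with q hq
      exact inv_mul_cancel₀ (ef_ne_zero (by simpa using hq))
    rw [tay_congr this, tay_const]; simp
  have h2 : tay (fun q => (ef q)⁻¹) = PowerSeries.mk fun n => (Fintype.card (Nat.Partition n) : ℂ) := by
    rw [tay_ef] at h1
    calc _ = tay (fun q => (ef q)⁻¹) * ((PowerSeries.mk fun n => (Fintype.card (Nat.Partition n) : ℂ))
        * PowerSeries.pentagonalSeries ℂ) := by rw [card_mul_pent, mul_one]
      _ = _ := by rw [mul_comm (PowerSeries.mk _), ← mul_assoc, h1, one_mul]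
  rw [← coeff_tay, h2]
  simp

open Complex in
/-- integrand -/
noncomputable def gint (n : ℕ) (a : ℝ) (θ : ℝ) : ℂ :=
  (ef (cexp (-(a + θ * I))))⁻¹ * cexp (n * (a + θ * I))

open Complex in
lemma gint_continuous (n : ℕ) {a : ℝ} (ha : 0 < a) : Continuous (gint n a) := by
  unfold gint
  refine Continuous.mul ?_ (by fun_prop)
  refine efinv_diff.continuousOn.comp_continuous (by fun_prop) fun θ => ?_
  simp [Complex.norm_exp, ha]

open Complex in
lemma card_eq_integral (n : ℕ) {a : ℝ} (ha : 0 < a) :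
    (Fintype.card (Nat.Partition n) : ℂ) = 1 / (2 * π) * ∫ θ in (-π)..π, gint n a θ := by
  have hR : 0 < Real.exp (-a) := Real.exp_pos _
  have hR1 : Real.exp (-a) < 1 := by simpa using ha
  have hd : DiffContOnCl ℂ (fun q => (ef q)⁻¹) (Metric.ball 0 (Real.exp (-a))) :=
    (efinv_diff.mono (Metric.closedBall_subset_ball hR1)).diffContOnCl_ball le_rfl
  have h := hd.circleIntegral_one_div_sub_center_pow_smul hR n
  rw [circleIntegral] at h
  have h2 : ∀ θ : ℝ, deriv (circleMap 0 (Real.exp (-a))) θ •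
      (fun z : ℂ => (1 / (z - 0) ^ (n + 1)) • (ef z)⁻¹) (circleMap 0 (Real.exp (-a)) θ)
      = I * gint n a (-θ) := by
    intro θ
    have hc : circleMap 0 (Real.exp (-a)) θ = cexp (-(a + (-θ : ℝ) * I)) := by
      rw [circleMap_zero, ofReal_exp, ← Complex.exp_add]
      congr 1
      push_cast; ring
    have hne : circleMap 0 (Real.exp (-a)) θ ≠ 0 := by rw [hc]; exact exp_ne_zero _
    simp only [deriv_circleMap, smul_eq_mul, sub_zero, gint]
    rw [← hc, Complex.exp_nat_mul,
      show cexp ((a : ℂ) + (-θ : ℝ) * I) = (circleMap 0 (Real.exp (-a)) θ)⁻¹ by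
        rw [hc, ← Complex.exp_neg, neg_neg]]
    generalize circleMap 0 (Real.exp (-a)) θ = c at *
    rw [inv_pow, pow_succ]
    field_simp
  simp_rw [h2] at h
  rw [intervalIntegral.integral_const_mul,
    intervalIntegral.integral_comp_neg (f := gint n a)] at h
  have hper : Function.Periodic (gint n a) (2 * π) := by
    intro θ
    simp only [gint]
    congr 1
    · congr 2
      rw [show -((a : ℂ) + ((θ + 2 * π : ℝ) : ℂ) * I) = -(a + θ * I) - 2 * π * I by push_cast; ring]
      exact Complex.exp_periodic.sub_eq _
    · rw [show (n : ℂ) * ((a : ℂ) + ((θ + 2 * π : ℝ) : ℂ) * I) = n * (a + θ * I) + n * (2 * π * I) by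
        push_cast; ring]
      exact (Complex.exp_periodic.nat_mul n) _
  have h3 := hper.intervalIntegral_add_eq (-(2 * π)) (-π)
  rw [show -(2 * π) + 2 * π = -0 by ring, show -π + 2 * π = π by ring] at h3
  rw [h3] at h
  rw [← card_eq_iter, smul_eq_mul] at *
  have hpi : (π : ℂ) ≠ 0 := by exact_mod_cast Real.pi_ne_zero
  have h4 : (∫ θ in (-π)..π, gint n a θ) = 2 * π / n.factorial * iteratedDeriv n (fun q => (ef q)⁻¹) 0 := by
    apply mul_left_cancel₀ I_ne_zero
    rw [h]; ring
  rw [h4]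
  field_simp

end GenFunPart

section EtaPart

open Complex

lemma my_mul_cpow {x y : ℂ} (hx : x ≠ 0) (hy : y ≠ 0) (h : arg x + arg y ∈ Set.Ioc (-π) π) (r : ℂ) :
    (x * y) ^ r = x ^ r * y ^ r := by
  rw [cpow_def_of_ne_zero (mul_ne_zero hx hy), cpow_def_of_ne_zero hx, cpow_def_of_ne_zero hy,
    (Complex.log_mul_eq_add_log_iff hx hy).mpr h, add_mul, Complex.exp_add]

lemma csqrt_I_mul {w : ℂ} (hw : 0 < w.re) : Complex.sqrt (I * w) = Complex.sqrt I * Complex.sqrt w := by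
  have hw0 : w ≠ 0 := by rintro rfl; simp at hw
  have h := Complex.abs_arg_lt_pi_div_two_iff.mpr (Or.inl hw)
  rw [abs_lt] at h
  unfold Complex.sqrt
  rw [my_mul_cpow I_ne_zero hw0]
  simp only [arg_I, Set.mem_Ioc]
  constructor <;> linarith [Real.pi_pos]

lemma csqrt_real_mul {b : ℝ} (hb : 0 < b) {w : ℂ} (hw : w ≠ 0) :
    Complex.sqrt (b * w) = (Real.sqrt b : ℂ) * Complex.sqrt w := by
  have h1 : Complex.sqrt (b : ℂ) = (Real.sqrt b : ℂ) := by
    rw [Complex.sqrt_of_nonneg (by exact_mod_cast hb.le)]; simp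
  rw [← h1]
  unfold Complex.sqrt
  rw [my_mul_cpow (by exact_mod_cast hb.ne') hw]
  rw [Complex.arg_ofReal_of_nonneg hb.le, zero_add]
  exact Complex.arg_mem_Ioc _

lemma ef_transf {ζ : ℂ} (hζ : 0 < ζ.re) :
    (ef (cexp (-ζ)))⁻¹ = Complex.sqrt (ζ / (2 * π)) * cexp (π ^ 2 / (6 * ζ) - ζ / 24)
      * (ef (cexp (-(4 * π ^ 2 / ζ))))⁻¹ := by
  have hζ0 : ζ ≠ 0 := by rintro rfl; simp at hζ
  have hpi : (π : ℂ) ≠ 0 := by exact_mod_cast Real.pi_ne_zero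
  have hre : 0 < (ζ / (2 * π)).re := by
    rw [show ζ / (2 * π) = ζ / ((2 * π : ℝ) : ℂ) by push_cast; rfl, Complex.div_ofReal_re]
    positivity
  have hτ : I * (ζ / (2 * π)) ∈ UpperHalfPlane.upperHalfPlaneSet := by
    change 0 < (I * (ζ / (2 * π))).im
    simpa using hre
  have h := ModularForm.eta_comp_eq_csqrt_I_inv hτ
  simp only [Function.comp, Pi.smul_apply, Pi.mul_apply, smul_eq_mul, csqrt_I_mul hre] at h
  have hs : Complex.sqrt I ≠ 0 := by simp [Complex.sqrt]
  have e1 : ModularForm.eta (I * (ζ / (2 * π))) = cexp (-(ζ / 24)) * ef (cexp (-ζ)) := by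
    simp only [ModularForm.eta, ef, Function.Periodic.qParam, ModularForm.eta_q_eq_pow]
    congr 1
    · congr 1
      push_cast
      field_simp
      linear_combination I_sq
    · congr! 5
      field_simp
      linear_combination I_sq
  have e2 : ModularForm.eta (-1 / (I * (ζ / (2 * π)))) = cexp (-(π ^ 2 / (6 * ζ))) * ef (cexp (-(4 * π ^ 2 / ζ))) := by
    simp only [ModularForm.eta, ef, Function.Periodic.qParam, ModularForm.eta_q_eq_pow]
    congr 1
    · congr 1
      push_cast
      field_simp
      ring
    · congr! 5
      field_simp
      ring
  rw [e1, e2] at h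
  have hn1 : ef (cexp (-ζ)) ≠ 0 := ef_ne_zero (by simpa [Complex.norm_exp] using hζ)
  have hn2 : ef (cexp (-(4 * π ^ 2 / ζ))) ≠ 0 := ef_ne_zero (by
    rw [Complex.norm_exp, Real.exp_lt_one_iff, neg_re, neg_lt_zero, 
      show (4 * (π : ℂ) ^ 2 / ζ) = ((4 * π ^ 2 : ℝ) : ℂ) * ζ⁻¹ by push_cast; rfl,
      Complex.re_ofReal_mul, Complex.inv_re]
    have : 0 < normSq ζ := normSq_pos.mpr hζ0
    positivity)
  rw [sub_eq_add_neg, Complex.exp_add]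
  rw [inv_eq_iff_eq_inv]
  rw [Complex.exp_neg (_ / _)] at h
  have hs3 : Complex.sqrt (ζ / (2 * π)) ≠ 0 := by
    have : ζ / (2 * π) ≠ 0 := by
      intro h0; rw [h0] at hre; simp at hre
    simp [Complex.sqrt, this]
  generalize ef (cexp (-(4 * π ^ 2 / ζ))) = u at *
  generalize ef (cexp (-ζ)) = v at *
  generalize Complex.sqrt (ζ / (2 * π)) = w at *
  have hne1 := Complex.exp_ne_zero (π ^ 2 / (6 * ζ))
  have hne2 := Complex.exp_ne_zero (-(ζ / 24))
  generalize cexp (π ^ 2 / (6 * ζ)) = x at *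
  generalize cexp (-(ζ / 24)) = y at *
  field_simp at h ⊢
  rw [h]

end EtaPart

section MainInt

open Complex

/-- integrand -/
noncomputable def fm (μ : ℝ) (w : ℂ) : ℂ := Complex.sqrt w * cexp ((μ / 2 : ℝ) * (w + w⁻¹))

lemma ball_re_pos {w : ℂ} (hw : w ∈ Metric.ball (1 : ℂ) 1) : 0 < w.re := by
  have h1 : ‖w - 1‖ < 1 := by simpa [dist_eq_norm] using hw
  have h2 := (abs_re_le_norm (w - 1)).trans_lt h1
  rw [abs_lt] at h2
  simp at h2
  linarith [h2.1]

lemma fm_diff (μ : ℝ) : DifferentiableOn ℂ (fm μ) (Metric.ball 1 1) := by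
  intro w hw
  have h := ball_re_pos hw
  have h0 : w ≠ 0 := by rintro rfl; simp at h
  have h1 := Complex.differentiableAt_sqrt (z := w) (Or.inl h)
  unfold fm
  apply DifferentiableAt.differentiableWithinAt
  refine h1.fun_mul (DifferentiableAt.cexp ?_)
  exact (differentiableAt_const _).fun_mul (differentiableAt_id.fun_add (differentiableAt_inv h0))

lemma mem_ball_of_unit {w : ℂ} (h1 : w.re ^ 2 + w.im ^ 2 ≤ 1) (h2 : 12 / 13 ≤ w.re) :
    w ∈ Metric.ball (1 : ℂ) 1 := by
  rw [Metric.mem_ball, dist_eq_norm]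
  have : ‖w - 1‖ ^ 2 < 1 := by
    rw [Complex.sq_norm, Complex.normSq_apply]
    simp
    nlinarith
  nlinarith [norm_nonneg (w - 1)]

lemma vert_eq_arc (μ : ℝ) :
    (∫ τ in (-(5/13 : ℝ))..(5/13), fm μ ((12/13 : ℝ) + τ * I)).re =
      ∫ α in (-Real.arccos (12/13))..(Real.arccos (12/13)),
        Real.cos (3 * α / 2) * Real.exp (μ * Real.cos α) := by
  obtain ⟨F, hF⟩ := (fm_diff μ).isExactOn_ball
  set θ := Real.arccos (12/13) with hθ
  have hcos : Real.cos θ = 12/13 := Real.cos_arccos (by norm_num) (by norm_num)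
  have hsin : Real.sin θ = 5/13 := by
    rw [hθ, Real.sin_arccos]
    rw [Real.sqrt_eq_iff_mul_self_eq] <;> norm_num
  have hθ0 : 0 ≤ θ := Real.arccos_nonneg _
  have hθπ : θ ≤ π / 2 := by rw [hθ, Real.arccos_le_pi_div_two]; norm_num
  have mem1 : ∀ τ ∈ Set.uIcc (-(5/13 : ℝ)) (5/13), ((12/13 : ℝ) + τ * I : ℂ) ∈ Metric.ball (1 : ℂ) 1 := by
    intro τ hτ
    rw [Set.uIcc_of_le (by norm_num)] at hτ
    apply mem_ball_of_unit
    · simp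
      nlinarith [hτ.1, hτ.2]
    · simp
  have mem2 : ∀ α ∈ Set.uIcc (-θ) θ, cexp (α * I) ∈ Metric.ball (1 : ℂ) 1 := by
    intro α hα
    rw [Set.uIcc_of_le (by linarith)] at hα
    apply mem_ball_of_unit
    · rw [exp_ofReal_mul_I_re, exp_ofReal_mul_I_im]
      rw [Real.cos_sq_add_sin_sq]
    · rw [exp_ofReal_mul_I_re, ← hcos, ← Real.cos_abs α]
      apply Real.cos_le_cos_of_nonneg_of_le_pi (abs_nonneg _) (by linarith [Real.pi_pos])
      exact abs_le.mpr hα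
  have c1 : ContinuousOn (fun τ : ℝ => fm μ ((12/13 : ℝ) + τ * I)) (Set.uIcc (-(5/13 : ℝ)) (5/13)) :=
    (fm_diff μ).continuousOn.comp (by fun_prop) mem1
  have c2 : ContinuousOn (fun α : ℝ => fm μ (cexp (α * I))) (Set.uIcc (-θ) θ) :=
    (fm_diff μ).continuousOn.comp (by fun_prop) mem2
  have i1 := intervalIntegral.integral_eq_sub_of_hasDerivAt (a := -(5/13 : ℝ)) (b := 5/13)
    (f := fun τ : ℝ => F ((12/13 : ℝ) + τ * I))
    (f' := fun τ : ℝ => fm μ ((12/13 : ℝ) + τ * I) * I) (by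
      intro τ hτ
      have h := hF _ (mem1 τ hτ)
      have h2 : HasDerivAt (fun τ : ℝ => ((12/13 : ℝ) + τ * I : ℂ)) I τ := by
        simpa using ((HasDerivAt.ofReal_comp (hasDerivAt_id τ)).mul_const I).const_add ((12/13 : ℝ) : ℂ)
      exact h.comp τ h2)
    (ContinuousOn.intervalIntegrable (c1.mul continuousOn_const))
  have i2 := intervalIntegral.integral_eq_sub_of_hasDerivAt (a := -θ) (b := θ)
    (f := fun α : ℝ => F (cexp (α * I)))
    (f' := fun α : ℝ => fm μ (cexp (α * I)) * (cexp (α * I) * I)) (by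
      intro τ hτ
      have h := hF _ (mem2 τ hτ)
      have h2 : HasDerivAt (fun τ : ℝ => cexp (τ * I)) (cexp (τ * I) * I) τ := by
        have : HasDerivAt (fun τ : ℝ => (τ * I : ℂ)) I τ := by
          simpa using ((HasDerivAt.ofReal_comp (hasDerivAt_id τ)).mul_const I)
        exact this.cexp
      exact h.comp τ h2)
    (ContinuousOn.intervalIntegrable (c2.mul (by fun_prop)))
  have hend1 : cexp (θ * I) = (12/13 : ℝ) + (5/13 : ℝ) * I := by
    rw [Complex.exp_mul_I, ← ofReal_cos, ← ofReal_sin, hcos, hsin]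
  have hend2 : cexp ((-θ : ℝ) * I) = (12/13 : ℝ) + (-(5/13) : ℝ) * I := by
    rw [Complex.exp_mul_I, ← ofReal_cos, ← ofReal_sin, Real.cos_neg, Real.sin_neg, hcos, hsin]
  simp only [hend1, hend2] at i2
  have i3 := i1.trans i2.symm
  simp_rw [← mul_assoc] at i3
  rw [intervalIntegral.integral_mul_const, intervalIntegral.integral_mul_const] at i3
  have i4 := mul_right_cancel₀ I_ne_zero i3
  rw [i4]
  have c3 : IntervalIntegrable (fun α : ℝ => fm μ (cexp (α * I)) * cexp (α * I)) MeasureTheory.volume (-θ) θ :=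
    ContinuousOn.intervalIntegrable (c2.mul (by fun_prop))
  rw [← Complex.reCLM_apply, ← ContinuousLinearMap.intervalIntegral_comp_comm _ c3]
  apply intervalIntegral.integral_congr
  intro α hα
  rw [Set.uIcc_of_le (by linarith)] at hα
  simp only [fm, Complex.reCLM_apply]
  have hs : Complex.sqrt (cexp (α * I)) = cexp (α / 2 * I) := by
    rw [_root_.sqrt_eq_exp (Complex.exp_ne_zero _), Complex.log_exp]
    · congr 1; ring
    · simp; linarith [hα.1, Real.pi_pos]
    · simp; linarith [hα.2, Real.pi_pos]
  have hc : cexp (α * I) + (cexp (α * I))⁻¹ = ((2 * Real.cos α : ℝ) : ℂ) := by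
    rw [← Complex.exp_neg, Complex.exp_mul_I, ← neg_mul, Complex.exp_mul_I]
    simp; ring
  rw [hs, hc, ← ofReal_mul, ← ofReal_exp, mul_right_comm, ← Complex.exp_add,
    show (α : ℂ) / 2 * I + α * I = ((3 * α / 2 : ℝ) : ℂ) * I by push_cast; ring,
    Complex.re_mul_ofReal, exp_ofReal_mul_I_re]
  congr 2
  ring

lemma arc_eq_sigma (μ : ℝ) :
    (∫ α in (-Real.arccos (12/13))..(Real.arccos (12/13)),
        Real.cos (3 * α / 2) * Real.exp (μ * Real.cos α)) =
      Real.exp μ * ∫ σ in (-Real.sqrt (2/13))..(Real.sqrt (2/13)), (1 - σ ^ 2) * Real.exp (-(μ/2) * σ ^ 2) := by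
  set θ := Real.arccos (12/13) with hθ
  have hcos : Real.cos θ = 12/13 := Real.cos_arccos (by norm_num) (by norm_num)
  have hθ0 : 0 ≤ θ := Real.arccos_nonneg _
  have hθπ : θ ≤ π / 2 := by rw [hθ, Real.arccos_le_pi_div_two]; norm_num
  have hs : 2 * Real.sin (θ / 2) = Real.sqrt (2/13) := by
    symm
    have h1 : 0 ≤ Real.sin (θ / 2) := Real.sin_nonneg_of_nonneg_of_le_pi (by linarith) (by linarith [Real.pi_pos])
    rw [Real.sqrt_eq_iff_mul_self_eq (by norm_num) (by linarith)]
    have h2 := Real.cos_sq (θ/2)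
    have h3 := Real.sin_sq_add_cos_sq (θ/2)
    rw [show 2 * (θ/2) = θ by ring, hcos] at h2
    nlinarith
  have h := intervalIntegral.integral_comp_mul_deriv (a := -θ) (b := θ) (f := fun α => 2 * Real.sin (α / 2))
    (f' := fun α => Real.cos (α/2)) (g := fun σ => (1 - σ ^ 2) * Real.exp (-(μ/2) * σ ^ 2)) (by
      intro x _
      have := ((Real.hasDerivAt_sin (x/2)).comp x ((hasDerivAt_id x).div_const 2)).const_mul 2
      refine this.congr_deriv ?_
      ring) (by fun_prop) (by fun_prop)
  simp only [hs, show 2 * Real.sin (-θ / 2) = -Real.sqrt (2/13) by rw [neg_div, Real.sin_neg]; linarith] at h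
  rw [← h, ← intervalIntegral.integral_const_mul]
  congr 1
  ext α
  simp only [Function.comp]
  have e1 : Real.cos α = 1 - 2 * Real.sin (α/2) ^ 2 := by
    have h2 := Real.cos_two_mul (α/2)
    have h3 := Real.sin_sq_add_cos_sq (α/2)
    rw [show 2 * (α/2) = α by ring] at h2
    linarith
  have e2 : Real.cos (3 * α / 2) = Real.cos (α/2) * (1 - (2 * Real.sin (α/2)) ^ 2) := by
    have h2 := Real.cos_three_mul (α/2)
    have h3 := Real.sin_sq_add_cos_sq (α/2)
    rw [show 3 * (α/2) = 3 * α / 2 by ring] at h2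
    rw [h2]
    linear_combination (4 * Real.cos (α/2)) * h3
  rw [e2, e1, show μ * (1 - 2 * Real.sin (α/2) ^ 2) = μ + -(μ/2) * (2 * Real.sin (α/2)) ^ 2 by ring, Real.exp_add]
  ring

lemma integrable_sq_gauss {b : ℝ} (hb : 0 < b) : MeasureTheory.Integrable fun x : ℝ => x ^ 2 * Real.exp (-b * x ^ 2) := by
  have := integrable_rpow_mul_exp_neg_mul_sq hb (s := 2) (by norm_num)
  simpa using this

lemma gauss_full {μ : ℝ} (hμ : 0 < μ) :
    ∫ σ : ℝ, (1 - σ ^ 2) * Real.exp (-(μ/2) * σ ^ 2) = Real.sqrt (2 * π / μ) * (1 - 1 / μ) := by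
  have hb : 0 < μ / 2 := by positivity
  have g1 := integrable_exp_neg_mul_sq hb
  have g2 := integrable_sq_gauss hb
  have key : ∫ σ : ℝ, (Real.exp (-(μ/2) * σ ^ 2) - μ * (σ ^ 2 * Real.exp (-(μ/2) * σ ^ 2))) = 0 := by
    have g3 : MeasureTheory.Integrable fun σ : ℝ => σ * Real.exp (-(μ/2) * σ ^ 2) :=
      integrable_mul_exp_neg_mul_sq hb
    refine MeasureTheory.integral_eq_zero_of_hasDerivAt_of_integrable
      (f := fun σ : ℝ => σ * Real.exp (-(μ/2) * σ ^ 2)) ?_ (g1.sub (g2.const_mul μ)) g3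
    intro σ
    have h1 : HasDerivAt (fun σ : ℝ => -(μ/2) * σ ^ 2) (-(μ/2) * (2 * σ)) σ := by
      simpa using (hasDerivAt_pow 2 σ).const_mul (-(μ/2))
    refine ((hasDerivAt_id σ).mul h1.exp).congr_deriv ?_
    simp; ring
  rw [MeasureTheory.integral_sub g1 (g2.const_mul μ), MeasureTheory.integral_const_mul] at key
  have : (fun σ : ℝ => (1 - σ ^ 2) * Real.exp (-(μ/2) * σ ^ 2)) =
    fun σ : ℝ => Real.exp (-(μ/2) * σ ^ 2) - σ ^ 2 * Real.exp (-(μ/2) * σ ^ 2) := by ext; ring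
  rw [this, MeasureTheory.integral_sub g1 g2]
  rw [integral_gaussian, show π / (μ / 2) = 2 * π / μ by field_simp] at *
  have h2 : (∫ σ : ℝ, σ ^ 2 * Real.exp (-(μ/2) * σ ^ 2)) = Real.sqrt (2 * π / μ) / μ := by
    rw [eq_div_iff hμ.ne']; linarith
  rw [h2]; ring

lemma gauss_tail : ∃ C : ℝ, 0 ≤ C ∧ ∀ μ : ℝ, 2 ≤ μ →
    |(∫ σ in (-Real.sqrt (2/13))..(Real.sqrt (2/13)), (1 - σ ^ 2) * Real.exp (-(μ/2) * σ ^ 2))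
      - Real.sqrt (2 * π / μ) * (1 - 1 / μ)| ≤ C * Real.exp (-(μ / 13)) := by
  have hG : MeasureTheory.Integrable fun σ : ℝ => (Real.exp (-1 * σ ^ 2) + σ ^ 2 * Real.exp (-1 * σ ^ 2)) :=
    (integrable_exp_neg_mul_sq one_pos).add (integrable_sq_gauss one_pos)
  refine ⟨(∫ σ : ℝ, (Real.exp (-1 * σ ^ 2) + σ ^ 2 * Real.exp (-1 * σ ^ 2))) * Real.exp (2/13), ?_, ?_⟩
  · apply mul_nonneg _ (Real.exp_pos _).le
    apply MeasureTheory.integral_nonneg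
    intro x; positivity
  intro μ hμ
  have hb : 0 < μ / 2 := by linarith
  have hf : MeasureTheory.Integrable fun σ : ℝ => (1 - σ ^ 2) * Real.exp (-(μ/2) * σ ^ 2) := by
    refine ((integrable_exp_neg_mul_sq hb).sub (integrable_sq_gauss hb)).congr (Filter.Eventually.of_forall fun x => ?_)
    simp; ring
  rw [← gauss_full (by linarith), intervalIntegral.integral_of_le (by linarith [Real.sqrt_nonneg (2/13)]),
    ← MeasureTheory.integral_add_compl measurableSet_Ioc hf, abs_sub_comm, add_sub_cancel_left]
  rw [← Real.norm_eq_abs]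
  have hS : (0:ℝ) ≤ Real.sqrt (2/13) := Real.sqrt_nonneg _
  have hS2 : Real.sqrt (2/13) ^ 2 = 2 / 13 := Real.sq_sqrt (by norm_num)
  calc _ ≤ ∫ σ in (Set.Ioc (-Real.sqrt (2/13)) (Real.sqrt (2/13)))ᶜ,
        (Real.exp (-1 * σ ^ 2) + σ ^ 2 * Real.exp (-1 * σ ^ 2)) * (Real.exp (2/13) * Real.exp (-(μ/13))) := by
        apply MeasureTheory.norm_integral_le_of_norm_le (hG.mul_const _).integrableOn
        rw [MeasureTheory.ae_restrict_iff' measurableSet_Ioc.compl]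
        refine Filter.Eventually.of_forall fun σ hσ => ?_
        have h2 : 2 / 13 ≤ σ ^ 2 := by
          rw [← hS2]
          simp only [Set.mem_compl_iff, Set.mem_Ioc, not_and_or, not_lt, not_le] at hσ
          rcases hσ with h | h <;> nlinarith
        have h3 : |1 - σ ^ 2| ≤ 1 + σ ^ 2 := by rw [abs_le]; constructor <;> nlinarith
        rw [norm_mul, Real.norm_eq_abs, Real.norm_eq_abs, abs_of_pos (Real.exp_pos _)]
        have h4 : Real.exp (-(μ/2) * σ ^ 2) ≤ Real.exp (-1 * σ ^ 2) * (Real.exp (2/13) * Real.exp (-(μ/13))) := by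
          rw [← Real.exp_add, ← Real.exp_add, Real.exp_le_exp]
          nlinarith
        calc _ ≤ (1 + σ ^ 2) * (Real.exp (-1 * σ ^ 2) * (Real.exp (2/13) * Real.exp (-(μ/13)))) := by gcongr
          _ = _ := by ring
    _ ≤ ∫ σ : ℝ, (Real.exp (-1 * σ ^ 2) + σ ^ 2 * Real.exp (-1 * σ ^ 2)) * (Real.exp (2/13) * Real.exp (-(μ/13))) := by
        apply MeasureTheory.setIntegral_le_integral (hG.mul_const _)
        refine Filter.Eventually.of_forall fun σ => ?_
        simp only [Pi.zero_apply]
        positivity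
    _ = _ := by rw [MeasureTheory.integral_mul_const]; ring

lemma main_int : ∃ C : ℝ, 0 ≤ C ∧ ∀ μ : ℝ, 2 ≤ μ →
    |(∫ τ in (-(5/13 : ℝ))..(5/13), fm μ ((12/13 : ℝ) + τ * I)).re
      - Real.exp μ * (Real.sqrt (2 * π / μ) * (1 - 1 / μ))| ≤ C * Real.exp (12 * μ / 13) := by
  obtain ⟨C, hC, h⟩ := gauss_tail
  refine ⟨C, hC, fun μ hμ => ?_⟩
  rw [vert_eq_arc, arc_eq_sigma, ← mul_sub, abs_mul, abs_of_pos (Real.exp_pos _)]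
  calc _ ≤ Real.exp μ * (C * Real.exp (-(μ / 13))) := by gcongr; exact h μ hμ
    _ = C * (Real.exp μ * Real.exp (-(μ/13))) := by ring
    _ = _ := by rw [← Real.exp_add]; congr 2; ring

end MainInt

section Bounds

open Complex

lemma ef_zero : ef 0 = 1 := by simp [ef]

lemma efinv_near : ∃ C δ : ℝ, 0 ≤ C ∧ 0 < δ ∧ ∀ q : ℂ, ‖q‖ < δ → ‖(ef q)⁻¹ - 1‖ ≤ C * ‖q‖ := by
  have h := (efinv_diff.differentiableAt (Metric.ball_mem_nhds (0 : ℂ) one_pos)).isBigO_sub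
  obtain ⟨C, hC, h2⟩ := h.exists_nonneg
  obtain ⟨δ, hδ, h3⟩ := Metric.eventually_nhds_iff.mp h2.bound
  refine ⟨C, δ, hC, hδ, fun q hq => ?_⟩
  have := h3 (y := q) (by simpa using hq)
  simpa [ef_zero] using this

lemma factor_bound {w : ℂ} (hw : ‖w‖ < 1) :
    (1 - ‖w‖) * Real.exp (‖w‖ - w.re) ≤ ‖1 - w‖ := by
  have h1 := Complex.hasSum_re (Complex.hasSum_taylorSeries_neg_log hw)
  have h2 := Complex.hasSum_re (Complex.hasSum_taylorSeries_neg_log (z := (‖w‖ : ℂ)) (by simpa using hw))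
  have h3 := h2.sub h1
  have hpos : 0 < 1 - ‖w‖ := by linarith
  have hne : 1 - w ≠ 0 := by
    intro h0
    have : w = 1 := by linear_combination -h0
    rw [this] at hw; simp at hw
  have h4 := le_hasSum h3 1 (by
    intro k _
    have e1 : ((‖w‖ : ℂ) ^ k / k).re = ‖w‖ ^ k / k := by
      rw [show (‖w‖ : ℂ) ^ k / k = ((‖w‖ ^ k / k : ℝ) : ℂ) by push_cast; rfl, ofReal_re]
    have e2 : (w ^ k / k).re ≤ ‖w‖ ^ k / k := by
      refine (re_le_norm _).trans ?_
      simp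
    rw [e1]; linarith)
  have e3 : (-Complex.log (1 - (‖w‖ : ℂ))).re = -Real.log (1 - ‖w‖) := by
    rw [neg_re, Complex.log_re, show (1 - (‖w‖ : ℂ)) = ((1 - ‖w‖ : ℝ) : ℂ) by push_cast; rfl, norm_real,
      Real.norm_of_nonneg hpos.le]
  rw [e3, neg_re, Complex.log_re] at h4
  simp at h4
  rw [← Real.log_le_log_iff (by positivity) (norm_pos_iff.mpr hne), Real.log_mul hpos.ne' (Real.exp_ne_zero _),
    Real.log_exp]
  linarith

lemma ef_lower {q : ℂ} (hq : ‖q‖ < 1) :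
    ‖ef (‖q‖ : ℂ)‖ * Real.exp (‖q‖ / (1 - ‖q‖) - (q / (1 - q)).re) ≤ ‖ef q‖ := by
  have hq' : ‖(‖q‖ : ℂ)‖ < 1 := by simpa using hq
  have t1 := (ModularForm.multipliable_one_sub_pow hq').hasProd.tendsto_prod_nat.norm
  have t2 := (ModularForm.multipliable_one_sub_pow hq).hasProd.tendsto_prod_nat.norm
  have s1 := ((hasSum_geometric_of_lt_one (norm_nonneg q) hq).mul_left ‖q‖)
  have s2 := Complex.hasSum_re ((hasSum_geometric_of_norm_lt_one hq).mul_left q)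
  have s3 := (s1.sub s2).tendsto_sum_nat
  have t3 := t1.mul ((Real.continuous_exp.tendsto _).comp s3)
  rw [← div_eq_mul_inv, ← div_eq_mul_inv] at t3
  refine le_of_tendsto_of_tendsto' t3 t2 fun N => ?_
  simp only [Function.comp, norm_prod, Real.exp_sum, ← Finset.prod_mul_distrib]
  apply Finset.prod_le_prod
  · intro i _; positivity
  · intro i _
    have hp : ‖q ^ (i+1)‖ < 1 := by rw [norm_pow]; exact pow_lt_one₀ (norm_nonneg _) hq (by simp)
    have := factor_bound hp
    rw [norm_pow] at hp this
    have e : ‖1 - (‖q‖ : ℂ) ^ (i+1)‖ = 1 - ‖q‖ ^ (i+1) := by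
      rw [show 1 - (‖q‖ : ℂ) ^ (i+1) = ((1 - ‖q‖ ^ (i+1) : ℝ) : ℂ) by push_cast; rfl, norm_real,
        Real.norm_of_nonneg (by linarith)]
    rw [e, ← pow_succ', ← pow_succ']
    exact this

lemma gain {a θ : ℝ} (ha : 0 < a) (ha2 : a ≤ 1/2) (hθ : |θ| ≤ π) (hθ2 : 5/12 * a ≤ |θ|) :
    1 / (50 * a) ≤ Real.exp (-a) / (1 - Real.exp (-a)) -
      (cexp (-(a + θ * I)) / (1 - cexp (-(a + θ * I)))).re := by
  have hq : cexp (-(a + θ * I)) = ((Real.exp (-a) * Real.cos θ : ℝ) : ℂ) + ((-(Real.exp (-a) * Real.sin θ) : ℝ) : ℂ) * I := by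
    rw [neg_add, Complex.exp_add, ← neg_mul, Complex.exp_mul_I, Complex.cos_neg, Complex.sin_neg]
    push_cast; ring
  have hρ1 : Real.exp (-a) < 1 := by simpa using ha
  have hρa : 1 - a ≤ Real.exp (-a) := by linarith [Real.add_one_le_exp (-a)]
  have hρ : 1/2 ≤ Real.exp (-a) := by linarith
  have hsc := Real.sin_sq_add_cos_sq θ
  have hc : 0.035 * a ^ 2 ≤ 1 - Real.cos θ := by
    have h1 := Real.cos_le_one_sub_mul_cos_sq hθ
    have h2 : π ^ 2 ≤ 9.9 := by
      have := Real.pi_lt_d4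
      nlinarith [Real.pi_pos]
    have h3 : (5/12 * a) ^ 2 ≤ θ ^ 2 := by
      rw [← sq_abs θ]; gcongr
    have h4 : 2 / 9.9 ≤ 2 / π ^ 2 := by gcongr
    have h5 : 2 / 9.9 * (5/12 * a) ^ 2 ≤ 2 / π ^ 2 * θ ^ 2 := by gcongr
    nlinarith [sq_nonneg a]
  set ρ := Real.exp (-a)
  have hc1 : Real.cos θ ≤ 1 := Real.cos_le_one θ
  have hden : 0 < (1 - ρ) ^ 2 + 2 * ρ * (1 - Real.cos θ) := by
    have : 0 < (1 - ρ) ^ 2 := pow_pos (by linarith) 2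
    have : 0 ≤ 2 * ρ * (1 - Real.cos θ) := mul_nonneg (by linarith) (by linarith)
    linarith
  have hre : (cexp (-(a + θ * I)) / (1 - cexp (-(a + θ * I)))).re
      = (ρ * Real.cos θ - ρ ^ 2) / ((1 - ρ) ^ 2 + 2 * ρ * (1 - Real.cos θ)) := by
    rw [hq]
    generalize Real.cos θ = cc at hsc ⊢
    generalize Real.sin θ = ss at hsc ⊢
    rw [Complex.div_re, ← add_div, Complex.normSq_apply]
    congr 1
    · simp
      linear_combination (-ρ ^ 2) * hsc
    · simp
      linear_combination (ρ ^ 2) * hsc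
  rw [hre]
  set c := 1 - Real.cos θ with hcdef
  have hcc : Real.cos θ = 1 - c := by rw [hcdef]; ring
  rw [hcc]
  have hu : 0 < 1 - ρ := by linarith
  have heq : ρ / (1 - ρ) - (ρ * (1 - c) - ρ ^ 2) / ((1 - ρ) ^ 2 + 2 * ρ * c) =
      ρ * (1 + ρ) * c / ((1 - ρ) * ((1 - ρ) ^ 2 + 2 * ρ * c)) := by
    rw [div_sub_div _ _ hu.ne' hden.ne']
    congr 1
    ring
  rw [heq, div_le_div_iff₀ (by positivity) (by positivity)]
  have hc0 : 0 ≤ c := by linarith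
  have k1 : (1 - ρ) * ((1 - ρ) ^ 2 + 2 * ρ * c) ≤ a * (a ^ 2 + 2 * ρ * c) := by
    have hua : 1 - ρ ≤ a := by linarith
    gcongr
  have k2 : a ^ 2 + 2 * ρ * c ≤ 50 * (ρ * (1 + ρ) * c) := by
    have : 36.5 ≤ ρ * (48 + 50 * ρ) := by nlinarith
    nlinarith [mul_le_mul_of_nonneg_right this hc0]
  nlinarith [mul_le_mul_of_nonneg_left k2 ha.le]

end Bounds

section Assemble

open Complex

lemma gint_major (n : ℕ) {μ b τ : ℝ} (hμ : 0 < μ) (hb : b = π ^ 2 / (3 * μ))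
    (hn : (n : ℝ) - 1 / 24 = 3 * μ ^ 2 / (2 * π ^ 2)) :
    gint n (12/13 * b) (b * τ) = (Real.sqrt (b / (2 * π)) : ℂ) * (fm μ ((12/13 : ℝ) + τ * I) *
      (ef (cexp (-((12 * μ : ℝ) * ((12/13 : ℝ) + τ * I : ℂ)⁻¹))))⁻¹) := by
  have hb0 : 0 < b := by rw [hb]; positivity
  set w : ℂ := (12/13 : ℝ) + τ * I with hw
  have hwre : 0 < w.re := by rw [hw]; simp
  have hw0 : w ≠ 0 := by intro h; rw [h] at hwre; simp at hwre
  have hpi : (π : ℂ) ≠ 0 := by exact_mod_cast Real.pi_ne_zero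
  have hμ' : (μ : ℂ) ≠ 0 := by exact_mod_cast hμ.ne'
  have hz : (((12/13 * b : ℝ) : ℂ) + ((b * τ : ℝ) : ℂ) * I) = b * w := by
    rw [hw]; push_cast; ring
  have hre : 0 < ((b : ℂ) * w).re := by
    rw [Complex.re_ofReal_mul]; positivity
  have hbC : (b : ℂ) = π ^ 2 / (3 * μ) := by rw [hb]; push_cast; rfl
  have hnC : (n : ℂ) = 3 * μ ^ 2 / (2 * π ^ 2) + 1 / 24 := by
    have : (n : ℝ) = 3 * μ ^ 2 / (2 * π ^ 2) + 1 / 24 := by linarith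
    have h2 := congrArg (fun x : ℝ => (x : ℂ)) this
    push_cast at h2
    exact h2
  unfold gint
  rw [hz, ef_transf hre]
  have e1 : Complex.sqrt (b * w / (2 * π)) = (Real.sqrt (b / (2 * π)) : ℂ) * Complex.sqrt w := by
    rw [← csqrt_real_mul (by positivity) hw0]
    congr 1; push_cast; ring
  have e2 : 4 * (π : ℂ) ^ 2 / (b * w) = (12 * μ : ℝ) * w⁻¹ := by
    rw [hbC]; push_cast; field_simp; norm_num
  have e3 : cexp (π ^ 2 / (6 * (b * w)) - b * w / 24) * cexp (n * (b * w)) = cexp ((μ / 2 : ℝ) * (w + w⁻¹)) := by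
    rw [← Complex.exp_add, hnC, hbC]
    congr 1
    push_cast; field_simp; ring
  rw [e1, e2, fm, ← e3]
  ring

lemma major_err : ∃ C μ₀ : ℝ, 0 ≤ C ∧ ∀ μ τ : ℝ, μ₀ ≤ μ → 0 ≤ μ → |τ| ≤ 5/13 →
    ‖fm μ ((12/13 : ℝ) + τ * I) * (ef (cexp (-((12 * μ : ℝ) * ((12/13 : ℝ) + τ * I : ℂ)⁻¹))))⁻¹
      - fm μ ((12/13 : ℝ) + τ * I)‖ ≤ C * Real.exp (6 * μ / 13) := by
  obtain ⟨C, δ, hC, hδ, h⟩ := efinv_near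
  refine ⟨C, -Real.log δ + 1, hC, fun μ τ hμ hμ0 hτ => ?_⟩
  set w : ℂ := (12/13 : ℝ) + τ * I with hw
  have hwre : w.re = 12/13 := by rw [hw]; simp
  have hwim : w.im = τ := by rw [hw]; simp
  have hw0 : w ≠ 0 := by intro h; rw [h] at hwre; simp at hwre; norm_num at hwre
  have hns : normSq w ≤ 1 := by
    rw [Complex.normSq_apply, hwre, hwim]
    nlinarith [abs_le.mp hτ]
  have hns0 : 0 < normSq w := normSq_pos.mpr hw0
  have hinv : 12/13 ≤ (w⁻¹).re := by
    rw [Complex.inv_re, hwre, le_div_iff₀ hns0]; linarith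
  have hnw : ‖w‖ ≤ 1 := by
    rw [← sq_le_one_iff₀ (norm_nonneg _), Complex.sq_norm]; exact hns
  have hq : ‖cexp (-((12 * μ : ℝ) * w⁻¹))‖ = Real.exp (-(12 * μ * (w⁻¹).re)) := by
    rw [Complex.norm_exp, neg_re, Complex.re_ofReal_mul]
  have hq2 : ‖cexp (-((12 * μ : ℝ) * w⁻¹))‖ < δ := by
    rw [hq, ← Real.lt_log_iff_exp_lt hδ]
    nlinarith
  have h1 := h _ hq2
  have hs : ‖Complex.sqrt w‖ ≤ 1 := by
    unfold Complex.sqrt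
    have : w ^ (2⁻¹ : ℂ) = w ^ (((2⁻¹ : ℝ)) : ℂ) := by push_cast; rfl
    rw [this, Complex.norm_cpow_real]
    exact Real.rpow_le_one (norm_nonneg _) hnw (by norm_num)
  have hf : ‖fm μ w‖ ≤ Real.exp (μ / 2 * (12/13 + (w⁻¹).re)) := by
    rw [fm, norm_mul, Complex.norm_exp, Complex.re_ofReal_mul, add_re, hwre]
    exact mul_le_of_le_one_left (Real.exp_pos _).le hs
  rw [show ∀ x y : ℂ, x * y - x = x * (y - 1) by intros; ring, norm_mul]
  calc _ ≤ Real.exp (μ / 2 * (12/13 + (w⁻¹).re)) * (C * Real.exp (-(12 * μ * (w⁻¹).re))) := by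
        rw [← hq]; gcongr
    _ = C * (Real.exp (μ / 2 * (12/13 + (w⁻¹).re)) * Real.exp (-(12 * μ * (w⁻¹).re))) := by ring
    _ ≤ C * Real.exp (6 * μ / 13) := by
        gcongr
        rw [← Real.exp_add, Real.exp_le_exp]
        nlinarith

lemma ef_real_bound : ∃ a₀ : ℝ, 0 < a₀ ∧ ∀ a : ℝ, 0 < a → a ≤ a₀ →
    ‖ef (Real.exp (-a) : ℝ)‖⁻¹ ≤ 2 * Real.exp (π ^ 2 / (6 * a) - a / 24) := by
  obtain ⟨C, δ, hC, hδ, h⟩ := efinv_near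
  set δ' := min δ (1 / (C + 1)) with hδ'
  have hδ'0 : 0 < δ' := by rw [hδ']; positivity
  have t : Tendsto (fun a : ℝ => Real.exp (-(4 * π ^ 2 * a⁻¹))) (nhdsWithin 0 (Set.Ioi 0)) (nhds 0) := by
    apply Real.tendsto_exp_neg_atTop_nhds_zero.comp
    exact tendsto_inv_nhdsGT_zero.const_mul_atTop (by positivity)
  have t2 := t.eventually (gt_mem_nhds hδ'0)
  rw [eventually_nhdsWithin_iff, Metric.eventually_nhds_iff] at t2
  obtain ⟨ε, hε, t3⟩ := t2
  refine ⟨min (ε/2) 1, by positivity, fun a ha haa => ?_⟩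
  have ha1 : a ≤ 1 := haa.trans (min_le_right _ _)
  have haε : a < ε := by linarith [haa.trans (min_le_left _ _)]
  have h2 := t3 (y := a) (by simpa [abs_of_pos ha] using haε) ha
  have h3 := ef_transf (ζ := (a : ℂ)) (by simpa using ha)
  have e1 : cexp (-(a : ℂ)) = ((Real.exp (-a) : ℝ) : ℂ) := by push_cast; rfl
  rw [← norm_inv, ← e1, h3, norm_mul, norm_mul, Complex.norm_exp]
  have e2 : (π ^ 2 / (6 * (a : ℂ)) - a / 24).re = π ^ 2 / (6 * a) - a / 24 := by
    rw [show (π ^ 2 / (6 * (a : ℂ)) - a / 24) = ((π ^ 2 / (6 * a) - a / 24 : ℝ) : ℂ) by push_cast; rfl, ofReal_re]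
  have e3 : ‖cexp (-(4 * π ^ 2 / (a : ℂ)))‖ = Real.exp (-(4 * π ^ 2 * a⁻¹)) := by
    rw [show (-(4 * π ^ 2 / (a : ℂ))) = ((-(4 * π ^ 2 * a⁻¹) : ℝ) : ℂ) by push_cast; rfl, Complex.norm_exp, ofReal_re]
  have h4 := h (cexp (-(4 * π ^ 2 / (a : ℂ)))) (by rw [e3]; exact h2.trans_le (min_le_left _ _))
  rw [e3] at h4
  have h5 : C * Real.exp (-(4 * π ^ 2 * a⁻¹)) ≤ 1 := by
    have : Real.exp (-(4 * π ^ 2 * a⁻¹)) ≤ 1 / (C + 1) := (h2.trans_le (min_le_right _ _)).le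
    rw [le_div_iff₀ (by positivity)] at this
    nlinarith [Real.exp_pos (-(4 * π ^ 2 * a⁻¹))]
  have h6 : ‖(ef (cexp (-(4 * π ^ 2 / (a : ℂ)))))⁻¹‖ ≤ 2 := by
    have := norm_add_le ((ef (cexp (-(4 * π ^ 2 / (a : ℂ)))))⁻¹ - 1) 1
    rw [sub_add_cancel, norm_one] at this
    linarith
  have h7 : ‖Complex.sqrt ((a : ℂ) / (2 * π))‖ ≤ 1 := by
    unfold Complex.sqrt
    have : ((a : ℂ) / (2 * π)) ^ (2⁻¹ : ℂ) = ((a / (2 * π) : ℝ) : ℂ) ^ (((2⁻¹ : ℝ)) : ℂ) := by push_cast; rfl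
    rw [this, Complex.norm_cpow_real]
    apply Real.rpow_le_one (norm_nonneg _) _ (by norm_num)
    rw [norm_real, Real.norm_of_nonneg (by positivity), div_le_one (by positivity)]
    linarith [Real.pi_gt_three]
  rw [e2]
  calc _ ≤ 1 * Real.exp (π ^ 2 / (6 * a) - a / 24) * 2 := by gcongr
    _ = _ := by ring

lemma minor_bound : ∃ a₀ : ℝ, 0 < a₀ ∧ ∀ (n : ℕ) (a θ : ℝ), 0 < a → a ≤ a₀ → |θ| ≤ π → 5/12 * a ≤ |θ| →
    ‖gint n a θ‖ ≤ 2 * Real.exp (((n : ℝ) - 1/24) * a + π ^ 2 / (6 * a) - 1 / (50 * a)) := by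
  obtain ⟨a₀, h0, h⟩ := ef_real_bound
  refine ⟨min a₀ (1/2), by positivity, fun n a θ ha haa hθ hθ2 => ?_⟩
  have h1 := h a ha (haa.trans (min_le_left _ _))
  have h2 := gain ha (haa.trans (min_le_right _ _)) hθ hθ2
  have hq : ‖cexp (-(a + θ * I))‖ = Real.exp (-a) := by
    rw [Complex.norm_exp]; simp
  have hq1 : ‖cexp (-(a + θ * I))‖ < 1 := by rw [hq]; simpa using ha
  have h3 := ef_lower hq1
  rw [hq] at h3
  have hρ : ‖((Real.exp (-a) : ℝ) : ℂ)‖ < 1 := by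
    rw [norm_real, Real.norm_of_nonneg (Real.exp_pos _).le]; simpa using ha
  have p1 : 0 < ‖ef ((Real.exp (-a) : ℝ) : ℂ)‖ := norm_pos_iff.mpr (ef_ne_zero hρ)
  have p2 : 0 < ‖ef (cexp (-(a + θ * I)))‖ := norm_pos_iff.mpr (ef_ne_zero hq1)
  have h4 : ‖ef (cexp (-(a + θ * I)))‖⁻¹ ≤ ‖ef ((Real.exp (-a) : ℝ) : ℂ)‖⁻¹ * Real.exp (-(1 / (50 * a))) := by
    rw [Real.exp_neg (1 / (50 * a)), ← mul_inv]
    apply inv_anti₀ (by positivity)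
    refine le_trans ?_ h3
    gcongr
  unfold gint
  rw [norm_mul, norm_inv, Complex.norm_exp]
  have e : ((n : ℂ) * (a + θ * I)).re = n * a := by simp
  rw [e]
  calc _ ≤ (2 * Real.exp (π ^ 2 / (6 * a) - a / 24)) * Real.exp (-(1 / (50 * a))) * Real.exp (n * a) := by
        gcongr
        refine h4.trans ?_
        gcongr
    _ = 2 * (Real.exp (π ^ 2 / (6 * a) - a / 24) * Real.exp (-(1 / (50 * a))) * Real.exp (n * a)) := by ring
    _ = _ := by
      rw [← Real.exp_add, ← Real.exp_add]; congr 2; ring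

end Assemble

section Assemble2

open Complex

lemma card_asymp : ∃ C μ₀ : ℝ, 0 ≤ C ∧ ∀ (n : ℕ) (μ : ℝ), μ₀ ≤ μ →
    (n : ℝ) - 1 / 24 = 3 * μ ^ 2 / (2 * π ^ 2) →
    |(Fintype.card (Nat.Partition n) : ℝ) - π ^ 2 / (6 * Real.sqrt 3) / μ ^ 2 * (1 - 1 / μ) * Real.exp μ|
      ≤ C * Real.exp (0.997 * μ) := by
  obtain ⟨C1, μ1, hC1, H1⟩ := major_err
  obtain ⟨C2, hC2, H2⟩ := main_int
  obtain ⟨a₀, ha₀, H3⟩ := minor_bound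
  refine ⟨4 * π + C1 + C2, max (max 4 μ1) (4 / a₀), by positivity, fun n μ hμ hn => ?_⟩
  have hμ4 : 4 ≤ μ := (le_max_left _ _).trans ((le_max_left _ _).trans hμ)
  have hμ1 : μ1 ≤ μ := (le_max_right _ _).trans ((le_max_left _ _).trans hμ)
  have hμa : 4 / a₀ ≤ μ := (le_max_right _ _).trans hμ
  have hμ0 : 0 < μ := by linarith
  have hpi2 : π ^ 2 ≤ 10 := by
    have := Real.pi_lt_d4
    nlinarith [Real.pi_pos]
  obtain ⟨b, hb⟩ : ∃ b, b = π ^ 2 / (3 * μ) := ⟨_, rfl⟩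
  have hb0 : 0 < b := by rw [hb]; positivity
  have hbμ : b * μ ≤ 4 := by
    rw [hb, show π ^ 2 / (3 * μ) * μ = π ^ 2 / 3 by field_simp]; linarith
  have hb1 : b ≤ 1 := by nlinarith
  have hba : b ≤ a₀ := by
    rw [div_le_iff₀ ha₀] at hμa
    nlinarith
  have hpi3 := Real.pi_gt_three
  set a := 12/13 * b with ha
  have ha0 : 0 < a := by rw [ha]; positivity
  have hcont := gint_continuous n ha0
  have hint : ∀ x y : ℝ, IntervalIntegrable (gint n a) MeasureTheory.volume x y :=
    fun x y => hcont.intervalIntegrable x y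
  have hT := card_eq_integral n ha0
  -- minor arcs
  set B := 2 * Real.exp (0.997 * μ) with hB
  have hminor : ∀ θ : ℝ, |θ| ≤ π → b * (5/13) ≤ |θ| → ‖gint n a θ‖ ≤ B := by
    intro θ h1 h2
    refine (H3 n a θ ha0 (by rw [ha]; linarith) h1 (by rw [ha]; linarith)).trans ?_
    rw [hB]
    gcongr
    rw [hn, ha, hb]
    have e : 3 * μ ^ 2 / (2 * π ^ 2) * (12 / 13 * (π ^ 2 / (3 * μ))) + π ^ 2 / (6 * (12 / 13 * (π ^ 2 / (3 * μ)))) -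
      1 / (50 * (12 / 13 * (π ^ 2 / (3 * μ)))) = μ * (6/13 + 13/24 - 13 / (200 * π ^ 2)) := by
      field_simp; ring
    rw [e]
    have : 13 / (200 * 10) ≤ 13 / (200 * π ^ 2) := by gcongr
    nlinarith
  have O1 : ‖∫ θ in (-π)..(b * (-(5/13))), gint n a θ‖ ≤ B * π := by
    refine (intervalIntegral.norm_integral_le_of_norm_le_const (C := B) ?_).trans ?_
    · intro θ hθ
      rw [Set.uIoc_of_le (by linarith)] at hθ
      have : θ < 0 := by linarith [hθ.2]
      apply hminor <;> rw [abs_of_neg this] <;> linarith [hθ.1, hθ.2]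
    · gcongr
      rw [abs_of_nonneg (by linarith)]; linarith
  have O2 : ‖∫ θ in (b * (5/13))..π, gint n a θ‖ ≤ B * π := by
    refine (intervalIntegral.norm_integral_le_of_norm_le_const (C := B) ?_).trans ?_
    · intro θ hθ
      rw [Set.uIoc_of_le (by linarith)] at hθ
      have : 0 < θ := by linarith [hθ.1]
      apply hminor <;> rw [abs_of_pos this] <;> linarith [hθ.1, hθ.2]
    · gcongr
      rw [abs_of_nonneg (by linarith)]; linarith
  -- major arc
  have hM := intervalIntegral.smul_integral_comp_mul_left (a := -(5/13 : ℝ)) (b := 5/13) (gint n a) b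
  set k := Real.sqrt (b / (2 * π)) with hk
  have hk0 : 0 ≤ k := Real.sqrt_nonneg _
  have hk1 : k ≤ 1 := by
    rw [hk, Real.sqrt_le_one, div_le_one (by positivity)]
    linarith
  have hfmc : ContinuousOn (fun τ : ℝ => fm μ ((12/13 : ℝ) + τ * I)) (Set.uIcc (-(5/13 : ℝ)) (5/13)) := by
    refine (fm_diff μ).continuousOn.comp (by fun_prop) ?_
    intro τ hτ
    rw [Set.uIcc_of_le (by norm_num)] at hτ
    apply mem_ball_of_unit
    · simp
      nlinarith [hτ.1, hτ.2]
    · simp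
  set J := ∫ τ in (-(5/13 : ℝ))..(5/13), fm μ ((12/13 : ℝ) + τ * I) with hJ
  set G := ∫ τ in (-(5/13 : ℝ))..(5/13), gint n a (b * τ) with hG
  have hGJ : ‖G - k * J‖ ≤ C1 * Real.exp (6 * μ / 13) := by
    rw [hG, hJ, ← intervalIntegral.integral_const_mul, ← intervalIntegral.integral_sub]
    · refine (intervalIntegral.norm_integral_le_of_norm_le_const (C := C1 * Real.exp (6 * μ / 13)) ?_).trans ?_
      · intro τ hτ
        rw [Set.uIoc_of_le (by norm_num)] at hτ
        rw [ha, gint_major n hμ0 hb hn, ← hk, ← mul_sub, norm_mul, norm_real, Real.norm_of_nonneg hk0]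
        refine (mul_le_of_le_one_left (norm_nonneg _) hk1).trans ?_
        exact H1 μ τ hμ1 hμ0.le (abs_le.mpr ⟨hτ.1.le, hτ.2⟩)
      · apply mul_le_of_le_one_right (by positivity)
        rw [abs_of_nonneg] <;> norm_num
    · exact (hcont.comp (by fun_prop)).intervalIntegrable _ _
    · exact (continuousOn_const.mul hfmc).intervalIntegrable
  have hsplit : (∫ θ in (-π)..π, gint n a θ) = (∫ θ in (-π)..(b * (-(5/13))), gint n a θ) + b * G
      + ∫ θ in (b * (5/13))..π, gint n a θ := by
    rw [← intervalIntegral.integral_add_adjacent_intervals (hint (-π) (b * (5/13))) (hint _ π),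
      ← intervalIntegral.integral_add_adjacent_intervals (hint (-π) (b * (-(5/13)))) (hint _ (b * (5/13))),
      ← hM, real_smul]
  set P1 := ∫ θ in (-π)..(b * (-(5/13))), gint n a θ
  set P2 := ∫ θ in (b * (5/13))..π, gint n a θ
  have hcard : (Fintype.card (Nat.Partition n) : ℝ) = 1 / (2 * π) * (P1 + b * G + P2).re := by
    rw [← hsplit]
    have := congrArg Complex.re hT
    rw [natCast_re, show (1 / (2 * (π : ℂ))) = ((1 / (2 * π) : ℝ) : ℂ) by push_cast; rfl, Complex.re_ofReal_mul] at this
    exact this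
  have hmain : π ^ 2 / (6 * Real.sqrt 3) / μ ^ 2 * (1 - 1 / μ) * Real.exp μ =
      1 / (2 * π) * (b * (k * (Real.exp μ * (Real.sqrt (2 * π / μ) * (1 - 1 / μ))))) := by
    have e1 : k * Real.sqrt (2 * π / μ) = π / (Real.sqrt 3 * μ) := by
      rw [hk, ← Real.sqrt_mul (by positivity)]
      rw [show b / (2 * π) * (2 * π / μ) = π ^ 2 / (3 * μ ^ 2) by rw [hb]; field_simp]
      rw [Real.sqrt_div (by positivity), Real.sqrt_mul (by positivity), Real.sqrt_sq (by positivity),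
        Real.sqrt_sq (by positivity)]
    calc _ = 1 / (2 * π) * (b * ((π / (Real.sqrt 3 * μ)) * Real.exp μ * (1 - 1 / μ))) := by
          rw [hb]; field_simp; ring
      _ = _ := by rw [← e1]; ring
  have H2' := H2 μ (by linarith)
  rw [← hJ] at H2'
  set Z := Real.exp μ * (Real.sqrt (2 * π / μ) * (1 - 1 / μ))
  rw [hcard, hmain, ← mul_sub, abs_mul, abs_of_pos (by positivity : 0 < 1 / (2 * π))]
  have e : (P1 + b * G + P2).re - b * (k * Z) = P1.re + b * (G - k * J).re + P2.re + b * (k * (J.re - Z)) := by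
    rw [add_re, add_re, sub_re, Complex.re_ofReal_mul, Complex.re_ofReal_mul]; ring
  rw [e]
  have hpi1 : 1 / (2 * π) ≤ 1 := by rw [div_le_one (by positivity)]; linarith
  refine (mul_le_of_le_one_left (abs_nonneg _) hpi1).trans ?_
  have hx : Real.exp (6 * μ / 13) ≤ Real.exp (0.997 * μ) := by rw [Real.exp_le_exp]; linarith
  have hy : Real.exp (12 * μ / 13) ≤ Real.exp (0.997 * μ) := by rw [Real.exp_le_exp]; linarith
  have q1 := (abs_re_le_norm P1).trans O1
  have q2 := (abs_re_le_norm P2).trans O2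
  have q3 : |b * (G - k * J).re| ≤ C1 * Real.exp (0.997 * μ) := by
    rw [abs_mul, abs_of_pos hb0]
    refine (mul_le_of_le_one_left (abs_nonneg _) hb1).trans ?_
    refine ((abs_re_le_norm _).trans hGJ).trans ?_
    gcongr
  have q4 : |b * (k * (J.re - Z))| ≤ C2 * Real.exp (0.997 * μ) := by
    rw [abs_mul, abs_of_pos hb0]
    refine (mul_le_of_le_one_left (abs_nonneg _) hb1).trans ?_
    rw [abs_mul, abs_of_nonneg hk0]
    refine (mul_le_of_le_one_left (abs_nonneg _) hk1).trans ?_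
    refine H2'.trans ?_
    gcongr
  calc _ ≤ |P1.re| + |b * (G - k * J).re| + |P2.re| + |b * (k * (J.re - Z))| := by
        refine (abs_add_le _ _).trans ?_
        gcongr
        refine (abs_add_le _ _).trans ?_
        gcongr
        exact abs_add_le _ _
    _ ≤ B * π + C1 * Real.exp (0.997 * μ) + B * π + C2 * Real.exp (0.997 * μ) := by gcongr
    _ = _ := by rw [hB]; ring

end Assemble2

section Final

lemma ident {μ r : ℝ} (hμ : 0 < μ) (hr : 0 < r) (h : r ^ 2 = μ ^ 2 + 1 / 4) :
    xf (1 / (r + μ)) = 1 / (1 + 2 * r) ∧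
    Hf (1 / (r + μ)) = (1 + 2 * r) ^ 2 / (4 * μ ^ 2) * (1 - 1 / μ) * Real.exp (μ - r) := by
  obtain ⟨s, hs⟩ : ∃ s, s = 1 / (r + μ) := ⟨_, rfl⟩
  have hs0 : 0 < s := by rw [hs]; positivity
  have hs1 : s * (r + μ) = 1 := by rw [hs]; field_simp
  have hs2 : s = 4 * (r - μ) := by
    rw [hs, div_eq_iff (by positivity)]; nlinarith
  have hr' : r = 1 / (2 * s) + s / 8 := by
    have : 1 / (2 * s) = (r + μ) / 2 := by field_simp; linarith
    rw [this]; linarith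
  have hμ' : μ = 1 / (2 * s) - s / 8 := by
    have : 1 / (2 * s) = (r + μ) / 2 := by field_simp; linarith
    rw [this]; linarith
  rw [← hs]
  have h2 : 0 < 1 - s ^ 2 / 4 := by
    have : 1 - s ^ 2 / 4 = 2 * s * μ := by rw [hμ']; field_simp; ring
    rw [this]; positivity
  have h3 : 0 < 1 - 1 / 2 * s := by nlinarith
  have h4 : 0 < 1 + 1 / 2 * s := by positivity
  have e1 : 1 + 2 * r = (1 + 1/2 * s) ^ 2 / s := by rw [hr']; field_simp; ring
  have e2 : μ = (1 - 1/2 * s) * (1 + 1/2 * s) / (2 * s) := by rw [hμ']; field_simp; ring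
  have e3 : μ - r = -(1/4) * s := by linarith
  constructor
  · rw [xf, e1, one_div_div]
  · rw [Hf, e3, e1]
    congr 1
    rw [e2]
    have h3' := h3.ne'
    have h4' := h4.ne'
    have e4 : 1 - 2 * s - s ^ 2 / 4 = (1 - 1/2 * s) * (1 + 1/2 * s) - 2 * s := by ring
    rw [e4]
    generalize 1 - 1 / 2 * s = u at *
    generalize 1 + 1 / 2 * s = v at *
    field_simp
    ring

lemma sum_range_Icc (f : ℕ → ℝ) (N : ℕ) :
    ∑ l ∈ Finset.range (N + 1), f l = f 0 + ∑ l ∈ Finset.Icc 1 N, f l := by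
  rw [Finset.range_eq_Ico, Finset.sum_eq_sum_Ico_succ_bot (by omega)]
  congr 1

lemma pow_exp_tendsto (k : ℕ) {κ : ℝ} (hκ : 0 < κ) :
    Tendsto (fun x : ℝ => x ^ k * Real.exp (-(κ * x))) atTop (nhds 0) := by
  have h := (Real.tendsto_pow_mul_exp_neg_atTop_nhds_zero k).comp
    (tendsto_id.const_mul_atTop hκ)
  have h2 := h.const_mul ((κ ^ k)⁻¹)
  rw [mul_zero] at h2
  refine h2.congr fun x => ?_
  simp only [Function.comp, id]
  rw [mul_pow]
  field_simp

lemma rseq_tendsto : Tendsto rseq atTop atTop := by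
  unfold rseq
  apply Real.tendsto_sqrt_atTop.comp
  apply tendsto_atTop_add_const_right
  apply Tendsto.const_mul_atTop (by positivity)
  exact tendsto_atTop_add_const_right _ _ tendsto_natCast_atTop_atTop

lemma Q_lower {r : ℝ} (h3 : 2 ≤ r) :
    Real.exp r / (9 * r ^ 2) ≤ 2 * π ^ 2 / (3 * Real.sqrt 3) * (Real.exp r / (1 + 2 * r) ^ 2) := by
  have hpi := Real.pi_gt_three
  have hs3 : Real.sqrt 3 ≤ 2 := by
    rw [Real.sqrt_le_left (by norm_num)]; norm_num
  have g1 : 1 ≤ 2 * π ^ 2 / (3 * Real.sqrt 3) := by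
    rw [le_div_iff₀ (by positivity)]; nlinarith
  have g3 : (1 + 2 * r) ^ 2 ≤ 9 * r ^ 2 := by nlinarith
  have g2 : Real.exp r / (9 * r ^ 2) ≤ Real.exp r / (1 + 2 * r) ^ 2 :=
    div_le_div_of_nonneg_left (Real.exp_pos _).le (by positivity) g3
  exact g2.trans (le_mul_of_one_le_left (by positivity) g1)

end Final

/-- For every positive integer `N`, the error term `R` implicitly defined by the
simplified expansion of `p(n)` satisfies `n^{N/2}·R(n) → 0` as `n → ∞`. -/
theorem stmt1 (N : ℕ) (hN : 0 < N) (R : ℕ → ℝ)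
    (hR : ∀ n : ℕ, 1 ≤ n →
      (Fintype.card (Nat.Partition n) : ℝ) =
        2 * Real.pi ^ 2 / (3 * Real.sqrt 3) * (Real.exp (rseq n) / (1 + 2 * rseq n) ^ 2) *
          (1 - (∑ l ∈ Finset.Icc 1 N, Dcoef l / (1 + 2 * rseq n) ^ l) + R n)) :
    Tendsto (fun n : ℕ => (n : ℝ) ^ ((N : ℝ) / 2) * R n) atTop (nhds 0) := by
  obtain ⟨C, μ₀, hC, hA⟩ := card_asymp
  obtain ⟨K, hK, hO⟩ := (expansion_isBigO N).exists_nonneg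
  have hD0 : Dcoef 0 = -1 := by
    simp [Dcoef, Finset.sum_range_succ]
  -- s tends to 0
  have hrt := rseq_tendsto
  have hst : Tendsto (fun n : ℕ => 1 / (rseq n + Real.sqrt (2 * π ^ 2 / 3 * ((n : ℝ) - 1/24)))) atTop (nhds 0) := by
    simp only [one_div]
    apply tendsto_inv_atTop_zero.comp
    exact tendsto_atTop_mono (fun n => le_add_of_nonneg_right (Real.sqrt_nonneg _)) hrt
  have hev := hst.eventually hO.bound
  have hlim : Tendsto (fun n : ℕ => 9 * C * (rseq n ^ (N + 2) * Real.exp (-(0.003 * rseq n))) + K * (rseq n)⁻¹)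
      atTop (nhds 0) := by
    have h1 := ((pow_exp_tendsto (N + 2) (κ := 0.003) (by norm_num)).comp hrt).const_mul (9 * C)
    have h2 := (tendsto_inv_atTop_zero.comp hrt).const_mul K
    simpa using h1.add h2
  refine squeeze_zero_norm' ?_ hlim
  filter_upwards [hev, hrt.eventually_ge_atTop (μ₀ + 1), hrt.eventually_ge_atTop 2, eventually_ge_atTop 1]
    with n h1 h2 h3 hn
  have hn1 : (1 : ℝ) ≤ n := by exact_mod_cast hn
  have hpi := Real.pi_gt_three
  obtain ⟨r, hr⟩ : ∃ r, r = rseq n := ⟨_, rfl⟩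
  obtain ⟨μ, hμ⟩ : ∃ μ, μ = Real.sqrt (2 * π ^ 2 / 3 * ((n : ℝ) - 1/24)) := ⟨_, rfl⟩
  have hRn := hR n hn
  rw [← hr] at hRn h1 h2 h3 ⊢
  rw [← hμ] at h1
  have hpos : 0 < 2 * π ^ 2 / 3 * ((n : ℝ) - 1/24) := mul_pos (by positivity) (by linarith)
  have hμ0 : 0 < μ := by rw [hμ]; exact Real.sqrt_pos.mpr hpos
  have hr0 : 0 < r := by linarith
  have hμ2 : μ ^ 2 = 2 * π ^ 2 / 3 * ((n : ℝ) - 1/24) := by rw [hμ]; exact Real.sq_sqrt hpos.le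
  have hr2 : r ^ 2 = μ ^ 2 + 1 / 4 := by
    rw [hμ2, hr, rseq]; exact Real.sq_sqrt (by linarith)
  have hμr : μ ≤ r := by nlinarith
  have hμr1 : r - 1 ≤ μ := by nlinarith
  have hnr : (n : ℝ) ≤ r ^ 2 := by
    rw [hr2, hμ2]
    have : 6 ≤ 2 * π ^ 2 / 3 := by nlinarith
    nlinarith
  obtain ⟨id1, id2⟩ := ident hμ0 hr0 hr2
  set s := 1 / (r + μ) with hs
  have hs0 : 0 < s := by rw [hs]; positivity
  have hsr : s ≤ r⁻¹ := by
    rw [hs, one_div]; apply inv_anti₀ hr0; linarith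
  have hcard := hA n μ (by linarith) (by rw [hμ2]; field_simp)
  set p : ℝ := (Fintype.card (Nat.Partition n) : ℝ)
  set M := π ^ 2 / (6 * Real.sqrt 3) / μ ^ 2 * (1 - 1 / μ) * Real.exp μ with hM
  set E := Hf s + ∑ l ∈ Finset.range (N+1), Dcoef l * xf s ^ l with hE
  obtain ⟨Q, hQ⟩ : ∃ Q, Q = 2 * π ^ 2 / (3 * Real.sqrt 3) * (Real.exp r / (1 + 2 * r) ^ 2) := ⟨_, rfl⟩
  have hQ0 : 0 < Q := by rw [hQ]; positivity
  have hMQ : M = Q * Hf s := by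
    rw [id2, hM, hQ, Real.exp_sub]
    field_simp
    ring
  have hER : R n = (p - M) / Q + E := by
    rw [← hQ] at hRn
    have hsum : ∑ l ∈ Finset.range (N+1), Dcoef l * xf s ^ l =
        -1 + ∑ l ∈ Finset.Icc 1 N, Dcoef l / (1 + 2 * r) ^ l := by
      rw [sum_range_Icc, hD0, id1]
      simp [div_eq_mul_inv]
    rw [hE, hsum, hMQ, hRn]
    field_simp
    ring
  have hb1 : |(p - M) / Q| ≤ 9 * C * (r ^ 2 * Real.exp (-(0.003 * r))) := by
    rw [abs_div, abs_of_pos hQ0, div_le_iff₀ hQ0]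
    refine hcard.trans ?_
    have hQ1 : Real.exp r / (9 * r ^ 2) ≤ Q := by
      rw [hQ]; exact Q_lower (by linarith)
    calc C * Real.exp (0.997 * μ) ≤ C * Real.exp (0.997 * r) := by gcongr
      _ = C * (Real.exp (-(0.003 * r)) * Real.exp r) := by rw [← Real.exp_add]; congr 2; ring
      _ = 9 * C * (r ^ 2 * Real.exp (-(0.003 * r))) * (Real.exp r / (9 * r ^ 2)) := by field_simp
      _ ≤ _ := by gcongr
  have hb2 : |E| ≤ K * (r⁻¹) ^ (N + 1) := by
    rw [Real.norm_eq_abs, Real.norm_eq_abs] at h1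
    refine h1.trans ?_
    rw [abs_of_pos (by positivity)]
    gcongr
  have hnN : (n : ℝ) ^ ((N : ℝ) / 2) ≤ r ^ N := by
    calc (n : ℝ) ^ ((N : ℝ) / 2) ≤ (r ^ 2) ^ ((N : ℝ) / 2) := by gcongr
      _ = r ^ N := by
        rw [← Real.rpow_natCast r 2, ← Real.rpow_mul hr0.le, ← Real.rpow_natCast r N]
        congr 1; push_cast; ring
  rw [norm_mul, Real.norm_eq_abs, Real.norm_eq_abs, abs_of_nonneg (by positivity), hER]
  calc _ ≤ r ^ N * (9 * C * (r ^ 2 * Real.exp (-(0.003 * r))) + K * (r⁻¹) ^ (N + 1)) := by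
        gcongr
        exact (abs_add_le _ _).trans (add_le_add hb1 hb2)
    _ = _ := by
      have : r ^ N * (r⁻¹) ^ (N + 1) = r⁻¹ := by
        rw [pow_succ, ← mul_assoc, ← mul_pow, mul_inv_cancel₀ hr0.ne', one_pow, one_mul]
      rw [mul_add, mul_left_comm (r ^ N) K, this, pow_add]
      ring
end

section
/- For every t ∈ (0,1), log f(t) = π²/(6·(−log t)) − log(√(2π)) − (1/24)·(−log t) + (1/2)·log(−log t) + log f(e^{−4π²/(−log t)}). -/
open Real

/-- Euler's generating function `f(t) = ∏_{j≥1} 1/(1−t^j)`. -/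
noncomputable def partitionGF (t : ℝ) : ℝ := ∏' j : ℕ, 1 / (1 - t ^ (j + 1))

open UpperHalfPlane in
lemma eta_I_norm (y : ℝ) (hy : 0 < y) :
    Real.log ‖ModularForm.eta (Complex.I * y)‖ = -(π * y / 12) - Real.log (partitionGF (Real.exp (-(2 * π * y)))) := by
  have hz : (Complex.I * y) ∈ upperHalfPlaneSet := by
    simp [upperHalfPlaneSet, hy]
  have hq : ∀ n, ModularForm.eta_q n (Complex.I * y) = ((Real.exp (-(2 * π * y)) ^ (n + 1) : ℝ) : ℂ) := by
    intro n
    rw [ModularForm.eta_q_eq_pow]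
    push_cast
    congr 2
    linear_combination (2 * π * y : ℂ) * Complex.I_mul_I
  have hlt : Real.exp (-(2 * π * y)) < 1 := by
    rw [Real.exp_lt_one_iff]
    have := Real.pi_pos
    nlinarith [mul_pos this hy]
  have hpos := Real.exp_pos (-(2 * π * y))
  have hne := ModularForm.eta_tprod_ne_zero hz
  have hm := ModularForm.multipliableLocallyUniformlyOn_eta.multipliable hz
  have hP : partitionGF (Real.exp (-(2 * π * y))) = ‖∏' n, (1 - ModularForm.eta_q n (Complex.I * y))‖⁻¹ := by
    have h1 := (hm.hasProd.norm).inv₀ (by simpa using hne)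
    rw [← h1.tprod_eq, partitionGF]
    congr 1
    ext n
    rw [hq, one_div]
    congr 1
    rw [← Complex.ofReal_one, ← Complex.ofReal_sub, Complex.norm_real, Real.norm_of_nonneg]
    have := pow_le_one₀ (n := n + 1) hpos.le hlt.le
    linarith
  rw [hP, Real.log_inv, ModularForm.eta, norm_mul, Real.log_mul (by simp [Function.Periodic.qParam]) (by simpa using hne)]
  have : Real.log ‖Function.Periodic.qParam 24 (Complex.I * y)‖ = -(π * y / 12) := by
    rw [Function.Periodic.norm_qParam, Real.log_exp]
    simp
    ring
  rw [this]
  ring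

/-- Functional equation for `log f(t)`. -/
theorem stmt2 (t : ℝ) (ht : t ∈ Set.Ioo (0 : ℝ) 1) :
    Real.log (partitionGF t) =
      Real.pi ^ 2 / (6 * (-Real.log t)) - Real.log (Real.sqrt (2 * Real.pi))
        - 1 / 24 * (-Real.log t) + 1 / 2 * Real.log (-Real.log t)
        + Real.log (partitionGF (Real.exp (-(4 * Real.pi ^ 2) / (-Real.log t)))) := by
  obtain ⟨h0, h1⟩ := ht
  have hlog := Real.log_neg h0 h1
  obtain ⟨s, hs⟩ : ∃ s, s = -Real.log t := ⟨_, rfl⟩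
  have hs0 : 0 < s := by linarith
  have htt : t = Real.exp (-s) := by rw [hs, neg_neg, Real.exp_log h0]
  rw [← hs, htt]
  have hpi := Real.pi_pos
  obtain ⟨y, hy⟩ : ∃ y, y = s / (2 * π) := ⟨_, rfl⟩
  have hy0 : 0 < y := by rw [hy]; positivity
  have e1 := eta_I_norm y hy0
  have e2 := eta_I_norm y⁻¹ (by positivity)
  have hz : (Complex.I * y) ∈ UpperHalfPlane.upperHalfPlaneSet := by
    simp [UpperHalfPlane.upperHalfPlaneSet, hy0]
  have key := congrArg norm (ModularForm.eta_comp_eq_csqrt_I_inv hz)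
  have hinv : (-1 / (Complex.I * y) : ℂ) = Complex.I * (y⁻¹ : ℝ) := by
    have : (y : ℂ) ≠ 0 := by exact_mod_cast hy0.ne'
    push_cast
    field_simp
    simp
  have hsq : ∀ z : ℂ, z ≠ 0 → ‖Complex.sqrt z‖ ^ 2 = ‖z‖ := by
    intro z hz
    rw [← norm_pow, sqrt_eq_exp hz, ← Complex.exp_nat_mul]
    push_cast
    rw [mul_div_cancel₀ _ (by norm_num), Complex.exp_log hz]
  have hsl : ∀ z : ℂ, z ≠ 0 → Real.log ‖Complex.sqrt z‖ = 1 / 2 * Real.log ‖z‖ := by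
    intro z hz
    rw [← hsq z hz, Real.log_pow]; push_cast; ring
  have hyne : (Complex.I * y : ℂ) ≠ 0 := by simp [hy0.ne']
  have hsn : ∀ z : ℂ, z ≠ 0 → ‖Complex.sqrt z‖ ≠ 0 := by
    intro z hz h
    have := hsq z hz
    rw [h] at this
    simp at this
    exact hz (norm_eq_zero.mp this.symm)
  have en : ‖ModularForm.eta (Complex.I * y)‖ ≠ 0 := by simpa using ModularForm.eta_ne_zero hz
  simp only [Function.comp_apply, hinv, Pi.smul_apply, Pi.mul_apply, smul_eq_mul, norm_mul, norm_inv] at key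
  have key2 := congrArg Real.log key
  rw [Real.log_mul (inv_ne_zero (hsn _ Complex.I_ne_zero)) (mul_ne_zero (hsn _ hyne) en),
    Real.log_mul (hsn _ hyne) en, Real.log_inv, hsl _ Complex.I_ne_zero, hsl _ hyne, e1, e2] at key2
  have a1 : -(2 * π * y) = -s := by rw [hy]; field_simp
  have a2 : -(2 * π * y⁻¹) = -(4 * π ^ 2) / s := by rw [hy]; field_simp; norm_num
  have a3 : Real.log ‖(Complex.I * y : ℂ)‖ = Real.log s - Real.log (2 * π) := by
    rw [norm_mul, Complex.norm_I, one_mul, Complex.norm_real, Real.norm_of_nonneg hy0.le, hy,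
      Real.log_div hs0.ne' (by positivity)]
  have a4 : π * y / 12 = s / 24 := by rw [hy]; field_simp; norm_num
  have a5 : π * y⁻¹ / 12 = π ^ 2 / (6 * s) := by rw [hy]; field_simp; norm_num
  rw [a1, a2, a3, a4, a5] at key2
  simp only [Complex.norm_I, Real.log_one] at key2
  rw [Real.log_sqrt (by positivity)]
  linarith
end

section
/- For every t ∈ (0,1), κ₁(t) = π²/(6·(−log t)²) − 1/(2·(−log t)) + 1/24 − (4π²/(−log t)²) · κ₁(e^{−4π²/(−log t)}). -/
open Real

/-- `κ₁(t) = ∑_{j≥1} j·t^j/(1−t^j)`. -/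
noncomputable def kappa1 (t : ℝ) : ℝ :=
  ∑' j : ℕ, ((j : ℝ) + 1) * t ^ (j + 1) / (1 - t ^ (j + 1))

lemma kappa_G2 (z : UpperHalfPlane) (x : ℝ)
    (h : Complex.exp (2 * Real.pi * Complex.I * (z : ℂ)) = (x : ℂ)) :
    EisensteinSeries.G2 z = 2 * ((Real.pi : ℂ) ^ 2 / 6) - 8 * Real.pi ^ 2 * (kappa1 x : ℂ) := by
  have hn := UpperHalfPlane.norm_exp_two_pi_I_lt_one z
  rw [EisensteinSeries.G2_eq_tsum_cexp, riemannZeta_two,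
    ← tsum_pow_div_one_sub_eq_tsum_sigma hn]
  congr 2
  rw [h, tsum_pnat_eq_tsum_succ (f := fun n : ℕ ↦ (n : ℂ) ^ 1 * (x : ℂ) ^ n / (1 - (x : ℂ) ^ n))]
  simp [kappa1, Complex.ofReal_tsum]

/-- Functional equation for the mean `κ₁(t)`. -/
theorem stmt4 (t : ℝ) (ht : t ∈ Set.Ioo (0 : ℝ) 1) :
    kappa1 t =
      Real.pi ^ 2 / (6 * (-Real.log t) ^ 2) - 1 / (2 * (-Real.log t)) + 1 / 24
        - 4 * Real.pi ^ 2 / (-Real.log t) ^ 2 *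
            kappa1 (Real.exp (-(4 * Real.pi ^ 2) / (-Real.log t))) := by
  have hL : 0 < -Real.log t := by
    have := Real.log_neg ht.1 ht.2
    linarith
  have hte : t = Real.exp (-(-Real.log t)) := by rw [neg_neg, Real.exp_log ht.1]
  set L := -Real.log t with hLdef
  have hpi := Real.pi_pos
  have hLc : (L : ℂ) ≠ 0 := by exact_mod_cast hL.ne'
  have hpc : (Real.pi : ℂ) ≠ 0 := by exact_mod_cast hpi.ne'
  have hI : Complex.I ^ 2 = -1 := Complex.I_sq
  have hI0 := Complex.I_ne_zero
  have hz0 : 0 < (((L / (2 * Real.pi) : ℝ) : ℂ) * Complex.I).im := by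
    rw [Complex.im_ofReal_mul, Complex.I_im, mul_one]
    positivity
  let z : UpperHalfPlane := ⟨((L / (2 * Real.pi) : ℝ) : ℂ) * Complex.I, hz0⟩
  have hz : (z : ℂ) = (L : ℂ) / (2 * Real.pi) * Complex.I := by
    change ((L / (2 * Real.pi) : ℝ) : ℂ) * Complex.I = _
    push_cast
    rfl
  have hS : ((ModularGroup.S • z : UpperHalfPlane) : ℂ) = 2 * Real.pi / L * Complex.I := by
    rw [UpperHalfPlane.modular_S_smul, UpperHalfPlane.coe_mk, hz]
    field_simp
    rw [hI]
  have h1 := kappa_G2 z t (by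
    rw [hz, hte, Complex.ofReal_exp]
    congr 1
    push_cast
    field_simp
    rw [hI])
  have h2 := kappa_G2 (ModularGroup.S • z) (Real.exp (-(4 * Real.pi ^ 2) / L)) (by
    rw [hS, Complex.ofReal_exp]
    congr 1
    push_cast
    field_simp
    rw [hI]
    ring)
  have h3 := EisensteinSeries.G2_S_transform z
  rw [h1, h2, hz] at h3
  apply Complex.ofReal_injective
  generalize kappa1 (Real.exp (-(4 * Real.pi ^ 2) / L)) = k' at *
  generalize kappa1 t = k at *
  push_cast
  have e1 : ((((L : ℂ) / (2 * Real.pi) * Complex.I)) ^ 2)⁻¹ = -(4 * (Real.pi : ℂ) ^ 2 / (L : ℂ) ^ 2) := by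
    rw [mul_pow, hI]
    field_simp
    ring
  have e2 : -2 * (Real.pi : ℂ) * Complex.I / ((L : ℂ) / (2 * Real.pi) * Complex.I)
      = -(4 * Real.pi ^ 2 / L) := by
    field_simp
    ring
  rw [e1, e2] at h3
  have h4 : (8 * (Real.pi : ℂ) ^ 2) * k = (8 * (Real.pi : ℂ) ^ 2) *
      (Real.pi ^ 2 / (6 * L ^ 2) - 1 / (2 * L) + 1 / 24 - 4 * Real.pi ^ 2 / L ^ 2 * k') := by
    have : (8 * (Real.pi : ℂ) ^ 2) * k = 2 * ((Real.pi : ℂ) ^ 2 / 6) -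
      (2 * ((Real.pi : ℂ) ^ 2 / 6) - 8 * Real.pi ^ 2 * k) := by ring
    rw [this, h3]
    field_simp
    ring
  exact mul_left_cancel₀ (by simp [hpc]) h4
end

section
/- For every t ∈ (0,1), κ₂(t) = π²/(3·(−log t)³) − 1/(2·(−log t)²) + (4π²/(−log t)²)² · κ₂(e^{−4π²/(−log t)}) − (8π²/(−log t)³) · κ₁(e^{−4π²/(−log t)}). -/
open Real

/-- `κ₂(t) = ∑_{j≥1} j²·t^j/(1−t^j)²`. -/
noncomputable def kappa2 (t : ℝ) : ℝ :=
  ∑' j : ℕ, ((j : ℝ) + 1) ^ 2 * t ^ (j + 1) / (1 - t ^ (j + 1)) ^ 2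

lemma G2_eq_kappa1 (z : UpperHalfPlane) (t : ℝ) (h0 : 0 < t) (h1 : t < 1)
    (hz : Complex.exp (2 * Real.pi * Complex.I * (z : ℂ)) = (t : ℂ)) :
    EisensteinSeries.G2 z = ((Real.pi ^ 2 / 3 - 8 * Real.pi ^ 2 * kappa1 t : ℝ) : ℂ) := by
  have hn : ‖(t : ℂ)‖ < 1 := by
    rw [Complex.norm_real, Real.norm_eq_abs, abs_of_pos h0]; exact h1
  rw [EisensteinSeries.G2_eq_tsum_cexp, hz, ← tsum_pow_div_one_sub_eq_tsum_sigma hn 1,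
    tsum_pnat_eq_tsum_succ (f := fun n : ℕ ↦ (n : ℂ) ^ 1 * (t : ℂ) ^ n / (1 - (t : ℂ) ^ n)),
    riemannZeta_two, kappa1]
  push_cast
  simp only [pow_one]
  ring

lemma kappa1_transform (s : ℝ) (hs : 0 < s) :
    kappa1 (Real.exp (-s)) = 1 / 24 - 1 / (2 * s)
      + Real.pi ^ 2 / (6 * s ^ 2) * (1 - 24 * kappa1 (Real.exp (-(4 * Real.pi ^ 2) / s))) := by
  have hpi := Real.pi_pos
  have hpc : (Real.pi : ℂ) ≠ 0 := by exact_mod_cast hpi.ne'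
  have hsc : (s : ℂ) ≠ 0 := by exact_mod_cast hs.ne'
  have hI : Complex.I ^ 2 = -1 := Complex.I_sq
  let z : UpperHalfPlane := ⟨Complex.I * ((s / (2 * Real.pi) : ℝ) : ℂ), by
    rw [Complex.I_mul_im, Complex.ofReal_re]; positivity⟩
  have hz : (z : ℂ) = Complex.I * s / (2 * Real.pi) := by
    change Complex.I * ((s / (2 * Real.pi) : ℝ) : ℂ) = _
    push_cast; ring
  have h1 := G2_eq_kappa1 z (Real.exp (-s)) (Real.exp_pos _) (by simpa using hs) (by
    rw [hz]; push_cast; congr 1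
    field_simp; rw [hI])
  have h2 := G2_eq_kappa1 (ModularGroup.S • z) (Real.exp (-(4 * Real.pi ^ 2) / s))
    (Real.exp_pos _) (by
      rw [Real.exp_lt_one_iff]; apply div_neg_of_neg_of_pos _ hs
      have : 0 < Real.pi ^ 2 := by positivity
      linarith) (by
    rw [UpperHalfPlane.modular_S_smul]
    change Complex.exp (2 * Real.pi * Complex.I * (-(z : ℂ))⁻¹) = _
    rw [hz]; push_cast; congr 1
    field_simp; ring)
  have h3 := EisensteinSeries.G2_S_transform z
  rw [h1, h2, hz] at h3
  generalize kappa1 (Real.exp (-s)) = a at *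
  generalize kappa1 (Real.exp (-(4 * Real.pi ^ 2) / s)) = b at *
  have h4 : (((Complex.I * s / (2 * Real.pi)) ^ 2)⁻¹ : ℂ) = ((-(4 * Real.pi ^ 2 / s ^ 2) : ℝ) : ℂ) := by
    rw [div_pow, mul_pow, hI]; push_cast; field_simp; norm_num
  have h5 : (-2 * Real.pi * Complex.I / (Complex.I * s / (2 * Real.pi)) : ℂ)
      = ((-(4 * Real.pi ^ 2 / s) : ℝ) : ℂ) := by
    push_cast; field_simp; norm_num
  rw [h4, h5] at h3
  have h6 : Real.pi ^ 2 / 3 - 8 * Real.pi ^ 2 * a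
    = -(4 * Real.pi ^ 2 / s ^ 2) * (Real.pi ^ 2 / 3 - 8 * Real.pi ^ 2 * b)
      - -(4 * Real.pi ^ 2 / s) := by exact_mod_cast h3
  field_simp at h6 ⊢
  linarith

lemma kappa1_hasDerivAt (s : ℝ) (hs : 0 < s) :
    HasDerivAt (fun x => kappa1 (Real.exp (-x))) (-kappa2 (Real.exp (-s))) s := by
  unfold kappa1 kappa2
  rw [← tsum_neg]
  set r := Real.exp (-(s / 2)) with hr
  have hr0 : 0 < r := Real.exp_pos _
  have hr1 : r < 1 := by rw [hr, Real.exp_lt_one_iff]; linarith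
  have hsum : ∀ k : ℕ, Summable fun n : ℕ => ((n : ℝ) + 1) ^ k * r ^ (n + 1) := by
    intro k
    have := (summable_nat_add_iff 1).mpr (summable_pow_mul_geometric_of_norm_lt_one k (r := r)
      (by rw [Real.norm_eq_abs, abs_of_pos hr0]; exact hr1))
    simpa using this
  have key : ∀ (n : ℕ) (y : ℝ), y ∈ Set.Ioi (s / 2) →
      0 < Real.exp (-y) ^ (n + 1) ∧ Real.exp (-y) ^ (n + 1) ≤ r ^ (n + 1) ∧
      1 - r ≤ 1 - Real.exp (-y) ^ (n + 1) := by
    intro n y hy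
    have hy' : s / 2 < y := hy
    have h1 : Real.exp (-y) ^ (n + 1) ≤ r ^ (n + 1) := by
      apply pow_le_pow_left₀ (Real.exp_pos _).le
      rw [hr, Real.exp_le_exp]; linarith
    have h2 : r ^ (n + 1) ≤ r := pow_le_of_le_one hr0.le hr1.le (by omega)
    exact ⟨pow_pos (Real.exp_pos _) _, h1, by linarith⟩
  refine hasDerivAt_tsum_of_isPreconnected
    (g := fun (n : ℕ) (x : ℝ) => ((n : ℝ) + 1) * Real.exp (-x) ^ (n + 1) / (1 - Real.exp (-x) ^ (n + 1)))
    (g' := fun (n : ℕ) (x : ℝ) => -(((n : ℝ) + 1) ^ 2 * Real.exp (-x) ^ (n + 1) / (1 - Real.exp (-x) ^ (n + 1)) ^ 2))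
    (u := fun n : ℕ => ((n : ℝ) + 1) ^ 2 * r ^ (n + 1) / (1 - r) ^ 2)
    (t := Set.Ioi (s / 2)) (y₀ := s) ((hsum 2).div_const _) isOpen_Ioi isPreconnected_Ioi
    ?_ ?_ (by simpa using hs) ?_ (by simpa using hs)
  · intro n y hy
    obtain ⟨k0, k1, k2⟩ := key n y hy
    have hne : 1 - Real.exp (-y) ^ (n + 1) ≠ 0 := by linarith
    have he : HasDerivAt (fun x : ℝ => Real.exp (-x) ^ (n + 1))
        (-((n : ℝ) + 1) * Real.exp (-y) ^ (n + 1)) y := by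
      have := ((hasDerivAt_neg y).exp).pow (n + 1)
      refine this.congr_deriv ?_
      push_cast
      ring
    have := (he.const_mul ((n : ℝ) + 1)).div (he.const_sub 1) hne
    refine this.congr_deriv ?_
    field_simp
    ring
  · intro n y hy
    obtain ⟨k0, k1, k2⟩ := key n y hy
    have : 0 < 1 - r := by linarith
    rw [norm_neg, Real.norm_eq_abs, abs_of_nonneg (by positivity)]
    gcongr
  · have : 0 < 1 - r := by linarith
    refine Summable.of_nonneg_of_le ?_ ?_ ((hsum 1).div_const (1 - r))
    · intro n
      obtain ⟨k0, k1, k2⟩ := key n s (by simpa using hs)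
      have : 0 < 1 - Real.exp (-s) ^ (n + 1) := by linarith
      positivity
    · intro n
      obtain ⟨k0, k1, k2⟩ := key n s (by simpa using hs)
      rw [pow_one]
      gcongr

/-- Functional equation for the variance `κ₂(t)`. -/
theorem stmt5 (t : ℝ) (ht : t ∈ Set.Ioo (0 : ℝ) 1) :
    kappa2 t =
      Real.pi ^ 2 / (3 * (-Real.log t) ^ 3) - 1 / (2 * (-Real.log t) ^ 2)
        + (4 * Real.pi ^ 2 / (-Real.log t) ^ 2) ^ 2 *
            kappa2 (Real.exp (-(4 * Real.pi ^ 2) / (-Real.log t)))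
        - 8 * Real.pi ^ 2 / (-Real.log t) ^ 3 *
            kappa1 (Real.exp (-(4 * Real.pi ^ 2) / (-Real.log t))) := by
  obtain ⟨h0, h1⟩ := ht
  obtain ⟨s, hs, rfl⟩ : ∃ s : ℝ, 0 < s ∧ t = Real.exp (-s) :=
    ⟨-Real.log t, by have := Real.log_neg h0 h1; linarith, by rw [neg_neg, Real.exp_log h0]⟩
  rw [Real.log_exp, neg_neg]
  have hpi := Real.pi_pos
  have d1 := kappa1_hasDerivAt s hs
  have hs' : 0 < 4 * Real.pi ^ 2 / s := by positivity
  have d2 := kappa1_hasDerivAt _ hs'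
  have di : HasDerivAt (fun x : ℝ => 4 * Real.pi ^ 2 / x) (-(4 * Real.pi ^ 2) / s ^ 2) s := by
    have := (hasDerivAt_inv hs.ne').const_mul (4 * Real.pi ^ 2)
    refine this.congr_deriv ?_
    ring
  have d3 := HasDerivAt.comp s d2 di
  have dp : HasDerivAt (fun x : ℝ => Real.pi ^ 2 / 6 * (x⁻¹ * x⁻¹))
      (-(Real.pi ^ 2 / (3 * s ^ 3))) s := by
    have := ((hasDerivAt_inv hs.ne').mul (hasDerivAt_inv hs.ne')).const_mul (Real.pi ^ 2 / 6)
    refine this.congr_deriv ?_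
    field_simp
    ring
  have dq : HasDerivAt (fun x : ℝ => 1 / 24 - 1 / 2 * x⁻¹) (1 / (2 * s ^ 2)) s := by
    have := ((hasDerivAt_inv hs.ne').const_mul (1 / 2)).const_sub (1 / 24)
    refine this.congr_deriv ?_
    field_simp
  have d4 := dq.add (dp.mul ((d3.const_mul 24).const_sub 1))
  have heq : (fun x => kappa1 (Real.exp (-x))) =ᶠ[nhds s] _ :=
    Filter.eventuallyEq_of_mem (Ioi_mem_nhds hs) (fun x hx => kappa1_transform x hx)
  have d5 := (d1.congr_of_eventuallyEq heq.symm)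
  have d6 := d5.unique (d4.congr_of_eventuallyEq (Filter.Eventually.of_forall fun x => by
    simp only [Pi.add_apply, Pi.mul_apply, Function.comp, neg_div]
    ring))
  simp only [Function.comp, ← neg_div] at d6
  have d7 := neg_eq_iff_eq_neg.mp d6
  clear d6
  rw [d7]
  field_simp
  ring
end

section
/- There exists a positive constant C such that for every natural number n ≥ 1: |π²/(3·(−log t_n)) − (1/2 + r_n)| ≤ C · √n · e^{−2π√(24n − 1)}. -/
open Real

lemma le_of_sq_le_sq_aux {a b : ℝ} (h : a ^ 2 ≤ b ^ 2) (hb : 0 ≤ b) : a ≤ b :=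
  abs_le_of_sq_le_sq' h hb |>.2

open EisensteinSeries UpperHalfPlane in
lemma E2_imag (z : ℍ) (y : ℝ) (hy : 0 < y) (hz : (z : ℂ) = Complex.I * y) :
    E2 z = ((1 - 24 * kappa1 (Real.exp (-(2 * π * y))) : ℝ) : ℂ) := by
  have hq : Complex.exp (2 * π * Complex.I * z) = ((Real.exp (-(2 * π * y)) : ℝ) : ℂ) := by
    rw [hz]
    push_cast
    congr 1
    linear_combination (2 * π * y : ℂ) * Complex.I_mul_I
  have hn : ‖((Real.exp (-(2 * π * y)) : ℝ) : ℂ)‖ < 1 := by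
    rw [Complex.norm_real, Real.norm_eq_abs, abs_of_pos (Real.exp_pos _), Real.exp_lt_one_iff]
    have := mul_pos (mul_pos two_pos pi_pos) hy
    linarith
  rw [E2_eq_tsum_cexp, hq, kappa1]
  have h := tsum_pow_div_one_sub_eq_tsum_sigma hn 1
  have h2 := tsum_pnat_eq_tsum_succ (f := fun n : ℕ => (n : ℂ) ^ 1 * ((Real.exp (-(2 * π * y)) : ℝ) : ℂ) ^ n / (1 - ((Real.exp (-(2 * π * y)) : ℝ) : ℂ) ^ n))
  rw [h2] at h
  rw [← h]
  push_cast
  simp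

open EisensteinSeries UpperHalfPlane in
lemma kappa_transform (y : ℝ) (hy : 0 < y) :
    1 - 24 * kappa1 (Real.exp (-(2 * π * y))) =
      -(1 - 24 * kappa1 (Real.exp (-(2 * π * (1 / y))))) / y ^ 2 + 6 / (π * y) := by
  let z : ℍ := ⟨Complex.I * y, by simpa using hy⟩
  have hz : (z : ℂ) = Complex.I * y := rfl
  have hyc : (y : ℂ) ≠ 0 := by exact_mod_cast hy.ne'
  have hS : ((ModularGroup.S • z : ℍ) : ℂ) = Complex.I * ((1 / y : ℝ) : ℂ) := by
    rw [UpperHalfPlane.modular_S_smul]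
    simp only [hz]
    push_cast
    have := Complex.I_ne_zero
    field_simp
    simp
  have h1 := E2_imag z y hy hz
  have h2 := E2_imag _ (1 / y) (by positivity) hS
  have h3 := G2_S_transform z
  have h4 : E2 z = ((z : ℂ) ^ 2)⁻¹ * E2 (ModularGroup.S • z) + 6 * Complex.I / (π * z) := by
    simp only [E2, Pi.smul_apply, smul_eq_mul]
    rw [h3, riemannZeta_two]
    have : (π : ℂ) ≠ 0 := by exact_mod_cast pi_ne_zero
    have := z.ne_zero
    field_simp
    ring
  rw [h1, h2, hz] at h4
  have hp : (π : ℂ) ≠ 0 := by exact_mod_cast pi_ne_zero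
  have h5 : 6 * Complex.I / (π * (Complex.I * y)) = ((6 / (π * y) : ℝ) : ℂ) := by
    have := Complex.I_ne_zero
    push_cast
    field_simp
  have h6 : ((Complex.I * y) ^ 2)⁻¹ = ((-1 / y ^ 2 : ℝ) : ℂ) := by
    rw [mul_pow, Complex.I_sq]
    push_cast
    field_simp
  rw [h5, h6] at h4
  have h7 := Complex.ofReal_injective (by exact_mod_cast h4 : ((1 - 24 * kappa1 (Real.exp (-(2 * π * y))) : ℝ) : ℂ) = ((-1 / y ^ 2 * (1 - 24 * kappa1 (Real.exp (-(2 * π * (1 / y))))) + 6 / (π * y) : ℝ) : ℂ))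
  rw [h7]; ring

lemma kappa_bound : ∃ B : ℝ, 0 < B ∧ ∀ q : ℝ, 0 < q → q ≤ 1 / 2 →
    0 ≤ kappa1 q ∧ kappa1 q ≤ B * q := by
  have hs : Summable (fun j : ℕ => ((j : ℝ) + 1) * (1 / 2 : ℝ) ^ j) := by
    have h1 := summable_pow_mul_geometric_of_norm_lt_one 1 (r := (1 / 2 : ℝ)) (by norm_num)
    have h2 := summable_geometric_of_lt_one (r := (1 / 2 : ℝ)) (by norm_num) (by norm_num)
    refine (h1.add h2).congr fun j => ?_
    ring
  refine ⟨2 * ∑' j : ℕ, ((j : ℝ) + 1) * (1 / 2 : ℝ) ^ j + 1, ?_, ?_⟩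
  · have : 0 ≤ ∑' j : ℕ, ((j : ℝ) + 1) * (1 / 2 : ℝ) ^ j := tsum_nonneg fun j => by positivity
    linarith
  intro q hq hq2
  have hp : ∀ j : ℕ, q ^ (j + 1) ≤ 1 / 2 := fun j => by
    have : q ^ j ≤ 1 := pow_le_one₀ hq.le (by linarith)
    rw [pow_succ]; nlinarith
  have h0 : ∀ j : ℕ, 0 ≤ ((j : ℝ) + 1) * q ^ (j + 1) / (1 - q ^ (j + 1)) := fun j =>
    div_nonneg (by positivity) (by linarith [hp j])
  have hb : ∀ j : ℕ, ((j : ℝ) + 1) * q ^ (j + 1) / (1 - q ^ (j + 1)) ≤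
      (2 * q) * (((j : ℝ) + 1) * (1 / 2 : ℝ) ^ j) := fun j => by
    rw [div_le_iff₀ (by linarith [hp j])]
    have h1 : q ^ j ≤ (1 / 2 : ℝ) ^ j := pow_le_pow_left₀ hq.le hq2 j
    have h2 : ((j : ℝ) + 1) * q ^ (j + 1) ≤ q * (((j : ℝ) + 1) * (1 / 2 : ℝ) ^ j) := by
      rw [pow_succ]
      calc _ = q * (((j : ℝ) + 1) * q ^ j) := by ring
        _ ≤ _ := by gcongr
    have h3 : 0 ≤ q * (((j : ℝ) + 1) * (1 / 2 : ℝ) ^ j) := by positivity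
    nlinarith [hp j]
  have hS2 := hs.mul_left (2 * q)
  refine ⟨tsum_nonneg h0, ?_⟩
  have := (Summable.of_nonneg_of_le h0 hb hS2).tsum_le_tsum hb hS2
  rw [tsum_mul_left] at this
  unfold kappa1
  linarith

set_option maxHeartbeats 1000000 in
theorem stmt10 :
    ∃ C : ℝ, 0 < C ∧ ∀ n : ℕ, 1 ≤ n → ∀ t : ℝ, t ∈ Set.Ioo (0 : ℝ) 1 → kappa1 t = n →
      |Real.pi ^ 2 / (3 * (-Real.log t)) - (1 / 2 + rseq n)| ≤
        C * Real.sqrt n * Real.exp (-(2 * Real.pi) * Real.sqrt (24 * (n : ℝ) - 1)) := by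
  obtain ⟨B, hB, hK⟩ := kappa_bound
  refine ⟨48 * B * 12, by positivity, ?_⟩
  rintro n hn t ⟨ht0, ht1⟩ hk
  have hn' : (1 : ℝ) ≤ n := by exact_mod_cast hn
  set s := -Real.log t with hs
  have hs0 : 0 < s := by
    have := Real.log_neg ht0 ht1
    linarith
  have hts : t = Real.exp (-s) := by rw [hs, neg_neg, Real.exp_log ht0]
  set x := π ^ 2 / (3 * s) with hx
  have hx0 : 0 < x := by positivity
  have hpi := pi_pos
  have hpi3 := pi_gt_three
  have hpi4 : π < 3.15 := pi_lt_d2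
  have htr := kappa_transform (s / (2 * π)) (by positivity)
  have e1 : -(2 * π * (s / (2 * π))) = -s := by field_simp
  have e2 : -(2 * π * (1 / (s / (2 * π)))) = -(12 * x) := by
    rw [hx]; field_simp; ring
  rw [e1, e2, ← hts, hk] at htr
  set K := kappa1 (Real.exp (-(12 * x))) with hKd
  set r := rseq n with hr
  have hrarg : 1 / 4 < 2 * π ^ 2 / 3 * ((n : ℝ) - 1 / 24) + 1 / 4 := by
    have : 0 < 2 * π ^ 2 / 3 * ((n : ℝ) - 1 / 24) := mul_pos (by positivity) (by linarith)
    linarith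
  have hr2 : r ^ 2 = 2 * π ^ 2 / 3 * ((n : ℝ) - 1 / 24) + 1 / 4 :=
    Real.sq_sqrt (by linarith)
  have hr0 : 0 ≤ r := Real.sqrt_nonneg _
  have hr1 : 1 ≤ r := by
    have : 1 ≤ r ^ 2 := by
      rw [hr2]
      have : 6 * (23 / 24) ≤ 2 * π ^ 2 / 3 * ((n : ℝ) - 1 / 24) := by
        apply mul_le_mul <;> nlinarith
      linarith
    nlinarith
  have key : (x - 1 / 2) ^ 2 = r ^ 2 + 24 * x ^ 2 * K := by
    rw [hr2]
    have hsx : s = π ^ 2 / (3 * x) := by rw [hx]; field_simp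
    rw [hsx] at htr
    field_simp at htr
    linear_combination (1 / 36 : ℝ) * htr
  -- nonnegativity of K without size constraint
  have hK0 : 0 ≤ K := by
    rw [hKd]
    refine tsum_nonneg fun j => div_nonneg (by positivity) ?_
    have : Real.exp (-(12 * x)) ^ (j + 1) ≤ 1 :=
      pow_le_one₀ (Real.exp_pos _).le (Real.exp_le_one_iff.mpr (by linarith))
    linarith
  have hxr : 1 / 2 + r ≤ x := by
    by_contra hcon
    push Not at hcon
    have : 0 ≤ 24 * x ^ 2 * K := by positivity
    nlinarith
  have hqle : Real.exp (-(12 * x)) ≤ 1 / 2 := by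
    have h1 : Real.exp (-(12 * x)) ≤ Real.exp (-1) := Real.exp_le_exp.mpr (by linarith)
    have h2 := Real.exp_neg_one_lt_d9
    linarith
  obtain ⟨-, hKB⟩ := hK _ (Real.exp_pos _) hqle
  rw [← hKd] at hKB
  set d := x - (1 / 2 + r) with hd
  have hd0 : 0 ≤ d := by linarith
  rw [abs_of_nonneg hd0]
  have hdK : d ≤ 48 * x * K := by
    have h1 : d * (x - 1 / 2 + r) = 24 * x ^ 2 * K := by rw [hd]; linear_combination key
    have h2 : d * (x / 2) ≤ 24 * x ^ 2 * K := by
      rw [← h1]; exact mul_le_mul_of_nonneg_left (by linarith) hd0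
    have h3 : (x / 2) * d ≤ (x / 2) * (48 * x * K) := by linarith
    exact le_of_mul_le_mul_left h3 (by positivity)
  have hxe : x * Real.exp (-(12 * x)) ≤ 4 * r * Real.exp (-(12 * r)) := by
    have e : Real.exp (-(12 * x)) = Real.exp (-(12 * d + 6)) * Real.exp (-(12 * r)) := by
      rw [← Real.exp_add]; congr 1; rw [hd]; ring
    rw [e, ← mul_assoc]
    refine mul_le_mul_of_nonneg_right ?_ (Real.exp_pos _).le
    rw [Real.exp_neg, ← div_eq_mul_inv, div_le_iff₀ (Real.exp_pos _)]
    have h1 := Real.add_one_le_exp (12 * d + 6)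
    have h2 : 4 * r * (12 * d + 6 + 1) ≤ 4 * r * Real.exp (12 * d + 6) :=
      mul_le_mul_of_nonneg_left h1 (by positivity)
    have h3 : x = d + 1 / 2 + r := by rw [hd]; ring
    have h4 : d ≤ r * d := le_mul_of_one_le_left hd0 hr1
    have h5 : 4 * r * (12 * d + 6 + 1) = 48 * (r * d) + 28 * r := by ring
    linarith
  have hrn : r ≤ 3 * Real.sqrt n := by
    have h1 : Real.sqrt n ^ 2 = n := Real.sq_sqrt (by linarith)
    refine le_of_sq_le_sq_aux ?_ (by positivity)
    rw [mul_pow, h1, hr2]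
    have h10 : π ^ 2 ≤ 10 := by nlinarith
    have h11 : 2 * π ^ 2 / 3 * ((n : ℝ) - 1 / 24) ≤ 20 / 3 * ((n : ℝ) - 1 / 24) :=
      mul_le_mul_of_nonneg_right (by linarith) (by linarith)
    linarith
  have hexp : Real.exp (-(12 * r)) ≤ Real.exp (-(2 * π) * Real.sqrt (24 * (n : ℝ) - 1)) := by
    apply Real.exp_le_exp.mpr
    have h1 : Real.sqrt (24 * (n : ℝ) - 1) ^ 2 = 24 * n - 1 := Real.sq_sqrt (by linarith)
    have : 2 * π * Real.sqrt (24 * (n : ℝ) - 1) ≤ 12 * r := by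
      refine le_of_sq_le_sq_aux ?_ (by positivity)
      rw [mul_pow, h1, mul_pow 12 r, hr2]
      linarith
    linarith
  calc d ≤ 48 * x * K := hdK
    _ ≤ 48 * x * (B * Real.exp (-(12 * x))) := by gcongr
    _ = 48 * B * (x * Real.exp (-(12 * x))) := by ring
    _ ≤ 48 * B * (4 * r * Real.exp (-(12 * r))) := by gcongr
    _ ≤ 48 * B * (4 * (3 * Real.sqrt n) * Real.exp (-(2 * π) * Real.sqrt (24 * (n : ℝ) - 1))) := by
      gcongr
    _ = _ := by ring
end

section
/- There exists a positive constant C such that for every natural number n ≥ 1: |log f(t_n) + n·(−log t_n) − r_n − (1/2)·log(−log t_n) + log(√(2π))| ≤ C · e^{−2π√(24n − 1)}. -/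
open Real

lemma aux_summable_log {t : ℝ} (h0 : 0 < t) (h1 : t < 1) :
    Summable fun j : ℕ => Real.log (1 - t ^ (j + 1)) := by
  have h : Summable fun j : ℕ => -t ^ (j + 1) :=
    ((summable_nat_add_iff 1).mpr (summable_geometric_of_lt_one h0.le h1)).neg
  simpa [sub_eq_add_neg] using Real.summable_log_one_add_of_summable h

lemma aux_pow_lt {t : ℝ} (h0 : 0 < t) (h1 : t < 1) (j : ℕ) : 0 < 1 - t ^ (j + 1) := by
  have := pow_lt_one₀ h0.le h1 (Nat.succ_ne_zero j)
  simpa using this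

lemma aux_log_prod {t : ℝ} (h0 : 0 < t) (h1 : t < 1) :
    Real.log (partitionGF t) = - ∑' j : ℕ, Real.log (1 - t ^ (j + 1)) := by
  have h := Real.rexp_tsum_eq_tprod (f := fun j : ℕ => 1 / (1 - t ^ (j + 1)))
    (fun j => one_div_pos.mpr (aux_pow_lt h0 h1 j)) (by
      simpa using (aux_summable_log h0 h1).neg)
  rw [partitionGF, ← h, Real.log_exp, ← tsum_neg]
  simp

lemma aux_prod_eq {t : ℝ} (h0 : 0 < t) (h1 : t < 1) :
    ∏' j : ℕ, (1 - t ^ (j + 1)) = Real.exp (- Real.log (partitionGF t)) := by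
  rw [aux_log_prod h0 h1, neg_neg]
  exact (Real.rexp_tsum_eq_tprod (f := fun j : ℕ => (1 - t ^ (j + 1)))
    (aux_pow_lt h0 h1) (aux_summable_log h0 h1)).symm

lemma aux_exp_coe (y : ℝ) : Complex.exp (2 * π * Complex.I * (Complex.I * y)) =
    ((Real.exp (-(2 * π * y)) : ℝ) : ℂ) := by
  rw [Complex.ofReal_exp]
  congr 1
  push_cast
  linear_combination (2 * π * y : ℂ) * Complex.I_sq

lemma aux_exp_lt {y : ℝ} (hy : 0 < y) : Real.exp (-(2 * π * y)) < 1 := by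
  rw [Real.exp_lt_one_iff]
  have := Real.pi_pos
  have : 0 < 2 * π * y := by positivity
  linarith

lemma aux_eta_norm {y : ℝ} (hy : 0 < y) : ‖ModularForm.eta (Complex.I * y)‖ =
    Real.exp (-(π * y / 12) - Real.log (partitionGF (Real.exp (-(2 * π * y))))) := by
  have hn : ‖Complex.exp (2 * π * Complex.I * (Complex.I * y))‖ < 1 := by
    rw [aux_exp_coe, Complex.norm_real, Real.norm_of_nonneg (Real.exp_pos _).le]
    exact aux_exp_lt hy
  have hm := ModularForm.multipliable_one_sub_pow hn
  rw [ModularForm.eta, norm_mul]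
  simp_rw [ModularForm.eta_q_eq_pow]
  rw [hm.norm_tprod, aux_exp_coe, sub_eq_add_neg, Real.exp_add,
    ← aux_prod_eq (Real.exp_pos _) (aux_exp_lt hy)]
  congr 1
  · rw [Function.Periodic.qParam, Complex.norm_exp]
    congr 1
    have : 2 * π * Complex.I * (Complex.I * y) / ((24 : ℝ) : ℂ) = ((-(π * y / 12) : ℝ) : ℂ) := by
      push_cast
      linear_combination (π * y / 12 : ℂ) * Complex.I_sq
    rw [this, Complex.ofReal_re]
  · congr 1
    ext j
    rw [← Complex.ofReal_pow, ← Complex.ofReal_one, ← Complex.ofReal_sub, Complex.norm_real,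
      Real.norm_of_nonneg (aux_pow_lt (Real.exp_pos _) (aux_exp_lt hy) j).le]

lemma aux_norm_sqrt (z : ℂ) : ‖Complex.sqrt z‖ = Real.sqrt ‖z‖ := by
  have := Complex.norm_cpow_inv_nat z 2
  rw [Complex.sqrt, Real.sqrt_eq_rpow]
  simpa using this

lemma aux_L_transform {y : ℝ} (hy : 0 < y) :
    -(π * y⁻¹ / 12) - Real.log (partitionGF (Real.exp (-(2 * π * y⁻¹)))) =
    1 / 2 * Real.log y + (-(π * y / 12) - Real.log (partitionGF (Real.exp (-(2 * π * y))))) := by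
  have h := ModularForm.eta_comp_eq_csqrt_I_inv
    (show Complex.I * y ∈ UpperHalfPlane.upperHalfPlaneSet by
      simpa [UpperHalfPlane.upperHalfPlaneSet] using hy)
  have e : -1 / (Complex.I * y) = Complex.I * ((y⁻¹ : ℝ) : ℂ) := by
    have : (y : ℂ) ≠ 0 := by exact_mod_cast hy.ne'
    have := Complex.I_ne_zero
    push_cast
    field_simp
    simp
  have h2 := congrArg (fun z : ℂ => Real.log ‖z‖) h
  simp only [Function.comp, e, Pi.smul_apply, Pi.mul_apply, smul_eq_mul, norm_mul, norm_inv,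
    aux_norm_sqrt, aux_eta_norm hy, aux_eta_norm (inv_pos.mpr hy)] at h2
  simp only [Complex.norm_I, Complex.norm_real, Real.norm_of_nonneg hy.le, Real.sqrt_one, inv_one,
    one_mul, Real.log_exp] at h2
  rw [h2, Real.log_mul (Real.sqrt_pos.mpr hy).ne' (Real.exp_pos _).ne', Real.log_exp,
    Real.log_sqrt hy.le]
  ring

lemma aux_E2 {y : ℝ} (hy : 0 < y) (z : UpperHalfPlane) (hz : (z : ℂ) = Complex.I * y) :
    EisensteinSeries.E2 z = ((1 - 24 * kappa1 (Real.exp (-(2 * π * y))) : ℝ) : ℂ) := by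
  rw [EisensteinSeries.E2_eq_tsum_cexp, ← tsum_pow_div_one_sub_eq_tsum_sigma
    (UpperHalfPlane.norm_exp_two_pi_I_lt_one z), hz, aux_exp_coe,
    tsum_pnat_eq_tsum_succ (f := fun n : ℕ => (n : ℂ) ^ 1 *
      ((Real.exp (-(2 * π * y)) : ℝ) : ℂ) ^ n / (1 - ((Real.exp (-(2 * π * y)) : ℝ) : ℂ) ^ n)),
    kappa1]
  push_cast
  simp

lemma aux_kappa_transform {y : ℝ} (hy : 0 < y) :
    1 - 24 * kappa1 (Real.exp (-(2 * π * y))) =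
      - (y ^ 2)⁻¹ * (1 - 24 * kappa1 (Real.exp (-(2 * π * y⁻¹)))) + 6 / (π * y) := by
  have hyc : (y : ℂ) ≠ 0 := by exact_mod_cast hy.ne'
  have hpc : (π : ℂ) ≠ 0 := by exact_mod_cast Real.pi_pos.ne'
  have hI := Complex.I_ne_zero
  let z : UpperHalfPlane := ⟨Complex.I * y, by simpa using hy⟩
  have hz : (z : ℂ) = Complex.I * y := rfl
  have h := EisensteinSeries.G2_S_transform z
  have hG : ∀ w, EisensteinSeries.G2 w = π ^ 2 / 3 * EisensteinSeries.E2 w := by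
    intro w
    simp only [EisensteinSeries.E2, Pi.smul_apply, smul_eq_mul, riemannZeta_two]
    field_simp
    try ring
  have hS : ((ModularGroup.S • z : UpperHalfPlane) : ℂ) = Complex.I * ((y⁻¹ : ℝ) : ℂ) := by
    rw [UpperHalfPlane.modular_S_smul]
    show (-(Complex.I * y : ℂ))⁻¹ = _
    push_cast
    rw [inv_eq_iff_eq_inv]
    field_simp
    simp
  rw [hG, hG, aux_E2 hy z hz, aux_E2 (inv_pos.mpr hy) _ hS, hz] at h
  apply Complex.ofReal_injective
  have h3 : ((1 - 24 * kappa1 (Real.exp (-(2 * π * y))) : ℝ) : ℂ) =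
      3 / π ^ 2 * (π ^ 2 / 3 * ((1 - 24 * kappa1 (Real.exp (-(2 * π * y))) : ℝ) : ℂ)) := by
    field_simp
  rw [h3, h, Complex.ofReal_add, Complex.ofReal_mul, mul_pow, Complex.I_sq]
  generalize ((1 - 24 * kappa1 (Real.exp (-(2 * π * y⁻¹))) : ℝ) : ℂ) = X
  push_cast
  field_simp
  ring

lemma aux_hasSum {q : ℝ} (h0 : 0 < q) (h1 : q < 1) :
    HasSum (fun j : ℕ => 2 * (((j : ℝ) + 1) * q ^ (j + 1))) (2 * (q / (1 - q) ^ 2)) := by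
  have h := hasSum_coe_mul_geometric_of_norm_lt_one (𝕜 := ℝ) (r := q)
    (by rw [Real.norm_of_nonneg h0.le]; exact h1)
  rw [← hasSum_nat_add_iff' 1] at h
  simpa using h.mul_left 2

lemma aux_bound_val {q : ℝ} (h0 : 0 < q) (h1 : q ≤ 1 / 2) : 2 * (q / (1 - q) ^ 2) ≤ 8 * q := by
  have h2 : (1 / 4 : ℝ) ≤ (1 - q) ^ 2 := by nlinarith
  have h3 : q / (1 - q) ^ 2 ≤ q / (1 / 4) := by gcongr
  linarith

lemma aux_pow_le {q : ℝ} (h0 : 0 < q) (h1 : q ≤ 1 / 2) (j : ℕ) : q ^ (j + 1) ≤ 1 / 2 := by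
  have := pow_le_of_le_one h0.le (by linarith) (Nat.succ_ne_zero j)
  simp only [Nat.succ_eq_add_one] at this
  linarith

lemma aux_kappa_nonneg {q : ℝ} (h0 : 0 < q) (h1 : q < 1) : 0 ≤ kappa1 q := by
  refine tsum_nonneg fun j => ?_
  have := aux_pow_lt h0 h1 j
  positivity

lemma aux_kappa_le {q : ℝ} (h0 : 0 < q) (h1 : q ≤ 1 / 2) : kappa1 q ≤ 8 * q := by
  have hs := aux_hasSum h0 (by linarith)
  have hle : ∀ j : ℕ, ((j : ℝ) + 1) * q ^ (j + 1) / (1 - q ^ (j + 1)) ≤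
      2 * (((j : ℝ) + 1) * q ^ (j + 1)) := by
    intro j
    have := aux_pow_le h0 h1 j
    have hp : 0 < ((j : ℝ) + 1) * q ^ (j + 1) := by positivity
    rw [div_le_iff₀ (by linarith)]
    nlinarith
  have hsum : Summable fun j : ℕ => ((j : ℝ) + 1) * q ^ (j + 1) / (1 - q ^ (j + 1)) := by
    refine Summable.of_nonneg_of_le (fun j => ?_) hle hs.summable
    have := aux_pow_lt h0 (by linarith : q < 1) j
    positivity
  refine le_trans ?_ (aux_bound_val h0 h1)
  rw [← hs.tsum_eq]
  exact hsum.tsum_le_tsum hle hs.summable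

lemma aux_L_nonneg {q : ℝ} (h0 : 0 < q) (h1 : q < 1) : 0 ≤ Real.log (partitionGF q) := by
  rw [aux_log_prod h0 h1, ← tsum_neg]
  refine tsum_nonneg fun j => ?_
  have := aux_pow_lt h0 h1 j
  have h2 : 0 < q ^ (j + 1) := by positivity
  have := Real.log_nonpos this.le (by linarith)
  linarith

lemma aux_L_le {q : ℝ} (h0 : 0 < q) (h1 : q ≤ 1 / 2) : Real.log (partitionGF q) ≤ 8 * q := by
  have hs := aux_hasSum h0 (by linarith)
  rw [aux_log_prod h0 (by linarith), ← tsum_neg]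
  refine le_trans ?_ (aux_bound_val h0 h1)
  rw [← hs.tsum_eq]
  refine (aux_summable_log h0 (by linarith)).neg.tsum_le_tsum (fun j => ?_) hs.summable
  have hx := aux_pow_le h0 h1 j
  have hp : 0 < q ^ (j + 1) := by positivity
  have hl := Real.one_sub_inv_le_log_of_pos (show 0 < 1 - q ^ (j + 1) by linarith)
  have hi : (1 - q ^ (j + 1))⁻¹ ≤ 1 + 2 * q ^ (j + 1) := by
    rw [inv_le_iff_one_le_mul₀ (by linarith)]
    nlinarith
  have hj : 0 ≤ (j : ℝ) * q ^ (j + 1) := by positivity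
  linarith

set_option maxHeartbeats 1000000 in
/-- `log f(t_n) + n(−log t_n) = r_n + (1/2)log(−log t_n) − log √(2π) + β_n` with
`|β_n| ≤ C·e^{−2π√(24n−1)}`. -/
theorem stmt12 :
    ∃ C : ℝ, 0 < C ∧ ∀ n : ℕ, 1 ≤ n → ∀ t : ℝ, t ∈ Set.Ioo (0 : ℝ) 1 → kappa1 t = n →
      |Real.log (partitionGF t) + n * (-Real.log t) - rseq n
          - 1 / 2 * Real.log (-Real.log t) + Real.log (Real.sqrt (2 * Real.pi))| ≤
        C * Real.exp (-(2 * Real.pi) * Real.sqrt (24 * (n : ℝ) - 1)) := by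
  refine ⟨2000, by norm_num, ?_⟩
  rintro n hn t ⟨ht0, ht1⟩ hk
  have hpi := Real.pi_pos
  have hpi3 := Real.pi_gt_three
  have hn1 : (1 : ℝ) ≤ n := by exact_mod_cast hn
  have hs : 0 < -Real.log t := by linarith [Real.log_neg ht0 ht1]
  obtain ⟨y, hy⟩ : ∃ y, y = -Real.log t / (2 * π) := ⟨_, rfl⟩
  have hy0 : 0 < y := by rw [hy]; positivity
  have hsy : -Real.log t = 2 * π * y := by rw [hy]; field_simp
  have hty : Real.exp (-(2 * π * y)) = t := by
    rw [← hsy, neg_neg, Real.exp_log ht0]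
  have hK := aux_kappa_transform hy0
  have hL := aux_L_transform hy0
  rw [hty] at hK hL
  rw [hk] at hK
  obtain ⟨w, hw⟩ : ∃ w, w = y⁻¹ := ⟨_, rfl⟩
  have hw0 : 0 < w := by rw [hw]; positivity
  have hwy : w * y = 1 := by rw [hw]; field_simp
  rw [← inv_pow, ← hw] at hK
  rw [← hw] at hL
  obtain ⟨q, hq⟩ : ∃ q, q = Real.exp (-(2 * π * w)) := ⟨_, rfl⟩
  have hq0 : 0 < q := by rw [hq]; positivity
  have hq1 : q < 1 := by rw [hq]; exact aux_exp_lt hw0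
  rw [← hq] at hK hL
  have hK0 := aux_kappa_nonneg hq0 hq1
  have hdiv : 6 / (π * y) = 6 * w / π := by rw [hw]; field_simp
  rw [hdiv] at hK
  have hv : 0 < 6 * w / π := by positivity
  have hN : 24 * (n : ℝ) - 1 ≤ w ^ 2 := by
    have : 0 ≤ w ^ 2 * kappa1 q := by positivity
    linarith
  have hw1 : 1 ≤ w := by nlinarith
  have hsq : Real.sqrt (24 * (n : ℝ) - 1) ≤ w := Real.sqrt_le_iff.mpr ⟨hw0.le, hN⟩
  have hqE : q ≤ Real.exp (-(2 * Real.pi) * Real.sqrt (24 * (n : ℝ) - 1)) := by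
    rw [hq, Real.exp_le_exp]
    nlinarith
  have hqw : (2 * π * w) * q ≤ 1 - q := by
    have h1 := Real.add_one_le_exp (2 * π * w)
    have h2 : Real.exp (2 * π * w) * q = 1 := by rw [hq, ← Real.exp_add]; simp
    nlinarith
  have hw6 : 1 ≤ 2 * π * w := by nlinarith
  have hqh : q ≤ 1 / 2 := by nlinarith
  have hK8 := aux_kappa_le hq0 hqh
  have hL0 := aux_L_nonneg hq0 hq1
  have hL8 := aux_L_le hq0 hqh
  generalize kappa1 q = K at *
  generalize Real.log (partitionGF q) = Lq at *
  -- the key quantities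
  obtain ⟨A, hA⟩ : ∃ A, A = π * w / 12 + 2 * π * y * ((n : ℝ) - 1 / 24) := ⟨_, rfl⟩
  have hD : π * w / 12 - 2 * π * y * ((n : ℝ) - 1 / 24) = 1 / 2 + 2 * π * w * K := by
    have hNN : (n : ℝ) - 1 / 24 = (w ^ 2 * (1 - 24 * K) - 6 * w / π) / 24 := by linarith
    rw [hNN]
    have : 2 * π * y * ((w ^ 2 * (1 - 24 * K) - 6 * w / π) / 24) =
        (w * y) * (π * w * (1 - 24 * K) / 12) - (w * y) / 2 := by
      field_simp
      ring
    rw [this, hwy]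
    ring
  have hr0 : 0 ≤ rseq n := Real.sqrt_nonneg _
  have hr2 : rseq n ^ 2 = 2 * π ^ 2 / 3 * ((n : ℝ) - 1 / 24) + 1 / 4 := by
    rw [rseq, Real.sq_sqrt]
    have : 0 ≤ (n : ℝ) - 1 / 24 := by linarith
    positivity
  generalize rseq n = r at *
  have hAr : (A - r) * (A + r) = 2 * π * w * K + (2 * π * w * K) ^ 2 := by
    have h1 : A ^ 2 = (1 / 2 + 2 * π * w * K) ^ 2 +
        (w * y) * (2 * π ^ 2 / 3 * ((n : ℝ) - 1 / 24)) := by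
      rw [← hD, hA]; ring
    rw [hwy] at h1
    linear_combination h1 - hr2
  have hAw : π * w / 12 ≤ A := by
    rw [hA]
    have : 0 ≤ (n : ℝ) - 1 / 24 := by linarith
    have : 0 ≤ 2 * π * y * ((n : ℝ) - 1 / 24) := by positivity
    linarith
  have hpw : 0 < π * w := by positivity
  have hpos : 0 < A + r := by linarith
  have hX0 : 0 ≤ 2 * π * w * K := by positivity
  have hAr0 : 0 ≤ A - r := by
    by_contra hneg
    push Not at hneg
    have h1 := mul_neg_of_neg_of_pos hneg hpos
    rw [hAr] at h1
    have h2 := sq_nonneg (2 * π * w * K)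
    linarith
  have hXK : 2 * π * w * K ≤ 8 := by
    calc 2 * π * w * K ≤ 2 * π * w * (8 * q) := by gcongr
      _ ≤ 8 := by linarith
  have hArle : A - r ≤ 24 * 9 * K := by
    have h1 : (A - r) * (π * w / 12) ≤ 2 * π * w * K * 9 := by
      calc (A - r) * (π * w / 12) ≤ (A - r) * (A + r) := by gcongr; linarith
        _ = 2 * π * w * K + (2 * π * w * K) ^ 2 := hAr
        _ ≤ 2 * π * w * K * 9 := by nlinarith
    have h2 : (A - r) * (π * w) ≤ (24 * 9 * K) * (π * w) := by linarith
    exact le_of_mul_le_mul_right h2 hpw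
  have hlogs : Real.log (-Real.log t) = Real.log (2 * π) + Real.log y := by
    rw [hsy, Real.log_mul (by positivity) hy0.ne']
  have hEq : Real.log (partitionGF t) + n * (-Real.log t) - r
      - 1 / 2 * Real.log (-Real.log t) + Real.log (Real.sqrt (2 * Real.pi)) = Lq + (A - r) := by
    rw [hlogs, Real.log_sqrt (by positivity), hsy, hA]
    linarith
  rw [hEq, abs_of_nonneg (by linarith)]
  linarith
end

section
/- There exists a positive constant C such that for every natural number n ≥ 1: −C·√n·e^{−2π√(24n − 1)} ≤ c_n² − r_n ≤ C·n·e^{−2π√(24n − 1)}. -/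
open Real

lemma k2_summ {t : ℝ} (h0 : 0 < t) (h1 : t < 1) :
    Summable (fun j : ℕ => ((j : ℝ) + 1) ^ 2 * t ^ j) := by
  have h := summable_pow_mul_geometric_of_norm_lt_one 2 (r := t)
    (by rw [Real.norm_eq_abs, abs_of_pos h0]; exact h1)
  have h2 := (summable_nat_add_iff 1).2 h
  have h3 := h2.mul_right t⁻¹
  refine h3.congr fun j => ?_
  push_cast
  field_simp
  ring

lemma pw_bd {t : ℝ} (h0 : 0 < t) (h1 : t < 1) (j : ℕ) :
    0 < t ^ (j + 1) ∧ t ^ (j + 1) ≤ t ∧ 0 < 1 - t ^ (j + 1) := by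
  have h : t ^ (j + 1) ≤ t := pow_le_of_le_one h0.le h1.le (by simp)
  exact ⟨by positivity, h, by linarith⟩

/-- dominating bound for the terms of `kappa2`. -/
lemma k2_term {t ρ : ℝ} (h0 : 0 < t) (htρ : t ≤ ρ) (h1 : ρ < 1) (j : ℕ) :
    ((j : ℝ) + 1) ^ 2 * t ^ (j + 1) / (1 - t ^ (j + 1)) ^ 2 ≤
      t * ((1 - ρ) ^ 2)⁻¹ * (((j : ℝ) + 1) ^ 2 * ρ ^ j) := by
  obtain ⟨a, b, c⟩ := pw_bd h0 (htρ.trans_lt h1) j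
  have e : (1 - ρ) ^ 2 ≤ (1 - t ^ (j + 1)) ^ 2 := by
    apply pow_le_pow_left₀ <;> linarith
  have e2 : t ^ j ≤ ρ ^ j := pow_le_pow_left₀ h0.le htρ j
  have e3 : 0 < (1 - ρ) ^ 2 := by
    have : 0 < 1 - ρ := by linarith
    positivity
  calc ((j : ℝ) + 1) ^ 2 * t ^ (j + 1) / (1 - t ^ (j + 1)) ^ 2
      ≤ ((j : ℝ) + 1) ^ 2 * t ^ (j + 1) / (1 - ρ) ^ 2 := by gcongr
    _ = t * ((1 - ρ) ^ 2)⁻¹ * (((j : ℝ) + 1) ^ 2 * t ^ j) := by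
        rw [pow_succ t j]; ring
    _ ≤ _ := by gcongr

lemma k1_le_k2_term {t : ℝ} (h0 : 0 < t) (h1 : t < 1) (j : ℕ) :
    ((j : ℝ) + 1) * t ^ (j + 1) / (1 - t ^ (j + 1)) ≤
      ((j : ℝ) + 1) ^ 2 * t ^ (j + 1) / (1 - t ^ (j + 1)) ^ 2 := by
  obtain ⟨a, b, c⟩ := pw_bd h0 h1 j
  have e1 : (1:ℝ) ≤ (j : ℝ) + 1 := by simp
  have e2 : ((j : ℝ) + 1) ≤ ((j : ℝ) + 1) ^ 2 := by nlinarith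
  have e3 : (1 - t ^ (j + 1)) ^ 2 ≤ 1 - t ^ (j + 1) := by nlinarith
  gcongr

lemma k2_summable {t : ℝ} (h0 : 0 < t) (h1 : t < 1) :
    Summable (fun j : ℕ => ((j : ℝ) + 1) ^ 2 * t ^ (j + 1) / (1 - t ^ (j + 1)) ^ 2) := by
  refine Summable.of_nonneg_of_le (fun j => ?_) (fun j => k2_term h0 le_rfl h1 j)
    ((k2_summ h0 h1).mul_left _)
  obtain ⟨a, b, c⟩ := pw_bd h0 h1 j
  positivity

lemma k1_summable {t : ℝ} (h0 : 0 < t) (h1 : t < 1) :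
    Summable (fun j : ℕ => ((j : ℝ) + 1) * t ^ (j + 1) / (1 - t ^ (j + 1))) := by
  refine Summable.of_nonneg_of_le (fun j => ?_) (fun j => k1_le_k2_term h0 h1 j)
    (k2_summable h0 h1)
  obtain ⟨a, b, c⟩ := pw_bd h0 h1 j
  positivity

lemma k1_nonneg {t : ℝ} (h0 : 0 < t) (h1 : t < 1) : 0 ≤ kappa1 t := by
  refine tsum_nonneg fun j => ?_
  obtain ⟨a, b, c⟩ := pw_bd h0 h1 j
  positivity

lemma k1_le_k2 {t : ℝ} (h0 : 0 < t) (h1 : t < 1) : kappa1 t ≤ kappa2 t :=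
  (k1_summable h0 h1).tsum_le_tsum (k1_le_k2_term h0 h1) (k2_summable h0 h1)

lemma k2_bound : ∃ K : ℝ, 0 < K ∧ ∀ u : ℝ, 0 < u → u ≤ 1 / 2 → kappa2 u ≤ K * u := by
  refine ⟨4 * ∑' j : ℕ, ((j : ℝ) + 1) ^ 2 * (1 / 2 : ℝ) ^ j, ?_, fun u h0 h1 => ?_⟩
  · have := (k2_summ (t := 1 / 2) (by norm_num) (by norm_num)).tsum_pos (fun j => by positivity) 0
      (by norm_num)
    positivity
  · have hs := k2_summ (t := 1 / 2) (by norm_num) (by norm_num)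
    have h := (k2_summable h0 (by linarith)).tsum_le_tsum
      (k2_term h0 h1 (by norm_num)) (hs.mul_left _)
    rw [tsum_mul_left] at h
    unfold kappa2
    refine h.trans (le_of_eq ?_)
    norm_num
    ring

lemma k1_small {t : ℝ} (h0 : 0 < t) (h1 : t ≤ 1 / 8) : kappa1 t < 1 := by
  have hn : ‖t‖ < 1 := by rw [Real.norm_eq_abs, abs_of_pos h0]; linarith
  have hs := hasSum_coe_mul_geometric_of_norm_lt_one hn
  have hs2 : HasSum (fun j : ℕ => ((j + 1 : ℕ) : ℝ) * t ^ (j + 1)) (t / (1 - t) ^ 2) := by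
    rw [hasSum_nat_add_iff (f := fun j : ℕ => (j : ℝ) * t ^ j) 1]
    simpa using hs
  have hs3 := hs2.mul_left (8 / 7)
  have hle : kappa1 t ≤ 8 / 7 * (t / (1 - t) ^ 2) := by
    unfold kappa1
    refine hasSum_le (fun j => ?_) (k1_summable h0 (by linarith)).hasSum hs3
    obtain ⟨a, b, c⟩ := pw_bd h0 (by linarith : t < 1) j
    rw [div_le_iff₀ c]
    push_cast
    have : 0 < ((j : ℝ) + 1) * t ^ (j + 1) := by positivity
    nlinarith
  refine hle.trans_lt ?_
  have : 0 < (1 - t) ^ 2 := by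
    have : 0 < 1 - t := by linarith
    positivity
  rw [← mul_div_assoc, div_lt_one this]
  nlinarith

lemma k1_deriv {t : ℝ} (h0 : 0 < t) (h1 : t < 1) : HasDerivAt kappa1 (kappa2 t / t) t := by
  obtain ⟨ρ, hρ, hρ1⟩ := exists_between h1
  have h := hasDerivAt_tsum_of_isPreconnected (𝕜 := ℝ)
    (g := fun (j : ℕ) (t : ℝ) => ((j : ℝ) + 1) * t ^ (j + 1) / (1 - t ^ (j + 1)))
    (g' := fun (j : ℕ) (t : ℝ) => (((j : ℝ) + 1) ^ 2 * t ^ (j + 1) / (1 - t ^ (j + 1)) ^ 2) / t)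
    (((k2_summ (h0.trans hρ) hρ1)).mul_left ((1 - ρ) ^ 2)⁻¹)
    (t := Set.Ioo 0 ρ) isOpen_Ioo isPreconnected_Ioo (y := t) (y₀ := t) ?_ ?_ ⟨h0, hρ⟩
    (k1_summable h0 h1) ⟨h0, hρ⟩
  · rw [tsum_div_const] at h
    exact h
  · rintro j y ⟨hy, hy2⟩
    obtain ⟨a, b, c⟩ := pw_bd hy (hy2.trans hρ1) j
    have hp := hasDerivAt_pow (j + 1) y
    have := (hp.const_mul ((j : ℝ) + 1)).div (hp.const_sub 1) c.ne'
    convert! this using 1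
    push_cast
    field_simp
    simp
    ring
  · rintro j y ⟨hy, hy2⟩
    obtain ⟨a, b, c⟩ := pw_bd hy (hy2.trans hρ1) j
    rw [Real.norm_eq_abs, abs_of_nonneg (by positivity), div_le_iff₀ hy]
    refine (k2_term hy hy2.le hρ1 j).trans (le_of_eq ?_)
    ring

lemma k1_cast (y : ℝ) (hy : 0 < y) (z : UpperHalfPlane) (hz : (z : ℂ) = Complex.I * y) :
    EisensteinSeries.G2 z = ((π ^ 2 / 3 - 8 * π ^ 2 * kappa1 (Real.exp (-(2 * π * y))) : ℝ) : ℂ) := by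
  have hq : Complex.exp (2 * π * Complex.I * z) = ((Real.exp (-(2 * π * y)) : ℝ) : ℂ) := by
    rw [hz]
    push_cast
    congr 1
    linear_combination (2 * π * y : ℂ) * Complex.I_sq
  have h1 := tsum_pow_div_one_sub_eq_tsum_sigma (UpperHalfPlane.norm_exp_two_pi_I_lt_one z) 1
  rw [EisensteinSeries.G2_eq_tsum_cexp, ← h1, riemannZeta_two, hq]
  rw [tsum_pnat_eq_tsum_succ (f := fun n : ℕ => (n : ℂ) ^ 1 * ((Real.exp (-(2 * π * y)) : ℝ) : ℂ) ^ n / (1 - ((Real.exp (-(2 * π * y)) : ℝ) : ℂ) ^ n))]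
  unfold kappa1
  push_cast
  simp only [pow_one]
  ring

lemma k1_transf {s : ℝ} (hs : 0 < s) :
    kappa1 (Real.exp (-s)) = 1 / 24 + π ^ 2 / (6 * s ^ 2) - 1 / (2 * s)
      - 4 * π ^ 2 / s ^ 2 * kappa1 (Real.exp (-(4 * π ^ 2 / s))) := by
  have hy : 0 < s / (2 * π) := by positivity
  have hpi := Real.pi_pos
  let z : UpperHalfPlane := ⟨Complex.I * ((s / (2 * π) : ℝ) : ℂ), by
    rw [Complex.I_mul_im, Complex.ofReal_re]; exact hy⟩
  have hz : (z : ℂ) = Complex.I * ((s / (2 * π) : ℝ) : ℂ) := rfl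
  have hz' : ((ModularGroup.S • z : UpperHalfPlane) : ℂ) = Complex.I * (((s / (2 * π))⁻¹ : ℝ) : ℂ) := by
    rw [UpperHalfPlane.modular_S_smul, UpperHalfPlane.coe_mk, hz]
    have : ((s / (2 * π) : ℝ) : ℂ) ≠ 0 := by exact_mod_cast hy.ne'
    rw [Complex.ofReal_inv]
    field_simp
    simp
  have h := EisensteinSeries.G2_S_transform z
  rw [k1_cast _ hy z hz, k1_cast _ (inv_pos.2 hy) _ hz', hz] at h
  have e1 : 2 * π * (s / (2 * π)) = s := by field_simp
  have e2 : 2 * π * (s / (2 * π))⁻¹ = 4 * π ^ 2 / s := by field_simp; ring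
  rw [e1, e2] at h
  have h2 : π ^ 2 / 3 - 8 * π ^ 2 * kappa1 (Real.exp (-s)) =
      - ((s / (2 * π)) ^ 2)⁻¹ * (π ^ 2 / 3 - 8 * π ^ 2 * kappa1 (Real.exp (-(4 * π ^ 2 / s))))
       + 2 * π / (s / (2 * π)) := by
    have hne : ((s / (2 * π) : ℝ) : ℂ) ≠ 0 := by exact_mod_cast hy.ne'
    rw [← Complex.ofReal_inj, h, mul_pow, Complex.I_sq, mul_comm Complex.I]
    rw [show (-2 * π * Complex.I / (((s / (2 * π) : ℝ) : ℂ) * Complex.I)) = -2 * π / ((s / (2 * π) : ℝ) : ℂ) by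
      field_simp]
    push_cast
    ring
  field_simp at h2 ⊢
  linear_combination (-12) * h2

lemma k2_transf {s : ℝ} (hs : 0 < s) :
    kappa2 (Real.exp (-s)) = π ^ 2 / (3 * s ^ 3) - 1 / (2 * s ^ 2)
      - 8 * π ^ 2 / s ^ 3 * kappa1 (Real.exp (-(4 * π ^ 2 / s)))
      + 16 * π ^ 4 / s ^ 4 * kappa2 (Real.exp (-(4 * π ^ 2 / s))) := by
  have hpi := Real.pi_pos
  have hL : HasDerivAt (fun s : ℝ => kappa1 (Real.exp (-s))) (-kappa2 (Real.exp (-s))) s := by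
    have h1 := k1_deriv (Real.exp_pos (-s)) (by rw [Real.exp_lt_one_iff]; linarith)
    have h2 := (hasDerivAt_neg s).exp
    convert! h1.comp s h2 using 1
    field_simp
  have hu : HasDerivAt (fun s : ℝ => kappa1 (Real.exp (-(4 * π ^ 2 / s))))
      (4 * π ^ 2 / s ^ 2 * kappa2 (Real.exp (-(4 * π ^ 2 / s)))) s := by
    have h1 := k1_deriv (Real.exp_pos (-(4 * π ^ 2 / s)))
      (by rw [Real.exp_lt_one_iff]; have : 0 < 4 * π ^ 2 / s := by positivity
          linarith)
    have h2 := (((hasDerivAt_inv hs.ne').const_mul (4 * π ^ 2)).neg).exp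
    simp only [← div_eq_mul_inv, Pi.neg_apply] at h2
    convert! h1.comp s h2 using 1
    field_simp
  have hR : HasDerivAt (fun s : ℝ => 1 / 24 + π ^ 2 / 6 * (s⁻¹ ^ 2) - 1 / 2 * s⁻¹
      - 4 * π ^ 2 * (s⁻¹ ^ 2 * kappa1 (Real.exp (-(4 * π ^ 2 / s))))) _ s :=
    (((((hasDerivAt_inv hs.ne').pow 2).const_mul (π ^ 2 / 6)).const_add (1 / 24)).sub
      ((hasDerivAt_inv hs.ne').const_mul (1 / 2))).sub
      ((((hasDerivAt_inv hs.ne').pow 2).mul hu).const_mul (4 * π ^ 2))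
  have hev : (fun s : ℝ => kappa1 (Real.exp (-s))) =ᶠ[nhds s] (fun s : ℝ => 1 / 24 + π ^ 2 / 6 * (s⁻¹ ^ 2) - 1 / 2 * s⁻¹
      - 4 * π ^ 2 * (s⁻¹ ^ 2 * kappa1 (Real.exp (-(4 * π ^ 2 / s))))) := by
    filter_upwards [lt_mem_nhds hs] with x hx
    rw [k1_transf hx]
    field_simp
  have := hL.unique (hR.congr_of_eventuallyEq hev)
  rw [← neg_inj, this]
  simp
  field_simp
  ring

set_option maxHeartbeats 1000000 in
/-- `−C√n·e^{−2π√(24n−1)} ≤ c_n² − r_n ≤ Cn·e^{−2π√(24n−1)}` where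
`c_n² = κ₂(t_n)(log t_n)²`. -/
theorem stmt13 :
    ∃ C : ℝ, 0 < C ∧ ∀ n : ℕ, 1 ≤ n → ∀ t : ℝ, t ∈ Set.Ioo (0 : ℝ) 1 → kappa1 t = n →
      -(C * Real.sqrt n * Real.exp (-(2 * Real.pi) * Real.sqrt (24 * (n : ℝ) - 1))) ≤
          kappa2 t * (Real.log t) ^ 2 - rseq n ∧
        kappa2 t * (Real.log t) ^ 2 - rseq n ≤
          C * n * Real.exp (-(2 * Real.pi) * Real.sqrt (24 * (n : ℝ) - 1)) := by
  obtain ⟨K, hK, hKb⟩ := k2_bound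
  have hpi := Real.pi_gt_three
  have hpi0 := Real.pi_pos
  set M : ℝ := π ^ 2 + K with hM
  have hM0 : 0 < M := by positivity
  have hC1 : 0 < 48 * K * √M := by positivity
  have hC2 : 0 < 720 * K * M := by positivity
  refine ⟨48 * K * √M + 720 * K * M, by positivity, ?_⟩
  intro n hn t ⟨ht0, ht1⟩ hk
  have hn1 : (1 : ℝ) ≤ n := by exact_mod_cast hn
  have ht8 : 1 / 8 < t := by
    by_contra hcon
    have := k1_small ht0 (not_lt.1 hcon)
    linarith
  obtain ⟨s, hsdef⟩ : ∃ s, s = -Real.log t := ⟨_, rfl⟩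
  have hts : t = Real.exp (-s) := by rw [hsdef, neg_neg, Real.exp_log ht0]
  have hs : 0 < s := by
    have := Real.log_neg ht0 ht1
    linarith
  have hs3 : s < 3 := by
    have h1 : Real.exp (-3) < t := by
      refine lt_trans ?_ ht8
      have h2 := Real.add_one_lt_exp (x := 1) (by norm_num)
      have h3 : Real.exp (-3) = (Real.exp 1 ^ 3)⁻¹ := by
        rw [← Real.exp_nat_mul, ← Real.exp_neg]; norm_num
      rw [h3, one_div]
      apply inv_strictAnti₀ (by norm_num)
      nlinarith [pow_lt_pow_left₀ h2 (by norm_num) (n := 3) (by norm_num)]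
    have := (Real.lt_log_iff_exp_lt ht0).2 h1
    linarith
  have hlog : Real.log t ^ 2 = s ^ 2 := by rw [hsdef]; ring
  rw [hlog]
  rw [hts] at hk ⊢
  have T1 := k1_transf hs
  have T2 := k2_transf hs
  rw [hk] at T1
  obtain ⟨u, hu⟩ : ∃ u, u = Real.exp (-(4 * π ^ 2 / s)) := ⟨_, rfl⟩
  rw [← hu] at T1 T2
  have hu0 : 0 < u := hu ▸ Real.exp_pos _
  have hx1 : 1 ≤ 4 * π ^ 2 / s := by rw [le_div_iff₀ hs]; nlinarith
  have hu12 : u ≤ 1 / 2 := by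
    rw [hu, Real.exp_neg, one_div]
    apply inv_anti₀ (by norm_num)
    linarith [Real.add_one_le_exp (4 * π ^ 2 / s)]
  have hA0 := k1_nonneg hu0 (by linarith)
  have hAB := k1_le_k2 hu0 (by linarith)
  have hBK := hKb u hu0 hu12
  generalize kappa1 u = A at *
  generalize kappa2 u = B at *
  generalize kappa2 (Real.exp (-s)) = c at *
  -- main quantities
  obtain ⟨R, hR⟩ : ∃ R, R = π ^ 2 / (3 * s) - 1 / 2 := ⟨_, rfl⟩
  have hR12 : 1 / 2 ≤ R := by
    have : 1 ≤ π ^ 2 / (3 * s) := by rw [le_div_iff₀ (by positivity)]; nlinarith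
    linarith
  have hc : c * s ^ 2 = R - 8 * π ^ 2 * A / s + 16 * π ^ 4 * B / s ^ 2 := by
    rw [T2, hR]; field_simp
  have hrad : 2 * π ^ 2 / 3 * ((n : ℝ) - 1 / 24) + 1 / 4 = R ^ 2 - 8 * π ^ 4 / 3 * A / s ^ 2 := by
    rw [T1, hR]; field_simp; ring
  have hrad0 : 0 ≤ 2 * π ^ 2 / 3 * ((n : ℝ) - 1 / 24) + 1 / 4 := by
    have : 0 ≤ (n : ℝ) - 1 / 24 := by linarith
    positivity
  obtain ⟨r, hr⟩ : ∃ r, r = rseq n := ⟨_, rfl⟩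
  have hr0 : 0 ≤ r := by rw [hr]; exact Real.sqrt_nonneg _
  have hr2 : r ^ 2 = 2 * π ^ 2 / 3 * ((n : ℝ) - 1 / 24) + 1 / 4 := by
    rw [hr]; exact Real.sq_sqrt hrad0
  rw [← hr, hc]
  have hAs : 0 ≤ 8 * π ^ 4 / 3 * A / s ^ 2 := by positivity
  have hrR : r ≤ R := by
    refine le_of_sq_le_sq_aux ?_ (by linarith)
    linarith
  have hRr : R - r ≤ 8 * π ^ 4 / 3 * A / s ^ 2 := by
    have h1 : (R - r) * (R + r) = 8 * π ^ 4 / 3 * A / s ^ 2 := by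
      have : (R - r) * (R + r) = R ^ 2 - r ^ 2 := by ring
      linarith
    have hr1 : 1 / 2 ≤ r := by
      refine le_of_sq_le_sq_aux ?_ hr0
      rw [hr2]
      have : 0 ≤ 2 * π ^ 2 / 3 * ((n : ℝ) - 1 / 24) := by
        have : 0 ≤ (n : ℝ) - 1 / 24 := by linarith
        positivity
      linarith
    rw [← h1]
    exact le_mul_of_one_le_right (by linarith) (by linarith)
  have hsR : 1 / s ≤ 6 / π ^ 2 * R := by
    have : 1 / s = 3 / π ^ 2 * (R + 1 / 2) := by rw [hR]; field_simp; ring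
    rw [this]
    have : 0 < 3 / π ^ 2 := by positivity
    have e : 6 / π ^ 2 * R = 3 / π ^ 2 * (2 * R) := by ring
    rw [e]
    gcongr
    linarith
  have hus : u ≤ s ^ 2 / (8 * π ^ 4) := by
    have h1 := Real.quadratic_le_exp_of_nonneg (x := 4 * π ^ 2 / s) (by positivity)
    have h2 : (8 * π ^ 4) / s ^ 2 ≤ Real.exp (4 * π ^ 2 / s) := by
      have : (8 * π ^ 4) / s ^ 2 = (4 * π ^ 2 / s) ^ 2 / 2 := by field_simp; ring
      rw [this]; linarith
    rw [hu, Real.exp_neg, ← inv_div (8 * π ^ 4)]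
    exact inv_anti₀ (by positivity) h2
  have hRM : R ^ 2 ≤ M * n := by
    have h1 : 8 * π ^ 4 / 3 * A / s ^ 2 ≤ K / 3 := by
      rw [div_le_iff₀ (by positivity)]
      have h2 : A ≤ K * (s ^ 2 / (8 * π ^ 4)) := by
        refine (hAB.trans hBK).trans ?_
        gcongr
      calc 8 * π ^ 4 / 3 * A ≤ 8 * π ^ 4 / 3 * (K * (s ^ 2 / (8 * π ^ 4))) := by gcongr
        _ = K / 3 * s ^ 2 := by field_simp
    have h3 : 9 < π ^ 2 := by nlinarith
    rw [hM]
    nlinarith [mul_le_mul_of_nonneg_left hn1 hK.le, mul_le_mul_of_nonneg_left hn1 (sq_nonneg π)]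
  have hRle : R ≤ √M * √n := by
    rw [← Real.sqrt_mul hM0.le]
    exact Real.le_sqrt_of_sq_le hRM
  obtain ⟨E, hE⟩ : ∃ E, E = Real.exp (-(2 * π) * √(24 * (n : ℝ) - 1)) := ⟨_, rfl⟩
  have huE : u ≤ E := by
    rw [hu, hE]
    apply Real.exp_le_exp.2
    have h1 : 4 * π ^ 2 / s = 12 * R + 6 := by rw [hR]; field_simp; ring
    have h2 : 2 * π * √(24 * (n : ℝ) - 1) ≤ 12 * r := by
      refine le_of_sq_le_sq_aux ?_ (by positivity)
      rw [mul_pow, Real.sq_sqrt (by linarith), mul_pow 12 r, hr2]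
      nlinarith
    rw [h1]; linarith
  rw [← hE]
  have hE0 : 0 < E := hu0.trans_le huE
  have hBE : B ≤ K * E := hBK.trans (by gcongr)
  have hAE : A ≤ K * E := hAB.trans hBE
  have hB0 : 0 ≤ B := hA0.trans hAB
  have hS0 : 0 ≤ √(n : ℝ) := Real.sqrt_nonneg _
  constructor
  · have h1 : 8 * π ^ 2 * A / s ≤ 48 * K * √M * √n * E := by
      calc 8 * π ^ 2 * A / s = 8 * π ^ 2 * A * (1 / s) := by ring
        _ ≤ 8 * π ^ 2 * (K * E) * (6 / π ^ 2 * (√M * √n)) := by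
            gcongr
            exact hsR.trans (by gcongr)
        _ = _ := by field_simp; ring
    have h2 : 0 ≤ 16 * π ^ 4 * B / s ^ 2 := by positivity
    have h3 : 0 ≤ 720 * K * M * √n * E := by positivity
    nlinarith
  · have h1 : 8 * π ^ 4 / 3 * A / s ^ 2 + 16 * π ^ 4 * B / s ^ 2 ≤ 720 * K * M * n * E := by
      calc 8 * π ^ 4 / 3 * A / s ^ 2 + 16 * π ^ 4 * B / s ^ 2
          = (8 * π ^ 4 / 3 * A + 16 * π ^ 4 * B) * (1 / s) ^ 2 := by ring
        _ ≤ (8 * π ^ 4 / 3 * (K * E) + 16 * π ^ 4 * (K * E)) * (6 / π ^ 2 * R) ^ 2 := by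
            gcongr
        _ = 672 * K * E * R ^ 2 := by field_simp; ring
        _ ≤ 672 * K * E * (M * n) := by gcongr
        _ ≤ _ := by
            have : 0 ≤ K * E * (M * n) := by positivity
            nlinarith
    have h2 : 0 ≤ 8 * π ^ 2 * A / s := by positivity
    have h3 : 0 ≤ 48 * K * √M * n * E := by positivity
    nlinarith
end

section
/- For every integer j ≥ 2 and every t ∈ (0,1): κ_j(t) = π²·j!/(6·(−log t)^{j+1}) − (j−1)!/(2·(−log t)^j) + E_j(t), where E_j(t) = ((j−1)!/(−log t)^j) · Σ_{r=1}^{j} C(j,r) · (−4π²/(−log t))^r · κ_r(e^{−4π²/(−log t)})/(r−1)!. Moreover, for each j ≥ 2 there exists a positive constant C_j such that for every t ∈ (e^{−π/2}, 1): |E_j(t)| ≤ C_j · e^{−4π²/(−log t)} / (−log t)^{2j}. -/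
open Real

/-- The cumulants `κ_j(t)`, defined recursively by `κ_{j+1}(t) = t·κ_j'(t)`. -/
noncomputable def kappa : ℕ → ℝ → ℝ
  | 0 => fun _ => 0
  | 1 => kappa1
  | n + 2 => fun t => t * deriv (kappa (n + 1)) t

/-- The error term `E_j(t)` in the functional equation for `κ_j`. -/
noncomputable def Eterm (j : ℕ) (t : ℝ) : ℝ :=
  (Nat.factorial (j - 1) : ℝ) / (-Real.log t) ^ j *
    ∑ r ∈ Finset.Icc 1 j,
      (Nat.choose j r : ℝ) * (-(4 * Real.pi ^ 2) / (-Real.log t)) ^ r *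
        kappa r (Real.exp (-(4 * Real.pi ^ 2) / (-Real.log t))) / (Nat.factorial (r - 1) : ℝ)

open UpperHalfPlane EisensteinSeries in
lemma aux_E2_s18 (z : ℍ) (q : ℝ) (hq : Complex.exp (2 * π * Complex.I * z) = (q : ℂ)) :
    E2 z = 1 - 24 * ((kappa1 q : ℝ) : ℂ) := by
  have hn := norm_exp_two_pi_I_lt_one z
  rw [E2_eq_tsum_cexp, ← tsum_pow_div_one_sub_eq_tsum_sigma hn,
    tsum_pnat_eq_tsum_succ (f := fun n : ℕ ↦
        (n : ℂ) ^ 1 * Complex.exp (2 * π * Complex.I * z) ^ n / (1 - Complex.exp (2 * π * Complex.I * z) ^ n)),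
    hq, kappa1, Complex.ofReal_tsum]
  congr 2
  apply tsum_congr
  intro n
  push_cast
  ring

open UpperHalfPlane EisensteinSeries in
lemma aux_transform (x : ℝ) (hx : 0 < x) :
    kappa1 (Real.exp (-x)) = π ^ 2 / (6 * x ^ 2) - 1 / (2 * x) + 1 / 24
      - 4 * π ^ 2 / x ^ 2 * kappa1 (Real.exp (-(4 * π ^ 2) / x)) := by
  have hpi := Real.pi_pos
  let z : ℍ := ⟨Complex.I * ((x / (2 * π) : ℝ) : ℂ), by rw [Complex.I_mul_im, Complex.ofReal_re]; positivity⟩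
  have hz : (z : ℂ) = Complex.I * ((x / (2 * π) : ℝ) : ℂ) := rfl
  have hxc : (x : ℂ) ≠ 0 := by exact_mod_cast hx.ne'
  have hpc : (π : ℂ) ≠ 0 := by exact_mod_cast hpi.ne'
  have h1 := aux_E2_s18 z (Real.exp (-x)) (by
    rw [hz]; push_cast; congr 1
    field_simp
    rw [Complex.I_sq])
  have hS : ((ModularGroup.S • z : ℍ) : ℂ) = Complex.I * ((2 * π / x : ℝ) : ℂ) := by
    rw [modular_S_smul]
    simp [hz]
    field_simp
    try (rw [Complex.I_sq])
    try ring
  have h2 := aux_E2_s18 (ModularGroup.S • z) (Real.exp (-(4 * π ^ 2) / x)) (by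
    rw [hS]; push_cast; congr 1
    field_simp
    rw [Complex.I_sq]; ring)
  have h3 := G2_S_transform z
  have hE : ∀ w : ℍ, G2 w = (π : ℂ) ^ 2 / 3 * E2 w := by
    intro w
    simp [E2, riemannZeta_two]
    field_simp
    ring
  rw [hE, hE, h1, h2, hz] at h3
  have hI := Complex.I_sq
  push_cast at h3
  rw [mul_pow, Complex.I_sq] at h3
  have h4 : -2 * (π : ℂ) * Complex.I / (Complex.I * (x / (2 * π))) = -4 * π ^ 2 / x := by
    field_simp; norm_num
  rw [h4] at h3
  apply Complex.ofReal_injective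
  push_cast
  field_simp at h3 ⊢
  linear_combination (-12) * h3

noncomputable def TT (j r : ℕ) (x : ℝ) : ℝ :=
  (1 / x) ^ j * (-(4 * π ^ 2) / x) ^ r * kappa r (Real.exp (-(4 * π ^ 2) / x))

lemma TT_deriv (hk : ∀ r : ℕ, ∀ t ∈ Set.Ioo (0:ℝ) 1, DifferentiableAt ℝ (kappa r) t)
    (j r : ℕ) (hr : 1 ≤ r) (x : ℝ) (hx : 0 < x) :
    HasDerivAt (TT j r) (-((j + r) * TT (j+1) r x + TT (j+1) (r+1) x)) x := by
  obtain ⟨s, rfl⟩ : ∃ s, r = s + 1 := ⟨r - 1, by omega⟩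
  have hpi := Real.pi_pos
  have hy : HasDerivAt (fun x : ℝ => -(4 * π ^ 2) / x) (4 * π ^ 2 / x ^ 2) x := by
    have := (hasDerivAt_inv hx.ne').const_mul (-(4 * π ^ 2))
    refine (this.congr_deriv (by field_simp)).congr_of_eventuallyEq (Filter.Eventually.of_forall fun y => ?_)
    simp [div_eq_mul_inv]
  have hu : HasDerivAt (fun x : ℝ => 1 / x) (- 1 / x ^ 2) x := by
    have := (hasDerivAt_inv hx.ne')
    refine (this.congr_deriv (by field_simp)).congr_of_eventuallyEq (Filter.Eventually.of_forall fun y => ?_)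
    simp
  have hmem : Real.exp (-(4 * π ^ 2) / x) ∈ Set.Ioo (0:ℝ) 1 := by
    refine ⟨Real.exp_pos _, ?_⟩
    rw [Real.exp_lt_one_iff]
    apply div_neg_of_neg_of_pos _ hx
    have : 0 < π ^ 2 := by positivity
    linarith
  have hkd := ((hk (s+1) _ hmem).hasDerivAt).comp x hy.exp
  have h := ((hu.pow j).mul (hy.pow (s+1))).mul hkd
  have e : kappa (s+1+1) (Real.exp (-(4 * π ^ 2) / x)) = Real.exp (-(4 * π ^ 2) / x) *
    deriv (kappa (s+1)) (Real.exp (-(4 * π ^ 2) / x)) := rfl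
  refine h.congr_deriv ?_
  simp only [TT, e, Function.comp, Pi.mul_apply, Pi.pow_apply]
  generalize Real.exp (-(4 * π ^ 2) / x) = E
  generalize deriv (kappa (s+1)) E = K'
  generalize kappa (s+1) E = K
  have hj : (j : ℝ) * (1 / x) ^ (j - 1) * (-1 / x ^ 2) = - j * (1/x)^(j+1) := by
    rcases j with _ | j
    · simp
    · simp only [Nat.add_sub_cancel]; ring
  rw [hj]
  have h4 : 4 * π ^ 2 / x ^ 2 = - (-(4 * π ^ 2) / x) * (1/x) := by field_simp
  rw [h4]
  simp only [Nat.add_sub_cancel]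
  push_cast
  ring

noncomputable def aa (j s : ℕ) : ℝ := ((j - 1).factorial : ℝ) * (j.choose (s+1)) / (s.factorial : ℝ)

lemma aa_rec (m s : ℕ) : aa (m+2) (s+1) = (m + 1 + s + 2) * aa (m+1) (s+1) + aa (m+1) s := by
  simp only [aa, Nat.add_sub_cancel]
  have h1 : ((m+2).choose (s+2) : ℝ) = (m+1).choose (s+1) + (m+1).choose (s+2) := by
    exact_mod_cast Nat.choose_succ_succ (m+1) (s+1)
  have h2 : ((m+1).choose (s+2) : ℝ) * (s + 2) = (m+1).choose (s+1) * (m - s) := by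
    have := Nat.choose_succ_right_eq (m+1) (s+1)
    rcases le_or_gt s m with h | h
    · have h' : ((m + 1 - (s+1) : ℕ) : ℝ) = m - s := by
        rw [Nat.cast_sub (by omega)]; push_cast; ring
      rw [← h']; exact_mod_cast this
    · rw [Nat.choose_eq_zero_of_lt (by omega : m + 1 < s + 2), Nat.choose_eq_zero_of_lt (by omega : m + 1 < s + 1)]
      simp
  have h3 : ((m+2-1).factorial : ℝ) = (m+1) * m.factorial := by
    rw [show m + 2 - 1 = m + 1 by omega, Nat.factorial_succ]; push_cast; ring
  have h4 : ((s+1).factorial : ℝ) = (s+1) * s.factorial := by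
    rw [Nat.factorial_succ]; push_cast; ring
  rw [h3, h4, h1]
  have : (s.factorial : ℝ) ≠ 0 := by positivity
  field_simp
  linear_combination (-1) * h2

lemma aa_zero (m : ℕ) : aa (m+2) 0 = (m + 2) * aa (m+1) 0 := by
  simp [aa, Nat.factorial_succ]; ring

lemma aa_top (m : ℕ) : aa m m = 0 := by
  simp [aa]

lemma Eterm_eq (j : ℕ) (t : ℝ) :
    Eterm j t = ∑ s ∈ Finset.range j, aa j s * TT j (s+1) (-Real.log t) := by
  have hh := Finset.sum_Ico_add' (fun r => (aa j (r-1) * TT j r (-Real.log t))) 0 j 1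
  simp only [Nat.add_sub_cancel] at hh
  rw [Eterm, Finset.mul_sum, Finset.range_eq_Ico, hh]
  apply Finset.sum_congr (by ext; simp <;> omega)
  intro r hr
  simp only [Finset.mem_Ico] at hr
  rw [aa, TT, show r - 1 + 1 = r by omega, one_div, inv_pow]
  ring

noncomputable def FF (j : ℕ) (x : ℝ) : ℝ :=
  π ^ 2 * (Nat.factorial j : ℝ) / (6 * x ^ (j + 1))
          - (Nat.factorial (j - 1) : ℝ) / (2 * x ^ j) + ∑ s ∈ Finset.range j, aa j s * TT j (s+1) x

lemma FF_deriv (hk : ∀ r : ℕ, ∀ t ∈ Set.Ioo (0:ℝ) 1, DifferentiableAt ℝ (kappa r) t)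
    (m : ℕ) (x : ℝ) (hx : 0 < x) :
    HasDerivAt (FF (m+1)) (- FF (m+2) x) x := by
  have hS : HasDerivAt (fun x => ∑ s ∈ Finset.range (m+1), aa (m+1) s * TT (m+1) (s+1) x)
      (∑ s ∈ Finset.range (m+1), aa (m+1) s * (-(((m+1 : ℕ) + (s+1 : ℕ)) * TT (m+2) (s+1) x + TT (m+2) (s+2) x))) x :=
    HasDerivAt.fun_sum fun s _ => (TT_deriv hk (m+1) (s+1) (by omega) x hx).const_mul _
  have hp : ∀ (c : ℝ) (n : ℕ), HasDerivAt (fun x : ℝ => c / x ^ n) (- c * n / x ^ (n+1)) x := by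
    intro c n
    have := ((hasDerivAt_pow n x).inv (by positivity)).const_mul c
    refine this.congr_deriv ?_
    rcases n with _ | n
    · simp
    · simp only [Nat.add_sub_cancel]; field_simp; ring
  have h := ((hp (π ^ 2 * (Nat.factorial (m+1) : ℝ) / 6) (m+2)).sub (hp ((Nat.factorial m : ℝ) / 2) (m+1))).add hS
  have e : FF (m+1) = (fun x : ℝ => (π ^ 2 * (Nat.factorial (m+1) : ℝ) / 6) / x ^ (m+2)) - (fun x : ℝ => ((Nat.factorial m : ℝ) / 2) / x ^ (m+1)) + (fun x => ∑ s ∈ Finset.range (m+1), aa (m+1) s * TT (m+1) (s+1) x) := by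
    ext y
    simp only [FF, Pi.add_apply, Pi.sub_apply, Nat.add_sub_cancel, div_div]
  rw [e]
  refine h.congr_deriv ?_
  have key : ∑ s ∈ Finset.range (m+2), aa (m+2) s * TT (m+2) (s+1) x =
      ∑ s ∈ Finset.range (m+1), aa (m+1) s * ((((m+1 : ℕ) + (s+1 : ℕ)) * TT (m+2) (s+1) x + TT (m+2) (s+2) x)) := by
    have e1 : ∑ s ∈ Finset.range (m+1), aa (m+1) s * (((m+1 : ℕ) + (s+1 : ℕ)) * TT (m+2) (s+1) x)
       = ∑ s ∈ Finset.range (m+2), aa (m+1) s * (((m+1 : ℕ) + (s+1 : ℕ)) * TT (m+2) (s+1) x) := by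
      rw [Finset.sum_range_succ _ (m+1), aa_top]; simp
    simp only [mul_add (aa _ _), Finset.sum_add_distrib]
    rw [e1, Finset.sum_range_succ' _ (m+1), Finset.sum_range_succ' _ (m+1), add_right_comm, ← Finset.sum_add_distrib]
    congr 1
    · apply Finset.sum_congr rfl
      intro s _
      rw [aa_rec]; push_cast; ring
    · rw [aa_zero]; push_cast; ring
  rw [FF, key]
  simp only [mul_neg, Finset.sum_neg_distrib]
  rw [show m + 2 - 1 = m + 1 by omega, Nat.factorial_succ (m+1), Nat.factorial_succ m]
  push_cast
  field_simp
  ring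

lemma main_eq (hk : ∀ r : ℕ, ∀ t ∈ Set.Ioo (0:ℝ) 1, DifferentiableAt ℝ (kappa r) t)
    (h1 : ∀ t ∈ Set.Ioo (0:ℝ) 1, kappa 1 t = FF 1 (-Real.log t) + 1/24) (m : ℕ) :
    ∀ t ∈ Set.Ioo (0:ℝ) 1, kappa (m+1) t = FF (m+1) (-Real.log t) + (if m = 0 then 1/24 else 0) := by
  induction m with
  | zero => simpa using h1
  | succ m ih =>
    intro t ht
    have hL : HasDerivAt (fun t : ℝ => -Real.log t) (-t⁻¹) t := (Real.hasDerivAt_log ht.1.ne').neg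
    have hpos : 0 < -Real.log t := by have := Real.log_neg ht.1 ht.2; linarith
    have h := ((FF_deriv hk m (-Real.log t) hpos).comp t hL).add_const (if m = 0 then (1/24 : ℝ) else 0)
    have h' : HasDerivAt (kappa (m+1)) _ t := h.congr_of_eventuallyEq (by
      filter_upwards [isOpen_Ioo.mem_nhds ht] with u hu
      exact ih u hu)
    change t * deriv (kappa (m+1)) t = _
    rw [h'.deriv]
    have := ht.1.ne'
    simp
    field_simp

lemma cplx_diff : DifferentiableOn ℂ (fun z : ℂ => ∑' j : ℕ, ((j : ℂ) + 1) * z ^ j / (1 - z ^ (j + 1)))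
    (Metric.ball 0 1) := by
  intro z hz
  obtain ⟨r, hr1, hr2⟩ := exists_between (mem_ball_zero_iff.1 hz)
  have hr0 : 0 ≤ r := (norm_nonneg z).trans hr1.le
  have hpw : ∀ w ∈ Metric.ball (0:ℂ) r, ∀ j : ℕ, 1 - r ≤ ‖1 - w ^ (j+1)‖ := by
    intro w hw j
    have h1 := norm_sub_norm_le (1:ℂ) (w ^ (j+1))
    have h2 : ‖w ^ (j+1)‖ ≤ r := by
      rw [norm_pow]
      have hw' := (mem_ball_zero_iff.1 hw).le
      calc ‖w‖ ^ (j+1) ≤ r ^ (j+1) := by gcongr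
        _ ≤ r ^ 1 := pow_le_pow_of_le_one hr0 hr2.le (by omega)
        _ = r := pow_one r
    rw [norm_one] at h1
    linarith
  have hd : DifferentiableOn ℂ (fun z : ℂ => ∑' j : ℕ, ((j : ℂ) + 1) * z ^ j / (1 - z ^ (j + 1)))
    (Metric.ball 0 r) := by
    apply Complex.differentiableOn_tsum_of_summable_norm (u := fun j : ℕ => ((j : ℝ) + 1) * r ^ j / (1 - r))
    · apply Summable.div_const
      have hn : ‖r‖ < 1 := by rwa [Real.norm_of_nonneg hr0]
      have a := summable_pow_mul_geometric_of_norm_lt_one 1 hn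
      have b := summable_geometric_of_norm_lt_one hn
      exact (a.add b).congr fun j => by simp; ring
    · intro j w hw
      refine DifferentiableAt.differentiableWithinAt ?_
      have : 1 - w ^ (j+1) ≠ 0 := by
        rw [← norm_pos_iff]; linarith [hpw w hw j]
      fun_prop (disch := exact this)
    · exact Metric.isOpen_ball
    · intro j w hw
      rw [norm_div, norm_mul, norm_pow]
      have hw' := (mem_ball_zero_iff.1 hw).le
      have h3 : ‖(j : ℂ) + 1‖ = (j : ℝ) + 1 := by
        rw [show (j : ℂ) + 1 = ((j + 1 : ℕ) : ℂ) by push_cast; rfl, Complex.norm_natCast]; push_cast; rfl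
      rw [h3]
      have := hpw w hw j
      have : 0 < 1 - r := by linarith
      gcongr
  exact (hd.differentiableAt (Metric.isOpen_ball.mem_nhds (mem_ball_zero_iff.2 hr1))).differentiableWithinAt

open scoped ContDiff in
lemma kappa_struct (m : ℕ) : ∃ g : ℝ → ℝ, ContDiffOn ℝ ∞ g (Set.Ioo (-1) 1) ∧
    ∀ t ∈ Set.Ioo (-1:ℝ) 1, kappa (m+1) t = t * g t := by
  induction m with
  | zero =>
    refine ⟨fun t => (∑' j : ℕ, ((j : ℂ) + 1) * (t:ℂ) ^ j / (1 - (t:ℂ) ^ (j + 1))).re, ?_, ?_⟩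
    · intro t ht
      have hb : (t : ℂ) ∈ Metric.ball (0:ℂ) 1 := by
        rw [mem_ball_zero_iff, Complex.norm_real, Real.norm_eq_abs, abs_lt]; exact ht
      have h := (cplx_diff.contDiffOn (n := ∞) Metric.isOpen_ball).contDiffAt (Metric.isOpen_ball.mem_nhds hb)
      exact h.real_of_complex.contDiffWithinAt
    · intro t ht
      change kappa1 t = _
      have : (∑' j : ℕ, ((j : ℂ) + 1) * (t:ℂ) ^ j / (1 - (t:ℂ) ^ (j + 1))) =
        ((∑' j : ℕ, ((j : ℝ) + 1) * t ^ j / (1 - t ^ (j + 1)) : ℝ) : ℂ) := by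
        push_cast; rfl
      beta_reduce
      rw [this, Complex.ofReal_re, kappa1, ← tsum_mul_left]
      apply tsum_congr; intro j; ring
  | succ m ih =>
    obtain ⟨g, hg, he⟩ := ih
    refine ⟨fun t => g t + t * deriv g t, ?_, ?_⟩
    · have := hg.deriv_of_isOpen (m := ∞) isOpen_Ioo (by simp)
      exact hg.add (contDiffOn_id.mul this)
    · intro t ht
      change t * deriv (kappa (m+1)) t = _
      have hgd : HasDerivAt g (deriv g t) t :=
        ((hg.differentiableOn (by simp)).differentiableAt (isOpen_Ioo.mem_nhds ht)).hasDerivAt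
      have h := (hasDerivAt_id t).mul hgd
      have h' : HasDerivAt (kappa (m+1)) _ t := h.congr_of_eventuallyEq (by
        filter_upwards [isOpen_Ioo.mem_nhds ht] with u hu
        exact he u hu)
      rw [h'.deriv]; simp

lemma kappa_diff (r : ℕ) (t : ℝ) (ht : t ∈ Set.Ioo (0:ℝ) 1) : DifferentiableAt ℝ (kappa r) t := by
  rcases r with _ | m
  · exact differentiableAt_const (0:ℝ)
  · obtain ⟨g, hg, he⟩ := kappa_struct m
    have ht' : t ∈ Set.Ioo (-1:ℝ) 1 := ⟨by linarith [ht.1], ht.2⟩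
    have hgd := (hg.differentiableOn (by simp)).differentiableAt (isOpen_Ioo.mem_nhds ht')
    refine (differentiableAt_id.mul hgd).congr_of_eventuallyEq ?_
    filter_upwards [isOpen_Ioo.mem_nhds ht'] with u hu
    exact he u hu

lemma kappa_bound_s18 (m : ℕ) (q0 : ℝ) (h1 : q0 < 1) : ∃ K : ℝ, 0 < K ∧ ∀ q : ℝ, 0 < q → q ≤ q0 →
    |kappa (m+1) q| ≤ K * q := by
  obtain ⟨g, hg, he⟩ := kappa_struct m
  have hc : ContinuousOn g (Set.Icc 0 q0) := hg.continuousOn.mono fun x hx => ⟨by linarith [hx.1], by linarith [hx.2]⟩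
  obtain ⟨K, hK⟩ := isCompact_Icc.exists_bound_of_continuousOn hc
  refine ⟨|K| + 1, by positivity, fun q h0 hq => ?_⟩
  rw [he q ⟨by linarith, by linarith⟩, abs_mul, abs_of_pos h0, mul_comm]
  have := hK q ⟨h0.le, hq⟩
  rw [Real.norm_eq_abs] at this
  have := le_abs_self K
  gcongr
  linarith

lemma TT_bound (j s : ℕ) (hs : s < j) : ∃ C : ℝ, 0 < C ∧ ∀ x : ℝ, 0 < x → x < π / 2 →
    |TT j (s+1) x| ≤ C * (Real.exp (-(4 * π ^ 2) / x) / x ^ (2 * j)) := by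
  have hpi := Real.pi_pos
  obtain ⟨K, hK, hb⟩ := kappa_bound_s18 s (Real.exp (-1)) (by rw [Real.exp_lt_one_iff]; norm_num)
  refine ⟨(4 * π ^ 2) ^ (s+1) * K * (π / 2) ^ (j - (s+1)), by positivity, fun x hx hx2 => ?_⟩
  have hq := hb (Real.exp (-(4 * π ^ 2) / x)) (Real.exp_pos _) (by
    rw [Real.exp_le_exp, div_le_iff₀ hx]
    nlinarith [Real.pi_gt_three])
  rw [TT, abs_mul, abs_mul, abs_pow, abs_pow, abs_div, abs_div, abs_neg, abs_one, abs_of_pos hx,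
    abs_of_pos (by positivity : 0 < 4 * π ^ 2)]
  set q := Real.exp (-(4 * π ^ 2) / x)
  have hq0 : 0 < q := Real.exp_pos _
  calc (1 / x) ^ j * (4 * π ^ 2 / x) ^ (s+1) * |kappa (s+1) q|
      ≤ (1 / x) ^ j * (4 * π ^ 2 / x) ^ (s+1) * (K * q) := by gcongr
    _ = (4 * π ^ 2) ^ (s+1) * K * x ^ (j - (s+1)) * (q / x ^ (2 * j)) := by
        obtain ⟨d, rfl⟩ : ∃ d, j = s + 1 + d := ⟨j - (s+1), by omega⟩
        rw [Nat.add_sub_cancel_left]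
        simp only [div_pow, one_pow]
        field_simp
        try ring
    _ ≤ _ := by gcongr

theorem stmt18 :
    (∀ j : ℕ, 2 ≤ j → ∀ t : ℝ, t ∈ Set.Ioo (0 : ℝ) 1 →
      kappa j t =
        Real.pi ^ 2 * (Nat.factorial j : ℝ) / (6 * (-Real.log t) ^ (j + 1))
          - (Nat.factorial (j - 1) : ℝ) / (2 * (-Real.log t) ^ j) + Eterm j t) ∧
    (∀ j : ℕ, 2 ≤ j → ∃ C : ℝ, 0 < C ∧
      ∀ t : ℝ, t ∈ Set.Ioo (Real.exp (-Real.pi / 2)) 1 →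
        |Eterm j t| ≤
          C * Real.exp (-(4 * Real.pi ^ 2) / (-Real.log t)) / (-Real.log t) ^ (2 * j)) := by
  constructor
  · intro j hj t ht
    have h := main_eq kappa_diff (by
      intro t ht
      have hpos : 0 < -Real.log t := by have := Real.log_neg ht.1 ht.2; linarith
      have h := aux_transform (-Real.log t) hpos
      rw [neg_neg, Real.exp_log ht.1] at h
      change kappa1 t = _
      rw [h]
      have hk1 : kappa 1 = kappa1 := rfl
      simp only [FF, aa, TT, Finset.sum_range_one, hk1]
      generalize -Real.log t = x at *
      norm_num
      field_simp
      ring) (j - 1) t ht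
    rw [show j - 1 + 1 = j by omega, if_neg (by omega), add_zero] at h
    rw [h, FF, Eterm_eq]
  · intro j hj
    have hex : ∀ s : ℕ, ∃ C : ℝ, 0 < C ∧ (s < j → ∀ x : ℝ, 0 < x → x < π / 2 →
      |TT j (s+1) x| ≤ C * (Real.exp (-(4 * π ^ 2) / x) / x ^ (2 * j))) := by
      intro s
      by_cases hs : s < j
      · obtain ⟨C, hC, h⟩ := TT_bound j s hs
        exact ⟨C, hC, fun _ => h⟩
      · exact ⟨1, one_pos, fun h => absurd h hs⟩
    choose C hC hb using hex
    have hnn : 0 ≤ ∑ s ∈ Finset.range j, |aa j s| * C s :=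
      Finset.sum_nonneg fun s _ => mul_nonneg (abs_nonneg _) (hC s).le
    refine ⟨∑ s ∈ Finset.range j, |aa j s| * C s + 1, by linarith, fun t ht => ?_⟩
    have ht0 : 0 < t := (Real.exp_pos _).trans ht.1
    have hpos : 0 < -Real.log t := by have := Real.log_neg ht0 ht.2; linarith
    have hlt : -Real.log t < π / 2 := by
      have := (Real.lt_log_iff_exp_lt ht0).2 ht.1
      linarith
    rw [Eterm_eq, mul_div_assoc]
    generalize -Real.log t = x at *
    have hQ : 0 ≤ Real.exp (-(4 * π ^ 2) / x) / x ^ (2 * j) := by positivity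
    calc |∑ s ∈ Finset.range j, aa j s * TT j (s+1) x|
        ≤ ∑ s ∈ Finset.range j, |aa j s * TT j (s+1) x| := Finset.abs_sum_le_sum_abs _ _
      _ ≤ ∑ s ∈ Finset.range j, |aa j s| * C s * (Real.exp (-(4 * π ^ 2) / x) / x ^ (2 * j)) := by
          apply Finset.sum_le_sum
          intro s hs
          rw [abs_mul, mul_assoc]
          exact mul_le_mul_of_nonneg_left (hb s (Finset.mem_range.1 hs) x hpos hlt) (abs_nonneg _)
      _ = (∑ s ∈ Finset.range j, |aa j s| * C s) * (Real.exp (-(4 * π ^ 2) / x) / x ^ (2 * j)) := by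
          rw [Finset.sum_mul]
      _ ≤ _ := by
          apply mul_le_mul_of_nonneg_right _ hQ
          linarith
end
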